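/- arXiv:1404.0599 — 2 statements merged into one kernel-verified Lean document; each statement's English description precedes it below -/
import Mathlib

section
/- Let φ be a continuous flow on a compact metric space X. Then φ is kinematic expansive if and only if for every β > 0 there exists δ > 0 such that whenever x, y ∈ X satisfy dist(φ_t(x), φ_t(y)) < δ for all t ∈ ℝ, there exist z ∈ X and real numbers a ≤ b with x, y ∈ φ_{[a,b]}(z) and diam(φ_{[a,b]}(z)) < β. -/
open Metric Set Filter Topology

/-- A continuous flow on a metric space. -/
def IsFlow {X : Type*} [MetricSpace X] (φ : ℝ → X → X) : Prop :=
  Continuous (fun p : ℝ × X => φ p.1 p.2) ∧ (∀ x, φ 0 x = x) ∧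
    ∀ s t x, φ s (φ t x) = φ (s + t) x

/-- Kinematic expansiveness. -/
def KinematicExpansive {X : Type*} [MetricSpace X] (φ : ℝ → X → X) : Prop :=
  ∀ ε > (0 : ℝ), ∃ δ > (0 : ℝ), ∀ x y : X,
    (∀ t : ℝ, dist (φ t x) (φ t y) < δ) → ∃ s : ℝ, |s| < ε ∧ y = φ s x

namespace IsFlow

variable {X : Type*} [MetricSpace X] {φ : ℝ → X → X}

theorem continuous_map (hφ : IsFlow φ) (t : ℝ) : Continuous (φ t) :=
  hφ.1.comp (Continuous.prodMk_right t)

theorem continuous_orbit (hφ : IsFlow φ) (x : X) : Continuous fun t => φ t x :=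
  hφ.1.comp (Continuous.prodMk_left x)

theorem eq_neg_of_eq (hφ : IsFlow φ) {t : ℝ} {x y : X} (h : φ t x = y) : φ (-t) y = x := by
  rw [← h, hφ.2.2, neg_add_cancel, hφ.2.1]

theorem nat_mul_eq_self (hφ : IsFlow φ) {t : ℝ} {x : X} (h : φ t x = x) (n : ℕ) :
    φ (n * t) x = x := by
  induction n with
  | zero => simp [hφ.2.1]
  | succ n ih =>
    rw [Nat.cast_succ, add_mul, one_mul, ← hφ.2.2, h, ih]

/-- A point that is fixed during some time interval `[0, ε]` is fixed forever. -/
theorem fixed_of_fixed_on_Icc (hφ : IsFlow φ) {ε : ℝ} (hε : 0 < ε) {x : X}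
    (h : ∀ t ∈ Set.Icc 0 ε, φ t x = x) (t : ℝ) : φ t x = x := by
  have key : ∀ t : ℝ, 0 ≤ t → φ t x = x := by
    intro t ht
    obtain ⟨n, hn⟩ := exists_nat_gt (t / ε)
    have hn0 : (0 : ℝ) < n := lt_of_le_of_lt (by positivity) hn
    have h1 : φ (t / n) x = x := by
      refine h _ ⟨by positivity, ?_⟩
      rw [div_lt_iff₀ hε] at hn
      rw [div_le_iff₀ hn0]
      linarith
    have h2 := hφ.nat_mul_eq_self h1 n
    rwa [mul_div_cancel₀ _ hn0.ne'] at h2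
  rcases le_total 0 t with ht | ht
  · exact key t ht
  · simpa using hφ.eq_neg_of_eq (key (-t) (by linarith))

/-- Non-fixed points of a compact set move by a uniform amount, in both time directions. -/
theorem exists_uniform_displacement (hφ : IsFlow φ) {K : Set X} (hK : IsCompact K)
    (hfix : ∀ x ∈ K, ¬ ∀ t, φ t x = x) {ε : ℝ} (hε : 0 < ε) :
    ∃ β > 0, ∀ x ∈ K, ∃ t ∈ Set.Icc 0 ε, β ≤ dist (φ t x) x ∧ β ≤ dist (φ (-t) x) x := by
  refine hK.induction_on (p := fun S => ∃ β > 0, ∀ x ∈ S, ∃ t ∈ Set.Icc 0 ε,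
    β ≤ dist (φ t x) x ∧ β ≤ dist (φ (-t) x) x) ⟨1, one_pos, by simp⟩ ?_ ?_ ?_
  · rintro S T hST ⟨β, hβ, H⟩
    exact ⟨β, hβ, fun x hx => H x (hST hx)⟩
  · rintro S T ⟨β, hβ, H⟩ ⟨γ, hγ, G⟩
    refine ⟨min β γ, lt_min hβ hγ, ?_⟩
    rintro x (hx | hx)
    · obtain ⟨t, ht, h1, h2⟩ := H x hx
      exact ⟨t, ht, (min_le_left _ _).trans h1, (min_le_left _ _).trans h2⟩
    · obtain ⟨t, ht, h1, h2⟩ := G x hx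
      exact ⟨t, ht, (min_le_right _ _).trans h1, (min_le_right _ _).trans h2⟩
  · intro x hx
    obtain ⟨t, ht, hne⟩ : ∃ t ∈ Set.Icc 0 ε, φ t x ≠ x := by
      by_contra! hcon
      exact hfix x hx (hφ.fixed_of_fixed_on_Icc hε hcon)
    have hne' : φ (-t) x ≠ x := fun h => hne (by simpa using hφ.eq_neg_of_eq h)
    obtain ⟨β, hβ, hlt⟩ := exists_between (lt_min (dist_pos.2 hne) (dist_pos.2 hne'))
    have hev : ∀ s, β < dist (φ s x) x → ∀ᶠ y in 𝓝 x, β < dist (φ s y) y := fun s hs =>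
      continuousAt_const.eventually_lt ((hφ.continuous_map s).dist continuous_id).continuousAt hs
    refine ⟨_, mem_nhdsWithin_of_mem_nhds ((hev t (hlt.trans_le (min_le_left _ _))).and
      (hev (-t) (hlt.trans_le (min_le_right _ _)))), β, hβ, fun y hy => ?_⟩
    exact ⟨t, ht, hy.1.le, hy.2.le⟩

/-- On a compact space, points move little during short times. -/
theorem exists_uniform_time [CompactSpace X] (hφ : IsFlow φ) {η : ℝ} (hη : 0 < η) :
    ∃ ε > 0, ∀ s : ℝ, |s| < ε → ∀ x, dist (φ s x) x < η := by
  have h : ∀ᶠ s in 𝓝 (0 : ℝ), ∀ x ∈ (Set.univ : Set X), dist (φ s x) x < η := by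
    refine isCompact_univ.eventually_forall_of_forall_eventually fun x _ => ?_
    have hc : Continuous fun p : ℝ × X => dist (φ p.1 p.2) p.2 := hφ.1.dist continuous_snd
    refine hc.continuousAt.eventually_lt continuousAt_const ?_
    simpa [hφ.2.1] using hη
  obtain ⟨ε, hε, H⟩ := Metric.eventually_nhds_iff.1 h
  exact ⟨ε, hε, fun s hs x => H (by simpa using hs) x (Set.mem_univ x)⟩

end IsFlow

theorem stmt0 {X : Type*} [MetricSpace X] [CompactSpace X] (φ : ℝ → X → X)
    (hφ : IsFlow φ) :
    KinematicExpansive φ ↔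
      ∀ β > (0 : ℝ), ∃ δ > (0 : ℝ), ∀ x y : X,
        (∀ t : ℝ, dist (φ t x) (φ t y) < δ) →
        ∃ (z : X) (a b : ℝ), a ≤ b ∧
          x ∈ (fun t => φ t z) '' Set.Icc a b ∧
          y ∈ (fun t => φ t z) '' Set.Icc a b ∧
          Metric.diam ((fun t => φ t z) '' Set.Icc a b) < β := by
  constructor
  · intro h β hβ
    obtain ⟨ε, hε, hεs⟩ := hφ.exists_uniform_time (η := β / 3) (by positivity)
    obtain ⟨δ, hδ, H⟩ := h ε hε
    refine ⟨δ, hδ, fun x y hxy => ?_⟩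
    obtain ⟨s, hs, rfl⟩ := H x y hxy
    refine ⟨x, -|s|, |s|, by linarith [abs_nonneg s], ⟨0, by simp, hφ.2.1 x⟩,
      ⟨s, ⟨neg_abs_le s, le_abs_self s⟩, rfl⟩, ?_⟩
    refine lt_of_le_of_lt (Metric.diam_le_of_forall_dist_le (C := 2 * (β / 3)) (by positivity) ?_)
      (by linarith)
    rintro _ ⟨u, hu, rfl⟩ _ ⟨v, hv, rfl⟩
    have h1 := hεs u ((abs_le.2 hu).trans_lt hs) x
    have h2 := hεs v ((abs_le.2 hv).trans_lt hs) x
    have h3 := dist_triangle_right (φ u x) (φ v x) x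
    show dist (φ u x) (φ v x) ≤ _
    linarith
  · intro h ε hε
    have fixed_eq : ∀ {p z y : X} {a b : ℝ}, (∀ t, φ t p = p) →
        p ∈ (fun t => φ t z) '' Set.Icc a b → y ∈ (fun t => φ t z) '' Set.Icc a b → y = p := by
      rintro p z _ a b hp ⟨u, -, hu⟩ ⟨v, -, rfl⟩
      have hz : z = p := by rw [← hφ.eq_neg_of_eq hu, hp]
      simp [hz, hp]
    obtain ⟨δ₀, hδ₀, H₀⟩ := h 1 one_pos
    have near_fixed : ∀ p y : X, (∀ t, φ t p = p) → (∀ t, dist (φ t y) p < δ₀) → y = p := by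
      intro p y hp hy
      obtain ⟨z, a, b, -, h1, h2, -⟩ := H₀ p y fun t => by rw [hp, dist_comm]; exact hy t
      exact fixed_eq hp h1 h2
    set F : Set X := {p | ∀ t, φ t p = p} with hF
    set U : Set X := ⋃ p ∈ F, ball p (δ₀ / 2) with hU
    have hUo : IsOpen U := isOpen_biUnion fun _ _ => isOpen_ball
    have leaves : ∀ x, x ∉ F → ∃ t, φ t x ∈ Uᶜ := by
      intro x hx
      by_contra! hcon
      replace hcon : ∀ t, φ t x ∈ U := fun t => not_not.1 (hcon t)
      obtain ⟨p, hp, hxp⟩ := Set.mem_iUnion₂.1 (hcon 0)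
      have hsub : Set.range (fun t => φ t x) ⊆ ball p (δ₀ / 2) := by
        refine IsPreconnected.subset_left_of_subset_union (v := ⋃ q ∈ F \ {p}, ball q (δ₀ / 2))
          isOpen_ball (isOpen_biUnion fun _ _ => isOpen_ball) ?_ ?_ ⟨_, ⟨0, rfl⟩, hxp⟩
          (isPreconnected_range (hφ.continuous_orbit x))
        · rw [Set.disjoint_iUnion₂_right]
          rintro q ⟨hq, hqp⟩
          rw [Set.disjoint_left]
          intro w hwp hwq
          refine hqp (near_fixed p q hp fun t => ?_)
          rw [hq t]
          rw [mem_ball] at hwp hwq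
          linarith [dist_triangle_left q p w]
        · rintro _ ⟨t, rfl⟩
          obtain ⟨q, hq, hxq⟩ := Set.mem_iUnion₂.1 (hcon t)
          by_cases hqp : q = p
          · exact Or.inl (hqp ▸ hxq)
          · exact Or.inr (Set.mem_iUnion₂.2 ⟨q, ⟨hq, hqp⟩, hxq⟩)
      refine hx ((near_fixed p x hp fun t => ?_) ▸ hp)
      have := mem_ball.1 (hsub ⟨t, rfl⟩)
      linarith
    obtain ⟨β, hβ, hdisp⟩ := hφ.exists_uniform_displacement (K := Uᶜ) hUo.isClosed_compl.isCompact
      (fun x hx hfix => hx (Set.mem_iUnion₂.2 ⟨x, hfix, mem_ball_self (by positivity)⟩)) hε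
    obtain ⟨δ, hδ, H⟩ := h β hβ
    refine ⟨δ, hδ, fun x y hxy => ?_⟩
    by_cases hx : x ∈ F
    · obtain ⟨z, a, b, -, h1, h2, -⟩ := H x y hxy
      exact ⟨0, by simpa using hε, by rw [hφ.2.1]; exact fixed_eq hx h1 h2⟩
    · obtain ⟨t, ht⟩ := leaves x hx
      obtain ⟨z, a, b, -, ⟨c, hc, hcx⟩, ⟨d, hd, hdy⟩, hdiam⟩ := H (φ t x) (φ t y) fun s => by
        rw [hφ.2.2, hφ.2.2]; exact hxy _
      have hshift : ∀ u, φ (u + c) z = φ u (φ t x) := fun u => by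
        rw [← hcx]; exact (hφ.2.2 u c z).symm
      have hbdd : Bornology.IsBounded ((fun t => φ t z) '' Set.Icc a b) :=
        (isCompact_Icc.image (hφ.continuous_orbit z)).isBounded
      obtain ⟨τ, hτ, hp, hn⟩ := hdisp _ ht
      have hshort : ∀ u, u + c ∈ Set.Icc a b → dist (φ u (φ t x)) (φ t x) < β := fun u hu =>
        (Metric.dist_le_diam_of_mem hbdd ⟨u + c, hu, hshift u⟩ ⟨c, hc, hcx⟩).trans_lt hdiam
      refine ⟨d - c, ?_, ?_⟩
      · rw [abs_lt]
        constructor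
        · by_contra! hlt
          exact (hshort (-τ) ⟨by linarith [hd.1, hτ.2], by linarith [hc.2, hτ.1]⟩).not_ge hn
        · by_contra! hlt
          exact (hshort τ ⟨by linarith [hc.1, hτ.1], by linarith [hd.2, hτ.2]⟩).not_ge hp
      · have h1 : φ t y = φ (d - c) (φ t x) := by
          rw [← hshift, sub_add_cancel]; exact hdy.symm
        rw [← hφ.eq_neg_of_eq rfl (t := t) (x := y), h1, hφ.2.2, hφ.2.2]
        congr 1
        ring
end

section
/- A continuous flow on a compact surface is geometric separating if and only if it is geometric expansive. -/
open Metric Set Filter Topology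

/-- A geometric separating flow. -/
def GeomSeparating {X : Type*} [MetricSpace X] (φ : ℝ → X → X) : Prop :=
  ∃ δ > (0 : ℝ), ∀ x y : X, ∀ h : ℝ → ℝ,
    StrictMono h → Function.Surjective h → h 0 = 0 →
    (∀ t : ℝ, dist (φ (h t) x) (φ t y) < δ) → ∃ s : ℝ, y = φ s x

/-- A geometric expansive flow. -/
def GeomExpansive {X : Type*} [MetricSpace X] (φ : ℝ → X → X) : Prop :=
  ∀ β > (0 : ℝ), ∃ δ > (0 : ℝ), ∀ x y : X, ∀ h : ℝ → ℝ,
    StrictMono h → Function.Surjective h → h 0 = 0 →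
    (∀ t : ℝ, dist (φ (h t) x) (φ t y) < δ) →
    ∃ (z : X) (a b : ℝ), a ≤ b ∧
      x ∈ (fun t => φ t z) '' Set.Icc a b ∧
      y ∈ (fun t => φ t z) '' Set.Icc a b ∧
      Metric.diam ((fun t => φ t z) '' Set.Icc a b) < β

/-- A continuous function to `ℂ` whose exponential is `1` is constant on preconnected sets. -/
theorem eq_of_exp_eq_one_of_preconnected {α : Type*} [TopologicalSpace α] {s : Set α}
    (hs : IsPreconnected s) {f : α → ℂ} (hf : ContinuousOn f s)
    (h1 : ∀ x ∈ s, Complex.exp (f x) = 1) {x y : α} (hx : x ∈ s) (hy : y ∈ s) : f x = f y := by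
  have : DiscreteTopology (AddSubgroup.zmultiples (2 * Real.pi * Complex.I : ℂ)) :=
    NormedSpace.discreteTopology_zmultiples _
  refine hs.constant_of_mapsTo (T := (AddSubgroup.zmultiples (2 * Real.pi * Complex.I : ℂ) : Set ℂ))
    ⟨this⟩ hf (fun z hz => ?_) hx hy
  obtain ⟨n, hn⟩ := Complex.exp_eq_one_iff.1 (h1 z hz)
  exact AddSubgroup.mem_zmultiples_iff.2 ⟨n, by rw [hn]; simp⟩

/-- Continuous logarithms along an interval. -/
theorem exists_log_on_Icc {g : ℝ → ℂ} {a b : ℝ} (hab : a ≤ b) (hg : ContinuousOn g (Icc a b))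
    (h0 : ∀ t ∈ Icc a b, g t ≠ 0) :
    ∃ l : ℝ → ℂ, ContinuousOn l (Icc a b) ∧ ∀ t ∈ Icc a b, Complex.exp (l t) = g t := by
  have hc : Continuous (IccExtend hab ((Icc a b).domRestrict g)) :=
    (continuousOn_iff_continuous_domRestrict.1 hg).Icc_extend'
  have hsc : IsSimplyConnected (univ : Set ℝ) := by
    have := convex_univ.contractibleSpace (E := ℝ) univ_nonempty
    exact SimplyConnectedSpace.ofContractible _
  obtain ⟨f, hf, hf2⟩ := Complex.exists_continuousOn_eqOn_exp_comp hsc isOpen_univ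
    hc.continuousOn (by
      rintro ⟨t, -, ht⟩
      exact h0 _ (projIcc a b hab t).2 ht)
  refine ⟨f, hf.mono (subset_univ _), fun t ht => ?_⟩
  have := hf2 (mem_univ t)
  simpa [IccExtend_of_mem hab _ ht] using this

/-- Continuous logarithms on a rectangle. -/
theorem exists_log_on_rectangle {g : ℝ → ℝ → ℂ} {a b c d : ℝ} (hab : a ≤ b) (hcd : c ≤ d)
    (hg : ContinuousOn (fun p : ℝ × ℝ => g p.1 p.2) (Icc a b ×ˢ Icc c d))
    (h0 : ∀ s ∈ Icc a b, ∀ t ∈ Icc c d, g s t ≠ 0) :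
    ∃ l : ℝ → ℝ → ℂ, ContinuousOn (fun p : ℝ × ℝ => l p.1 p.2) (Icc a b ×ˢ Icc c d) ∧
      ∀ s ∈ Icc a b, ∀ t ∈ Icc c d, Complex.exp (l s t) = g s t := by
  have hc : Continuous (fun p : ℝ × ℝ => g (projIcc a b hab p.1) (projIcc c d hcd p.2)) := by
    refine hg.comp_continuous (f := fun p : ℝ × ℝ =>
      ((projIcc a b hab p.1 : ℝ), (projIcc c d hcd p.2 : ℝ))) ?_ ?_
    · have := continuous_projIcc (h := hab)
      have := continuous_projIcc (h := hcd)
      fun_prop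
    · exact fun p => ⟨(projIcc a b hab p.1).2, (projIcc c d hcd p.2).2⟩
  have hsc : IsSimplyConnected (univ : Set (ℝ × ℝ)) := by
    have := convex_univ.contractibleSpace (E := ℝ × ℝ) univ_nonempty
    exact SimplyConnectedSpace.ofContractible _
  obtain ⟨f, hf, hf2⟩ := Complex.exists_continuousOn_eqOn_exp_comp hsc isOpen_univ
    hc.continuousOn (by
      rintro ⟨t, -, ht⟩
      exact h0 _ (projIcc a b hab t.1).2 _ (projIcc c d hcd t.2).2 ht)
  refine ⟨fun s t => f (s, t), hf.mono (subset_univ _), fun s hs t ht => ?_⟩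
  have := hf2 (mem_univ (s, t))
  simpa [projIcc_of_mem hab hs, projIcc_of_mem hcd ht] using this

open Classical in
/-- The variation `l t - l s` of a continuous logarithm `l` of `g` between `s` and `t`. -/
noncomputable def logVar (g : ℝ → ℂ) (s t : ℝ) : ℂ :=
  if h : ∃ l : ℝ → ℂ, ContinuousOn l (uIcc s t) ∧ ∀ r ∈ uIcc s t, Complex.exp (l r) = g r then
    h.choose t - h.choose s else 0

theorem logVar_eq {g l : ℝ → ℂ} {s t : ℝ} (hl : ContinuousOn l (uIcc s t))
    (he : ∀ r ∈ uIcc s t, Complex.exp (l r) = g r) : logVar g s t = l t - l s := by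
  have h : ∃ l : ℝ → ℂ, ContinuousOn l (uIcc s t) ∧ ∀ r ∈ uIcc s t, Complex.exp (l r) = g r :=
    ⟨l, hl, he⟩
  rw [logVar, dif_pos h]
  have := eq_of_exp_eq_one_of_preconnected (isPreconnected_uIcc (a := s) (b := t))
    (h.choose_spec.1.sub hl) (fun r hr => by
      have h0 : g r ≠ 0 := he r hr ▸ Complex.exp_ne_zero _
      simp [Complex.exp_sub, he r hr, h.choose_spec.2 r hr, h0])
    (left_mem_uIcc (a := s) (b := t)) right_mem_uIcc
  rw [Pi.sub_apply, Pi.sub_apply] at this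
  linear_combination -this

theorem exists_log_on_uIcc {g : ℝ → ℂ} {s t : ℝ} (hg : ContinuousOn g (uIcc s t))
    (h0 : ∀ r ∈ uIcc s t, g r ≠ 0) :
    ∃ l : ℝ → ℂ, ContinuousOn l (uIcc s t) ∧ ∀ r ∈ uIcc s t, Complex.exp (l r) = g r :=
  exists_log_on_Icc inf_le_sup hg h0

theorem exp_logVar {g : ℝ → ℂ} {s t : ℝ} (hg : ContinuousOn g (uIcc s t))
    (h0 : ∀ r ∈ uIcc s t, g r ≠ 0) : Complex.exp (logVar g s t) = g t / g s := by
  obtain ⟨l, hl, he⟩ := exists_log_on_uIcc hg h0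
  rw [logVar_eq hl he, Complex.exp_sub, he _ left_mem_uIcc, he _ right_mem_uIcc]

theorem logVar_add {g : ℝ → ℂ} {a b s t u : ℝ} (hg : ContinuousOn g (Icc a b))
    (h0 : ∀ r ∈ Icc a b, g r ≠ 0) (hs : s ∈ Icc a b) (ht : t ∈ Icc a b) (hu : u ∈ Icc a b) :
    logVar g s t + logVar g t u = logVar g s u := by
  obtain ⟨l, hl, he⟩ := exists_log_on_Icc (hs.1.trans hs.2) hg h0
  have key : ∀ {x y}, x ∈ Icc a b → y ∈ Icc a b → logVar g x y = l y - l x := fun hx hy =>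
    logVar_eq (hl.mono (uIcc_subset_Icc hx hy)) (fun r hr => he r (uIcc_subset_Icc hx hy hr))
  rw [key hs ht, key ht hu, key hs hu]; ring

theorem logVar_add' {g : ℝ → ℂ} {s t u : ℝ} (hg : ContinuousOn g (uIcc s t))
    (hg' : ContinuousOn g (uIcc t u)) (h0 : ∀ r ∈ uIcc s t, g r ≠ 0)
    (h0' : ∀ r ∈ uIcc t u, g r ≠ 0) :
    logVar g s t + logVar g t u = logVar g s u := by
  have hsub : Icc (min s (min t u)) (max s (max t u)) ⊆ uIcc s t ∪ uIcc t u := by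
    intro r hr
    simp only [mem_Icc, mem_union, mem_uIcc, min_le_iff, le_max_iff] at hr ⊢
    grind
  refine logVar_add (a := min s (min t u)) (b := max s (max t u))
    ((hg.union_of_isClosed hg' isClosed_Icc isClosed_Icc).mono hsub)
    (fun r hr => (hsub hr).elim (h0 r) (h0' r)) ?_ ?_ ?_ <;> simp

theorem logVar_div {f g : ℝ → ℂ} {s t : ℝ} (hf : ContinuousOn f (uIcc s t))
    (hf0 : ∀ r ∈ uIcc s t, f r ≠ 0) (hg : ContinuousOn g (uIcc s t))
    (h0 : ∀ r ∈ uIcc s t, g r ≠ 0) :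
    logVar (fun r => f r / g r) s t = logVar f s t - logVar g s t := by
  obtain ⟨l, hl, he⟩ := exists_log_on_uIcc hg h0
  obtain ⟨m, hm, hme⟩ := exists_log_on_uIcc hf hf0
  rw [logVar_eq hl he, logVar_eq hm hme, logVar_eq (hm.sub hl) fun r hr => by
    rw [Pi.sub_apply, Complex.exp_sub, he r hr, hme r hr]]
  rw [Pi.sub_apply, Pi.sub_apply]; ring

theorem logVar_div_const {g : ℝ → ℂ} {s t : ℝ} {c : ℂ} (hc : c ≠ 0)
    (hg : ContinuousOn g (uIcc s t)) (h0 : ∀ r ∈ uIcc s t, g r ≠ 0) :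
    logVar (fun r => g r / c) s t = logVar g s t := by
  rw [logVar_div hg h0 continuousOn_const (fun _ _ => hc),
    logVar_eq (g := fun _ => c) (l := fun _ => Complex.log c) continuousOn_const
      (fun _ _ => Complex.exp_log hc)]
  ring

theorem logVar_eq_log {g : ℝ → ℂ} {s t : ℝ} (hg : ContinuousOn g (uIcc s t))
    (h0 : ∀ r ∈ uIcc s t, g r ∈ Complex.slitPlane) :
    logVar g s t = Complex.log (g t) - Complex.log (g s) :=
  logVar_eq (l := fun r => Complex.log (g r)) (hg.clog h0)
    fun r hr => Complex.exp_log (Complex.slitPlane_ne_zero (h0 r hr))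

theorem logVar_congr {f g : ℝ → ℂ} {s t : ℝ} (hg : ContinuousOn g (uIcc s t))
    (h0 : ∀ r ∈ uIcc s t, g r ≠ 0) (h : EqOn f g (uIcc s t)) :
    logVar f s t = logVar g s t := by
  obtain ⟨l, hl, he⟩ := exists_log_on_uIcc hg h0
  rw [logVar_eq hl he, logVar_eq hl fun r hr => (he r hr).trans (h hr).symm]

theorem logVar_swap {g : ℝ → ℂ} {s t : ℝ} (hg : ContinuousOn g (uIcc s t))
    (h0 : ∀ r ∈ uIcc s t, g r ≠ 0) : logVar g t s = - logVar g s t := by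
  obtain ⟨l, hl, he⟩ := exists_log_on_uIcc hg h0
  rw [logVar_eq hl he, logVar_eq (s := t) (t := s) (by rwa [uIcc_comm]) (by rwa [uIcc_comm])]
  ring

/-- `logVar (γ - z) s t` is continuous in `z` off the curve. -/
theorem continuousAt_logVar_sub {γ : ℝ → ℂ} {s t : ℝ} (hγ : ContinuousOn γ (uIcc s t)) {z : ℂ}
    (hz : ∀ r ∈ uIcc s t, γ r ≠ z) :
    ContinuousAt (fun w => logVar (fun r => γ r - w) s t) z := by
  obtain ⟨μ, hμ, hμ'⟩ : ∃ μ > 0, ∀ r ∈ uIcc s t, μ ≤ ‖γ r - z‖ := by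
    obtain ⟨r, hr, hmin⟩ := isCompact_uIcc.exists_isMinOn (nonempty_uIcc (a := s) (b := t))
      (f := fun r => ‖γ r - z‖) (by fun_prop)
    exact ⟨_, norm_pos_iff.2 (sub_ne_zero.2 (hz r hr)), fun r' hr' => hmin hr'⟩
  have hre : ∀ w ∈ ball z μ, ∀ r ∈ uIcc s t, (γ r - w) / (γ r - z) ∈ Complex.slitPlane := by
    intro w hw r hr
    apply Complex.ball_one_subset_slitPlane
    have h0 : γ r - z ≠ 0 := sub_ne_zero.2 (hz r hr)
    rw [mem_ball, dist_eq_norm, div_sub_one h0, norm_div, div_lt_one (norm_pos_iff.2 h0)]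
    refine lt_of_lt_of_le ?_ (hμ' r hr)
    rw [mem_ball, dist_eq_norm, norm_sub_rev] at hw
    simpa using hw
  have heq : (fun w => logVar (fun r => γ r - w) s t) =ᶠ[𝓝 z] fun w =>
      logVar (fun r => γ r - z) s t + (Complex.log ((γ t - w) / (γ t - z)) -
        Complex.log ((γ s - w) / (γ s - z))) := by
    filter_upwards [ball_mem_nhds z hμ] with w hw
    have h0 : ∀ r ∈ uIcc s t, γ r - z ≠ 0 := fun r hr => sub_ne_zero.2 (hz r hr)
    rw [← logVar_eq_log (g := fun r => (γ r - w) / (γ r - z))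
        (ContinuousOn.div (by fun_prop) (by fun_prop) h0) (hre w hw),
      logVar_div (by fun_prop) (fun r hr h => ?_) (by fun_prop) h0]
    · ring
    · have := Complex.slitPlane_ne_zero (hre w hw r hr)
      simp [h] at this
  refine ContinuousAt.congr ?_ heq.symm
  have h1 := sub_ne_zero.2 (hz s left_mem_uIcc)
  have h2 := sub_ne_zero.2 (hz t right_mem_uIcc)
  have h3 : ∀ r ∈ uIcc s t, ContinuousAt (fun w => Complex.log ((γ r - w) / (γ r - z))) z :=
    fun r hr => ContinuousAt.clog (by fun_prop) (hre z (mem_ball_self hμ) r hr)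
  exact continuousAt_const.add ((h3 t right_mem_uIcc).sub (h3 s left_mem_uIcc))

theorem log_div_of_re_pos {u v : ℂ} (hu : 0 < u.re) (hv : 0 < v.re) :
    Complex.log (u / v) = Complex.log u - Complex.log v := by
  have hu0 : u ≠ 0 := by rintro rfl; simp at hu
  have hv0 : v ≠ 0 := by rintro rfl; simp at hv
  have h1 := abs_lt.1 (Complex.abs_arg_lt_pi_div_two_iff.2 (Or.inl hu))
  have h2 := abs_lt.1 (Complex.abs_arg_lt_pi_div_two_iff.2 (Or.inl hv))
  rw [← Complex.log_exp (x := Complex.log u - Complex.log v), Complex.exp_sub, Complex.exp_log hu0,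
    Complex.exp_log hv0]
  · simp only [Complex.sub_im, Complex.log_im]; linarith [h1.1, h2.2]
  · simp only [Complex.sub_im, Complex.log_im]; linarith [h1.2, h2.1, Real.pi_pos]

/-- The quotient `(b - z) / (a - z)` avoids the branch cut unless `z` is on the segment. -/
theorem div_mem_slitPlane_of_notMem_segment {a b z : ℂ} (hz : z ∉ segment ℝ a b) :
    (b - z) / (a - z) ∈ Complex.slitPlane := by
  by_contra h
  rw [Complex.mem_slitPlane_iff_not_le_zero, not_not] at h
  apply hz
  by_cases ha : a - z = 0
  · rw [← sub_eq_zero.1 ha]; exact left_mem_segment ℝ a b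
  obtain ⟨c, hc⟩ : ∃ c : ℝ, (b - z) / (a - z) = -(c : ℂ) := by
    refine ⟨-((b - z) / (a - z)).re, ?_⟩
    apply Complex.ext
    · simp
    · simpa using (Complex.le_def.1 h).2
  have hc0 : 0 ≤ c := by
    have := (Complex.le_def.1 h).1
    rw [hc] at this
    simpa using this
  have hne : (1 + c : ℂ) ≠ 0 := by
    norm_cast; positivity
  refine ⟨c / (1 + c), 1 / (1 + c), by positivity, by positivity, by field_simp; ring, ?_⟩
  have : b - z = -c * (a - z) := by rw [← hc]; field_simp
  simp only [Complex.real_smul]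
  push_cast
  field_simp
  linear_combination this

/-- A nonvanishing function along an interval whose logarithmic variation is the difference of the
principal logarithms at the ends. -/
def LogTrivial (q : ℝ → ℂ) (s t : ℝ) : Prop :=
  logVar q s t = Complex.log (q t) - Complex.log (q s)

theorem logTrivial_congr {f g : ℝ → ℂ} {s t : ℝ} (hg : ContinuousOn g (uIcc s t))
    (h0 : ∀ r ∈ uIcc s t, g r ≠ 0) (h : EqOn f g (uIcc s t)) :
    LogTrivial f s t ↔ LogTrivial g s t := by
  rw [LogTrivial, LogTrivial, logVar_congr hg h0 h, h left_mem_uIcc, h right_mem_uIcc]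

/-- Changing the window by end pieces on which `q` is in the slit plane does not matter. -/
theorem logTrivial_window_iff {q : ℝ → ℂ} {a b s t s' t' : ℝ} (hq : ContinuousOn q (Icc a b))
    (h0 : ∀ r ∈ Icc a b, q r ≠ 0) (hs : s ∈ Icc a b) (ht : t ∈ Icc a b) (hs' : s' ∈ Icc a b)
    (ht' : t' ∈ Icc a b) (h1 : ∀ r ∈ uIcc s s', q r ∈ Complex.slitPlane)
    (h2 : ∀ r ∈ uIcc t t', q r ∈ Complex.slitPlane) :
    LogTrivial q s t ↔ LogTrivial q s' t' := by
  have e1 := logVar_add hq h0 hs hs' ht'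
  have e2 := logVar_add hq h0 hs ht ht'
  rw [logVar_eq_log (hq.mono (uIcc_subset_Icc hs hs')) h1] at e1
  rw [logVar_eq_log (hq.mono (uIcc_subset_Icc ht ht')) h2] at e2
  unfold LogTrivial
  constructor <;> intro h
  · linear_combination e1 - e2 + h
  · linear_combination e2 - e1 + h

/-- Homotopy invariance, with ends staying in the slit plane. -/
theorem logTrivial_homotopy {q : ℝ → ℝ → ℂ} {s t : ℝ} (hst : s ≤ t)
    (hq : ContinuousOn (fun p : ℝ × ℝ => q p.1 p.2) (Icc 0 1 ×ˢ Icc s t))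
    (h0 : ∀ u ∈ Icc (0 : ℝ) 1, ∀ r ∈ Icc s t, q u r ≠ 0)
    (h1 : ∀ u ∈ Icc (0 : ℝ) 1, q u s ∈ Complex.slitPlane)
    (h2 : ∀ u ∈ Icc (0 : ℝ) 1, q u t ∈ Complex.slitPlane) :
    LogTrivial (q 0) s t ↔ LogTrivial (q 1) s t := by
  obtain ⟨l, hl, he⟩ := exists_log_on_rectangle zero_le_one hst hq h0
  have hs : s ∈ Icc s t := left_mem_Icc.2 hst
  have ht : t ∈ Icc s t := right_mem_Icc.2 hst
  have key : ∀ u ∈ Icc (0 : ℝ) 1, logVar (q u) s t = l u t - l u s := by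
    intro u hu
    rw [← uIcc_of_le hst] at hl he
    refine logVar_eq (hl.comp (f := fun r => (u, r)) (by fun_prop) fun r hr => ⟨hu, hr⟩)
      fun r hr => he u hu r hr
  have hlr : ∀ r ∈ Icc s t, ContinuousOn (fun u => l u r) (Icc 0 1) := fun r hr =>
    hl.comp (f := fun u => (u, r)) (by fun_prop) fun u hu => ⟨hu, hr⟩
  have hqr : ∀ r ∈ Icc s t, ContinuousOn (fun u => q u r) (Icc 0 1) := fun r hr =>
    hq.comp (f := fun u => (u, r)) (by fun_prop) fun u hu => ⟨hu, hr⟩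
  have := eq_of_exp_eq_one_of_preconnected (isPreconnected_Icc (a := (0 : ℝ)) (b := 1))
    (f := fun u => l u t - l u s - (Complex.log (q u t) - Complex.log (q u s)))
    (((hlr t ht).sub (hlr s hs)).sub (((hqr t ht).clog h2).sub ((hqr s hs).clog h1)))
    (fun u hu => by
      have a1 := h0 u hu s hs
      have a2 := h0 u hu t ht
      simp only [Complex.exp_sub, he u hu s hs, he u hu t ht, Complex.exp_log a1,
        Complex.exp_log a2]
      field_simp)
    (left_mem_Icc.2 zero_le_one) (right_mem_Icc.2 zero_le_one)
  unfold LogTrivial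
  rw [key 0 (by simp), key 1 (by simp)]
  constructor <;> intro h
  · linear_combination h - this
  · linear_combination h + this

/-- The defect of closing up the loop from `x α` along `x` to `x τ`, to `y τ`, back along `y` to
`y α'` and back to `x α`, as seen from `z`. -/
noncomputable def loopDefect (x y : ℝ → ℂ) (α α' τ : ℝ) (z : ℂ) : ℂ :=
  logVar (fun r => x r - z) α τ + Complex.log ((y τ - z) / (x τ - z)) -
    logVar (fun r => y r - z) α' τ - Complex.log ((y α' - z) / (x α - z))

section

variable {x y : ℝ → ℂ} {α α' τ : ℝ} {z : ℂ}

theorem exp_loopDefect (hx : ContinuousOn x (uIcc α τ)) (hy : ContinuousOn y (uIcc α' τ))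
    (hxz : ∀ r ∈ uIcc α τ, x r ≠ z) (hyz : ∀ r ∈ uIcc α' τ, y r ≠ z) :
    Complex.exp (loopDefect x y α α' τ z) = 1 := by
  have hx' : ∀ r ∈ uIcc α τ, x r - z ≠ 0 := fun r hr => sub_ne_zero.2 (hxz r hr)
  have hy' : ∀ r ∈ uIcc α' τ, y r - z ≠ 0 := fun r hr => sub_ne_zero.2 (hyz r hr)
  have h1 := hx' _ left_mem_uIcc
  have h2 := hx' _ right_mem_uIcc
  have h3 := hy' _ left_mem_uIcc
  have h4 := hy' _ right_mem_uIcc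
  rw [loopDefect, Complex.exp_sub, Complex.exp_sub, Complex.exp_add,
    exp_logVar (by fun_prop) hx', exp_logVar (by fun_prop) hy',
    Complex.exp_log (div_ne_zero h4 h2), Complex.exp_log (div_ne_zero h3 h1)]
  field_simp

theorem continuousAt_log_div {a b : ℂ} (h : z ∉ segment ℝ a b) :
    ContinuousAt (fun w => Complex.log ((b - w) / (a - w))) z := by
  refine ContinuousAt.clog ?_ (div_mem_slitPlane_of_notMem_segment h)
  refine ContinuousAt.div (by fun_prop) (by fun_prop) (sub_ne_zero.2 ?_)
  rintro rfl
  exact h (left_mem_segment ℝ a b)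

theorem continuousAt_loopDefect (hx : ContinuousOn x (uIcc α τ)) (hy : ContinuousOn y (uIcc α' τ))
    (hxz : ∀ r ∈ uIcc α τ, x r ≠ z) (hyz : ∀ r ∈ uIcc α' τ, y r ≠ z)
    (h1 : z ∉ segment ℝ (x τ) (y τ)) (h2 : z ∉ segment ℝ (x α) (y α')) :
    ContinuousAt (loopDefect x y α α' τ) z :=
  (((continuousAt_logVar_sub hx hxz).add (continuousAt_log_div h1)).sub
    (continuousAt_logVar_sub hy hyz)).sub (continuousAt_log_div h2)

theorem loopDefect_eq_zero_of_far (hx : ContinuousOn x (uIcc α τ))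
    (hy : ContinuousOn y (uIcc α' τ)) {R : ℝ} (hxz : ∀ r ∈ uIcc α τ, ‖x r‖ ≤ R)
    (hyz : ∀ r ∈ uIcc α' τ, ‖y r‖ ≤ R) (hz : R < ‖z‖) : loopDefect x y α α' τ z = 0 := by
  have hz0 : 0 < ‖z‖ := ((norm_nonneg _).trans (hxz _ left_mem_uIcc)).trans_lt hz
  have hz' : z ≠ 0 := norm_pos_iff.1 hz0
  have key : ∀ w : ℂ, ‖w‖ ≤ R → 0 < ((w - z) / (-z)).re := by
    intro w hw
    have : (w - z) / (-z) = 1 - w / z := by field_simp; ring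
    rw [this]
    have h1 : ‖w / z‖ < 1 := by
      rw [norm_div, div_lt_one hz0]; exact hw.trans_lt hz
    have := (Complex.abs_re_le_norm (w / z)).trans_lt h1
    simp only [Complex.sub_re, Complex.one_re]
    linarith [(abs_lt.1 this).2]
  have hne : ∀ w : ℂ, ‖w‖ ≤ R → w - z ≠ 0 := by
    intro w hw h
    have := key w hw
    simp [h] at this
  have e : ∀ {γ : ℝ → ℂ} {s t : ℝ}, ContinuousOn γ (uIcc s t) → (∀ r ∈ uIcc s t, ‖γ r‖ ≤ R) →
      logVar (fun r => γ r - z) s t =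
        Complex.log ((γ t - z) / (-z)) - Complex.log ((γ s - z) / (-z)) := by
    intro γ s t hγ hR
    rw [← logVar_div_const (neg_ne_zero.2 hz') (by fun_prop) fun r hr => hne _ (hR r hr),
      logVar_eq_log (by fun_prop) fun r hr => Or.inl (key _ (hR r hr))]
  have e2 : ∀ u v : ℂ, ‖u‖ ≤ R → ‖v‖ ≤ R → Complex.log ((u - z) / (v - z)) =
      Complex.log ((u - z) / (-z)) - Complex.log ((v - z) / (-z)) := by
    intro u v hu hv
    rw [← log_div_of_re_pos (key u hu) (key v hv)]
    congr 1
    have := hne v hv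
    field_simp
  rw [loopDefect, e hx hxz, e hy hyz, e2 _ _ (hyz _ right_mem_uIcc) (hxz _ right_mem_uIcc),
    e2 _ _ (hyz _ left_mem_uIcc) (hxz _ left_mem_uIcc)]
  ring

theorem div_mem_slitPlane_of_norm_lt {u v z : ℂ} (h : ‖u - v‖ < ‖v - z‖) :
    (u - z) / (v - z) ∈ Complex.slitPlane := by
  apply Complex.ball_one_subset_slitPlane
  have h0 : 0 < ‖v - z‖ := (norm_nonneg _).trans_lt h
  rw [mem_ball, dist_eq_norm, div_sub_one (norm_pos_iff.1 h0), norm_div, div_lt_one h0]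
  simpa using h

theorem loopDefect_eq_zero_of_close (hx : ContinuousOn x (uIcc α τ))
    (hy : ContinuousOn y (uIcc α τ)) (hy' : ContinuousOn y (uIcc α α'))
    (h1 : ∀ r ∈ uIcc α τ, ‖y r - x r‖ < ‖x r - z‖)
    (h2 : ∀ r ∈ uIcc α α', ‖y r - x α‖ < ‖x α - z‖) : loopDefect x y α α' τ z = 0 := by
  have hx0 : ∀ r ∈ uIcc α τ, x r - z ≠ 0 := fun r hr =>
    norm_pos_iff.1 ((norm_nonneg _).trans_lt (h1 r hr))
  have hs1 := fun r hr => div_mem_slitPlane_of_norm_lt (h1 r hr)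
  have hs2 := fun r hr => div_mem_slitPlane_of_norm_lt (h2 r hr)
  have hy0 : ∀ r ∈ uIcc α τ, y r - z ≠ 0 := fun r hr h =>
    Complex.slitPlane_ne_zero (hs1 r hr) (by simp [h])
  have hy0' : ∀ r ∈ uIcc α α', y r - z ≠ 0 := fun r hr h =>
    Complex.slitPlane_ne_zero (hs2 r hr) (by simp [h])
  have hc := hx0 α left_mem_uIcc
  have e1 : logVar (fun r => y r - z) α α' + logVar (fun r => y r - z) α' τ =
      logVar (fun r => y r - z) α τ := by
    have := logVar_add' (g := fun r => y r - z) (s := α') (t := α) (u := τ)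
      (by rw [uIcc_comm]; fun_prop) (by fun_prop) (by rwa [uIcc_comm]) hy0
    rw [← this, logVar_swap (s := α) (by fun_prop) hy0']
    ring
  have e2 := logVar_div (f := fun r => y r - z) (g := fun r => x r - z) (s := α) (t := τ)
    (by fun_prop) hy0 (by fun_prop) hx0
  rw [logVar_eq_log (g := fun r => (y r - z) / (x r - z))
    (ContinuousOn.div (by fun_prop) (by fun_prop) hx0) hs1] at e2
  have e3 := logVar_div_const (g := fun r => y r - z) (s := α) (t := α') hc (by fun_prop) hy0'
  rw [logVar_eq_log (by fun_prop) hs2] at e3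
  rw [loopDefect]
  linear_combination e2 - e1 - e3

end

/-- The principal logarithm of `(b - z) / (a - z)` jumps across the segment `[a, b]`. -/
theorem not_continuousAt_log_div_midpoint {a b : ℂ} (hab : a ≠ b) {F : ℂ → ℂ}
    (hF : ContinuousAt F (midpoint ℝ a b))
    (h : ∀ᶠ z in 𝓝 (midpoint ℝ a b), z ∉ segment ℝ a b →
      F z = Complex.log ((b - z) / (a - z))) : False := by
  set m := midpoint ℝ a b with hm
  have hm' : m = (a + b) / 2 := by
    rw [hm, midpoint_eq_smul_add, Complex.real_smul, invOf_eq_inv]; push_cast; ring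
  have hd : b - a ≠ 0 := sub_ne_zero.2 hab.symm
  set p : ℝ → ℂ := fun s => m + s * Complex.I * (b - a) with hp
  have hpc : Continuous p := by fun_prop
  have hp0 : p 0 = m := by simp [hp]
  have hquot : ∀ s : ℝ, (b - p s) / (a - p s) =
      ((-(1 / 4 - s ^ 2) / (1 / 4 + s ^ 2) : ℝ) : ℂ) + ((s / (1 / 4 + s ^ 2) : ℝ) : ℂ) * Complex.I := by
    intro s
    have hne : ((1 : ℂ) / 4 + s ^ 2) ≠ 0 := by
      have : (0 : ℝ) < 1 / 4 + s ^ 2 := by positivity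
      intro h0
      apply this.ne'
      have h2 : (((1 / 4 + s ^ 2 : ℝ)) : ℂ) = 0 := by push_cast; exact h0
      exact Complex.ofReal_eq_zero.1 h2
    have h1 : ((1 : ℂ) / 2 + s * Complex.I) ≠ 0 := by
      intro h0
      have := congrArg Complex.re h0
      norm_num at this
    have e1 : b - p s = (1 / 2 - s * Complex.I) * (b - a) := by simp only [hp, hm']; ring
    have e2 : a - p s = -(1 / 2 + s * Complex.I) * (b - a) := by simp only [hp, hm']; ring
    rw [e1, e2, mul_div_mul_right _ _ hd, div_eq_iff (neg_ne_zero.2 h1)]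
    push_cast
    rw [div_mul_eq_mul_div, ← add_div, div_mul_eq_mul_div, eq_div_iff hne]
    linear_combination (s ^ 2 : ℂ) * Complex.I_sq
  have him : ∀ s : ℝ, ((b - p s) / (a - p s)).im = s / (1 / 4 + s ^ 2) := by
    intro s; rw [hquot]; simp only [Complex.add_im, Complex.ofReal_im, Complex.im_ofReal_mul,
    Complex.I_im]; ring
  have hre : ∀ s : ℝ, ((b - p s) / (a - p s)).re = -(1 / 4 - s ^ 2) / (1 / 4 + s ^ 2) := by
    intro s; rw [hquot]; simp only [Complex.add_re, Complex.ofReal_re, Complex.re_ofReal_mul, Complex.I_re]; ring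
  have hoff : ∀ s : ℝ, s ≠ 0 → p s ∉ segment ℝ a b := by
    rintro s hs ⟨c, d, hc, hd', hcd, he⟩
    have h1 : (c + d - 1 : ℂ) = 0 := by rw [← Complex.ofReal_add, hcd]; simp
    have h2 : ((d : ℂ) - 1 / 2 - s * Complex.I) * (b - a) = 0 := by
      simp only [hp, hm', Complex.real_smul] at he
      linear_combination he - a * h1
    have := congrArg Complex.im ((mul_eq_zero.1 h2).resolve_right hd)
    norm_num at this
    exact hs this
  have hF' : Tendsto (fun s => (F (p s)).im) (𝓝 0) (𝓝 (F m).im) := by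
    have h1 : Tendsto p (𝓝 0) (𝓝 m) := hp0 ▸ hpc.tendsto 0
    exact (Complex.continuous_im.tendsto _).comp (hF.tendsto.comp h1)
  have hev : ∀ᶠ s in 𝓝 (0 : ℝ), s ≠ 0 → (F (p s)).im = ((b - p s) / (a - p s)).arg := by
    have h1 : Tendsto p (𝓝 0) (𝓝 m) := hp0 ▸ hpc.tendsto 0
    filter_upwards [h1.eventually h] with s hs hs0
    rw [hs (hoff s hs0), Complex.log_im]
  have hsm : ∀ᶠ s in 𝓝 (0 : ℝ), |s| < 1 / 4 := by
    have := continuous_abs.tendsto (0 : ℝ)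
    rw [abs_zero] at this
    exact this.eventually (gt_mem_nhds (by norm_num))
  have hneg : ∀ s : ℝ, |s| < 1 / 4 → ((b - p s) / (a - p s)).re < 0 := by
    intro s hs
    rw [hre]
    have := abs_lt.1 hs
    apply div_neg_of_neg_of_pos <;> nlinarith
  have hup : Real.pi / 2 ≤ (F m).im := by
    refine ge_of_tendsto (hF'.mono_left nhdsWithin_le_nhds : Tendsto _ (𝓝[>] (0 : ℝ)) _) ?_
    filter_upwards [nhdsWithin_le_nhds hev, nhdsWithin_le_nhds hsm, self_mem_nhdsWithin] with s h1 h2 h3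
    rw [h1 (ne_of_gt h3)]
    by_contra hlt
    push Not at hlt
    have h4 : 0 ≤ ((b - p s) / (a - p s)).arg := by
      rw [Complex.arg_nonneg_iff, him]
      exact div_nonneg (le_of_lt h3) (by positivity)
    have := Complex.abs_arg_lt_pi_div_two_iff.1 (abs_lt.2 ⟨by linarith [Real.pi_pos], hlt⟩)
    rcases this with h | h
    · linarith [hneg s h2]
    · have := hneg s h2; rw [h] at this; simp at this
  have hdown : (F m).im ≤ -(Real.pi / 2) := by
    refine le_of_tendsto (hF'.mono_left nhdsWithin_le_nhds : Tendsto _ (𝓝[<] (0 : ℝ)) _) ?_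
    filter_upwards [nhdsWithin_le_nhds hev, nhdsWithin_le_nhds hsm, self_mem_nhdsWithin] with s h1 h2 h3
    rw [h1 (ne_of_lt h3)]
    by_contra hlt
    push Not at hlt
    have h4 : ((b - p s) / (a - p s)).arg < 0 := by
      rw [Complex.arg_neg_iff, him]
      exact div_neg_of_neg_of_pos h3 (by positivity)
    have := Complex.abs_arg_lt_pi_div_two_iff.1 (abs_lt.2 ⟨hlt, by linarith [Real.pi_pos]⟩)
    rcases this with h | h
    · linarith [hneg s h2]
    · have := hneg s h2; rw [h] at this; simp at this
  linarith [Real.pi_pos]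

/-- Two disjoint arcs `x`, `y` over `[[τ, τ']]`, uniformly `ρ`-close to each other, which are joined
by a straight segment from `x α` to `y α'` that does not meet them otherwise, and whose ends are far
from the remaining parts. -/
structure JoinedArcs (x y : ℝ → ℂ) (τ τ' α α' ρ : ℝ) : Prop where
  hx : ContinuousOn x (uIcc τ τ')
  hy : ContinuousOn y (uIcc τ τ')
  hα : α ∈ uIcc τ τ'
  hα' : α' ∈ uIcc τ τ'
  injx : InjOn x (uIcc τ τ')
  injy : InjOn y (uIcc τ τ')
  disj : ∀ s ∈ uIcc τ τ', ∀ t ∈ uIcc τ τ', x s ≠ y t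
  segx : ∀ t ∈ uIcc τ τ', x t ∈ segment ℝ (x α) (y α') → t = α
  segy : ∀ t ∈ uIcc τ τ', y t ∈ segment ℝ (x α) (y α') → t = α'
  close : ∀ t ∈ uIcc τ τ', ‖y t - x t‖ < ρ
  closeα : ∀ t ∈ uIcc α α', ‖y t - x α‖ < ρ
  far : ∀ t ∈ uIcc α τ, 10 * ρ ≤ ‖x t - x τ'‖
  far' : ∀ t ∈ uIcc α τ', 10 * ρ ≤ ‖x t - x τ‖

theorem isPreconnected_uIcc_sdiff_left (a b : ℝ) : IsPreconnected (uIcc a b \ {a}) := by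
  rcases le_total a b with h | h
  · rw [uIcc_of_le h, Icc_sdiff_left]; exact isPreconnected_Ioc
  · rw [uIcc_of_ge h, Icc_sdiff_right]; exact isPreconnected_Ico

theorem norm_sub_lt_of_mem_segment {a b z : ℂ} {ρ : ℝ} (h : ‖b - a‖ < ρ)
    (hz : z ∈ segment ℝ a b) : ‖z - a‖ < ρ := by
  have h0 : 0 < ρ := (norm_nonneg _).trans_lt h
  have := (convex_ball a ρ).segment_subset (mem_ball_self h0) (by simpa [dist_eq_norm] using h) hz
  simpa [dist_eq_norm] using this

theorem isClosed_segment_complex (a b : ℂ) : IsClosed (segment ℝ a b) := by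
  rw [segment_eq_image]
  exact (isCompact_Icc.image (by fun_prop)).isClosed

namespace JoinedArcs

variable {x y : ℝ → ℂ} {τ τ' α α' ρ : ℝ}

theorem symm (h : JoinedArcs x y τ τ' α α' ρ) : JoinedArcs x y τ' τ α α' ρ where
  hx := uIcc_comm τ τ' ▸ h.hx
  hy := uIcc_comm τ τ' ▸ h.hy
  hα := uIcc_comm τ τ' ▸ h.hα
  hα' := uIcc_comm τ τ' ▸ h.hα'
  injx := uIcc_comm τ τ' ▸ h.injx
  injy := uIcc_comm τ τ' ▸ h.injy
  disj := uIcc_comm τ τ' ▸ h.disj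
  segx := uIcc_comm τ τ' ▸ h.segx
  segy := uIcc_comm τ τ' ▸ h.segy
  close := uIcc_comm τ τ' ▸ h.close
  closeα := h.closeα
  far := h.far'
  far' := h.far

/-- The sides of the loop other than the joining segment. -/
def sides (x y : ℝ → ℂ) (τ α α' : ℝ) : Set ℂ :=
  x '' uIcc α τ ∪ segment ℝ (x τ) (y τ) ∪ y '' uIcc α' τ

theorem subα (h : JoinedArcs x y τ τ' α α' ρ) : uIcc α τ ⊆ uIcc τ τ' :=
  uIcc_subset_uIcc h.hα left_mem_uIcc

theorem subα' (h : JoinedArcs x y τ τ' α α' ρ) : uIcc α' τ ⊆ uIcc τ τ' :=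
  uIcc_subset_uIcc h.hα' left_mem_uIcc

theorem isClosed_sides (h : JoinedArcs x y τ τ' α α' ρ) : IsClosed (sides x y τ α α') :=
  (((isCompact_uIcc.image_of_continuousOn (h.hx.mono h.subα)).isClosed.union
    (isClosed_segment_complex _ _)).union
    (isCompact_uIcc.image_of_continuousOn (h.hy.mono h.subα')).isClosed)

theorem pos (h : JoinedArcs x y τ τ' α α' ρ) : 0 < ρ :=
  (norm_nonneg _).trans_lt (h.close α h.hα)

theorem exp_eq_one (h : JoinedArcs x y τ τ' α α' ρ) {z : ℂ} (hz : z ∉ sides x y τ α α') :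
    Complex.exp (loopDefect x y α α' τ z) = 1 :=
  exp_loopDefect (h.hx.mono h.subα) (h.hy.mono h.subα')
    (fun r hr e => hz (Or.inl (Or.inl ⟨r, hr, e⟩))) (fun r hr e => hz (Or.inr ⟨r, hr, e⟩))

theorem continuousAt (h : JoinedArcs x y τ τ' α α' ρ) {z : ℂ} (hz : z ∉ sides x y τ α α')
    (hσ : z ∉ segment ℝ (x α) (y α')) : ContinuousAt (loopDefect x y α α' τ) z :=
  continuousAt_loopDefect (h.hx.mono h.subα) (h.hy.mono h.subα')
    (fun r hr e => hz (Or.inl (Or.inl ⟨r, hr, e⟩))) (fun r hr e => hz (Or.inr ⟨r, hr, e⟩))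
    (fun e => hz (Or.inl (Or.inr e))) hσ

theorem y_far (h : JoinedArcs x y τ τ' α α' ρ) {t : ℝ} (ht : t ∈ uIcc α' τ) :
    9 * ρ ≤ ‖y t - x τ'‖ := by
  have : t ∈ uIcc α τ ∪ uIcc α α' := by
    simp only [mem_union, mem_uIcc] at ht ⊢; grind
  rcases this with h1 | h1
  · have e1 := h.far t h1
    have e2 := h.close t (h.subα h1)
    have := norm_sub_le_norm_sub_add_norm_sub (x t) (y t) (x τ')
    rw [norm_sub_rev (x t) (y t)] at this
    linarith
  · have e1 := h.far α left_mem_uIcc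
    have e2 := h.closeα t h1
    have := norm_sub_le_norm_sub_add_norm_sub (x α) (y t) (x τ')
    rw [norm_sub_rev (x α) (y t)] at this
    linarith

theorem vanish (h : JoinedArcs x y τ τ' α α' ρ) {v : ℂ} (hv : v ∈ sides x y τ' α α')
    (hσ : v ∉ segment ℝ (x α) (y α')) :
    v ∉ sides x y τ α α' ∧ loopDefect x y α α' τ v = 0 := by
  have hρ := h.pos
  set N : Set ℂ := ball (x τ') (2 * ρ) ∪ x '' (uIcc α τ' \ {α}) ∪ y '' (uIcc α' τ' \ {α'}) with hN
  have hσα : ∀ z ∈ segment ℝ (x α) (y α'), ‖z - x α‖ < ρ := fun z hz =>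
    norm_sub_lt_of_mem_segment (h.closeα α' right_mem_uIcc) hz
  have hseg : ∀ z ∈ segment ℝ (x τ) (y τ), ‖z - x τ‖ < ρ := fun z hz =>
    norm_sub_lt_of_mem_segment (h.close τ left_mem_uIcc) hz
  have hseg' : ∀ z ∈ segment ℝ (x τ') (y τ'), ‖z - x τ'‖ < ρ := fun z hz =>
    norm_sub_lt_of_mem_segment (h.close τ' right_mem_uIcc) hz
  have tri : ∀ {a b c : ℂ} {r s q : ℝ}, ‖a - b‖ < r → ‖a - c‖ < s → q ≤ ‖b - c‖ → r + s ≤ q →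
      False := by
    intro a b c r s q h1 h2 h3 h4
    have := norm_sub_le_norm_sub_add_norm_sub b a c
    rw [norm_sub_rev b a] at this
    linarith
  have hoff : ∀ z ∈ N, z ∉ sides x y τ α α' ∧ z ∉ segment ℝ (x α) (y α') := by
    rintro z ((hz | ⟨t, ⟨ht, htα⟩, rfl⟩) | ⟨t, ⟨ht, htα⟩, rfl⟩)
    · rw [mem_ball, dist_eq_norm] at hz
      refine ⟨?_, fun e => tri (hσα z e) hz (h.far α left_mem_uIcc) (by linarith)⟩
      rintro ((⟨s, hs, rfl⟩ | e) | ⟨s, hs, rfl⟩)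
      · linarith [h.far s hs]
      · exact tri (hseg z e) hz (h.far τ right_mem_uIcc) (by linarith)
      · linarith [h.y_far hs]
    · have htI : t ∈ uIcc τ τ' := uIcc_comm τ τ' ▸ h.symm.subα ht
      refine ⟨?_, fun e => htα (h.segx t htI e)⟩
      rintro ((⟨s, hs, e⟩ | e) | ⟨s, hs, e⟩)
      · obtain rfl := h.injx (h.subα hs) htI e
        have h3 := h.hα
        apply htα
        simp only [mem_singleton_iff, mem_uIcc] at hs ht h3 ⊢
        grind
      · linarith [hseg _ e, h.far' t ht]
      · exact h.disj t htI s (h.subα' hs) e.symm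
    · have htI : t ∈ uIcc τ τ' := uIcc_comm τ τ' ▸ h.symm.subα' ht
      refine ⟨?_, fun e => htα (h.segy t htI e)⟩
      rintro ((⟨s, hs, e⟩ | e) | ⟨s, hs, e⟩)
      · exact h.disj s (h.subα hs) t htI e
      · linarith [hseg _ e, h.symm.y_far ht]
      · obtain rfl := h.injy (h.subα' hs) htI e
        have h3 := h.hα'
        apply htα
        simp only [mem_singleton_iff, mem_uIcc] at hs ht h3 ⊢
        grind
  have hne : τ' ≠ α := by
    rintro rfl
    have := h.far τ' left_mem_uIcc
    simp at this; linarith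
  have hne' : τ' ≠ α' := by
    rintro rfl
    have h1 := h.y_far (t := τ') left_mem_uIcc
    linarith [h.close τ' right_mem_uIcc]
  have hcN : IsPreconnected N := by
    refine IsPreconnected.union (y τ') (Or.inl ?_) ⟨τ', ⟨right_mem_uIcc, hne'⟩, rfl⟩
      (IsPreconnected.union (x τ') (mem_ball_self (by linarith))
        ⟨τ', ⟨right_mem_uIcc, hne⟩, rfl⟩ isPreconnected_ball ?_) ?_
    · rw [mem_ball, dist_eq_norm]; linarith [h.close τ' right_mem_uIcc]
    · exact (isPreconnected_uIcc_sdiff_left _ _).image _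
        (h.symm.hx.mono (sdiff_subset.trans h.symm.subα))
    · exact (isPreconnected_uIcc_sdiff_left _ _).image _
        (h.symm.hy.mono (sdiff_subset.trans h.symm.subα'))
  have hvN : v ∈ N := by
    rcases hv with (⟨t, ht, rfl⟩ | e) | ⟨t, ht, rfl⟩
    · exact Or.inl (Or.inr ⟨t, ⟨ht, fun e => hσ (e ▸ left_mem_segment ℝ _ _)⟩, rfl⟩)
    · left; left
      rw [mem_ball, dist_eq_norm]; linarith [hseg' v e]
    · exact Or.inr ⟨t, ⟨ht, fun e => hσ (e ▸ right_mem_segment ℝ _ _)⟩, rfl⟩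
  refine ⟨(hoff v hvN).1, ?_⟩
  have hτN : x τ' ∈ N := Or.inl (Or.inl (mem_ball_self (by linarith)))
  rw [eq_of_exp_eq_one_of_preconnected hcN
    (fun z hz => (h.continuousAt (hoff z hz).1 (hoff z hz).2).continuousWithinAt)
    (fun z hz => h.exp_eq_one (hoff z hz).1) hvN hτN]
  have hsubαα : uIcc α α' ⊆ uIcc τ τ' := uIcc_subset_uIcc h.hα h.hα'
  refine loopDefect_eq_zero_of_close (h.hx.mono h.subα) (h.hy.mono h.subα) (h.hy.mono hsubαα)
    (fun r hr => ?_) fun r hr => ?_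
  · linarith [h.close r (h.subα hr), h.far r hr]
  · linarith [h.closeα r hr, h.far α left_mem_uIcc]

theorem bounded (h : JoinedArcs x y τ τ' α α' ρ) : ∃ R, ∀ z : ℂ, R < ‖z‖ →
    loopDefect x y α α' τ z = 0 ∧ z ∉ sides x y τ α α' := by
  have hseg : Bornology.IsBounded (segment ℝ (x τ) (y τ)) := by
    rw [segment_eq_image]
    exact (isCompact_Icc.image (by fun_prop)).isBounded
  have hc : Bornology.IsBounded (sides x y τ α α') :=
    ((isCompact_uIcc.image_of_continuousOn (h.hx.mono h.subα)).isBounded.union hseg).union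
      (isCompact_uIcc.image_of_continuousOn (h.hy.mono h.subα')).isBounded
  obtain ⟨R, hR⟩ := hc.exists_norm_le
  refine ⟨R, fun z hz => ⟨loopDefect_eq_zero_of_far (h.hx.mono h.subα) (h.hy.mono h.subα')
    (fun r hr => hR _ (Or.inl (Or.inl ⟨r, hr, rfl⟩))) (fun r hr => hR _ (Or.inr ⟨r, hr, rfl⟩)) hz,
    fun e => absurd (hR z e) (not_le.2 hz)⟩⟩

/-- If both loop defects are nonzero somewhere off the segment then they cannot be equal to zero
far away: so they are not both nonzero. -/
theorem eq_zero_or (h : JoinedArcs x y τ τ' α α' ρ) {v : ℂ} (hσ : v ∉ segment ℝ (x α) (y α'))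
    (h1 : v ∉ sides x y τ α α') (h2 : v ∉ sides x y τ' α α')
    (hW : loopDefect x y α α' τ v ≠ 0) (hW' : loopDefect x y α α' τ' v ≠ 0) : False := by
  set W := loopDefect x y α α' τ with hWd
  set W' := loopDefect x y α α' τ' with hWd'
  set U : Set ℂ := {z | z ∉ segment ℝ (x α) (y α') ∧ (z ∉ sides x y τ α α' ∧ W z ≠ 0) ∧
    (z ∉ sides x y τ' α α' ∧ W' z ≠ 0)} with hU
  set U' : Set ℂ := {z | z ∉ segment ℝ (x α) (y α') ∧ ((z ∉ sides x y τ α α' ∧ W z = 0) ∨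
    (z ∉ sides x y τ' α α' ∧ W' z = 0))} with hU'
  have hsegc := (isClosed_segment_complex (x α) (y α')).isOpen_compl
  have loc : ∀ {t t' : ℝ}, JoinedArcs x y t t' α α' ρ → ∀ z, z ∉ segment ℝ (x α) (y α') →
      z ∉ sides x y t α α' → ∀ᶠ w in 𝓝 z, w ∉ sides x y t α α' ∧
        loopDefect x y α α' t w = loopDefect x y α α' t z := by
    intro t t' ht z hz hz'
    obtain ⟨r, hr, hsub⟩ := Metric.isOpen_iff.1
      (hsegc.inter ht.isClosed_sides.isOpen_compl) z ⟨hz, hz'⟩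
    filter_upwards [ball_mem_nhds z hr] with w hw
    exact ⟨(hsub hw).2, eq_of_exp_eq_one_of_preconnected (isPreconnected_ball (x := z) (r := r))
      (fun u hu => (ht.continuousAt (hsub hu).2 (hsub hu).1).continuousWithinAt)
      (fun u hu => ht.exp_eq_one (hsub hu).2) hw (mem_ball_self hr)⟩
  have hUo : IsOpen U := by
    rw [isOpen_iff_mem_nhds]
    rintro z ⟨hz, ⟨h3, h4⟩, h5, h6⟩
    filter_upwards [loc h z hz h3, loc h.symm z hz h5, hsegc.mem_nhds hz] with w a b c
    exact ⟨c, ⟨a.1, by rw [hWd, a.2]; exact h4⟩, b.1, by rw [hWd', b.2]; exact h6⟩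
  have hUo' : IsOpen U' := by
    rw [isOpen_iff_mem_nhds]
    rintro z ⟨hz, ⟨h3, h4⟩ | ⟨h3, h4⟩⟩
    · filter_upwards [loc h z hz h3, hsegc.mem_nhds hz] with w a c
      exact ⟨c, Or.inl ⟨a.1, by rw [hWd, a.2]; exact h4⟩⟩
    · filter_upwards [loc h.symm z hz h3, hsegc.mem_nhds hz] with w a c
      exact ⟨c, Or.inr ⟨a.1, by rw [hWd', a.2]; exact h4⟩⟩
  set p : ℝ → ℂ := fun s => v + s * (v - x α) with hp
  have hpσ : ∀ s ∈ Ici (0 : ℝ), p s ∉ segment ℝ (x α) (y α') := by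
    rintro s hs he
    rw [mem_Ici] at hs
    rw [segment_eq_image'] at he
    obtain ⟨θ, ⟨hθ0, hθ1⟩, he⟩ := he
    apply hσ
    rw [segment_eq_image']
    refine ⟨θ / (1 + s), ⟨by positivity, (div_le_one (by linarith)).2 (by linarith)⟩, ?_⟩
    have hne : (1 + s : ℂ) ≠ 0 := by
      have : (1 + s : ℝ) ≠ 0 := by positivity
      intro h0
      apply this
      have : ((1 + s : ℝ) : ℂ) = 0 := by push_cast; exact h0
      exact Complex.ofReal_eq_zero.1 this
    simp only [hp, Complex.real_smul] at he ⊢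
    push_cast
    field_simp
    linear_combination he
  have hpre : IsPreconnected (p '' Ici 0) := isPreconnected_Ici.image _ (by fun_prop)
  have hsubU : p '' Ici 0 ⊆ U ∪ U' := by
    rintro _ ⟨s, hs, rfl⟩
    have h0 := hpσ s hs
    by_cases h3 : p s ∈ sides x y τ α α'
    · exact Or.inr ⟨h0, Or.inr (h.symm.vanish h3 h0)⟩
    by_cases h4 : p s ∈ sides x y τ' α α'
    · exact Or.inr ⟨h0, Or.inl (h.vanish h4 h0)⟩
    by_cases h5 : W (p s) = 0
    · exact Or.inr ⟨h0, Or.inl ⟨h3, h5⟩⟩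
    by_cases h6 : W' (p s) = 0
    · exact Or.inr ⟨h0, Or.inr ⟨h4, h6⟩⟩
    exact Or.inl ⟨h0, ⟨h3, h5⟩, h4, h6⟩
  obtain ⟨R, hR⟩ := h.bounded
  have hvx : 0 < ‖v - x α‖ := norm_pos_iff.2
    (sub_ne_zero.2 fun e => hσ (e ▸ left_mem_segment ℝ _ _))
  obtain ⟨s, hs0, hs⟩ : ∃ s : ℝ, 0 ≤ s ∧ R < ‖p s‖ := by
    refine ⟨(|R| + ‖v‖ + 1) / ‖v - x α‖, by positivity, ?_⟩
    have h3 : ‖(((|R| + ‖v‖ + 1) / ‖v - x α‖ : ℝ) : ℂ) * (v - x α)‖ = |R| + ‖v‖ + 1 := by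
      rw [norm_mul, Complex.norm_real, Real.norm_of_nonneg (by positivity)]
      field_simp
    have h4 := norm_sub_le (p ((|R| + ‖v‖ + 1) / ‖v - x α‖)) v
    have h5 : p ((|R| + ‖v‖ + 1) / ‖v - x α‖) - v =
      (((|R| + ‖v‖ + 1) / ‖v - x α‖ : ℝ) : ℂ) * (v - x α) := by simp only [hp]; ring
    rw [h5, h3] at h4
    linarith [le_abs_self R]
  obtain ⟨w, -, ⟨-, ⟨-, h5⟩, -, h6⟩, -, ⟨-, h7⟩ | ⟨-, h7⟩⟩ := hpre U U' hUo hUo' hsubU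
    ⟨p 0, ⟨0, by simp, rfl⟩, by simpa [hp] using ⟨hσ, ⟨h1, hW⟩, h2, hW'⟩⟩
    ⟨p s, ⟨s, hs0, rfl⟩, hpσ s hs0, Or.inl ⟨(hR _ hs).2, (hR _ hs).1⟩⟩
  · exact h5 h7
  · exact h6 h7

end JoinedArcs

/-- Points near the middle of the joining segment see a nontrivial logarithmic variation. -/
theorem JoinedArcs.eventually_not_logTrivial {x y : ℝ → ℂ} {τ τ' α α' ρ : ℝ}
    (h : JoinedArcs x y τ τ' α α' ρ) : ∀ᶠ z in 𝓝 (midpoint ℝ (x α) (y α')),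
      ¬ LogTrivial (fun t => (y t - z) / (x t - z)) τ τ' := by
  set m := midpoint ℝ (x α) (y α') with hm
  have hmσ : m ∈ segment ℝ (x α) (y α') := midpoint_mem_segment _ _
  have hab : x α ≠ y α' := h.disj _ h.hα _ h.hα'
  have hρ := h.pos
  set K : Set ℂ := (x '' uIcc τ τ' ∪ y '' uIcc τ τ') ∪
    (segment ℝ (x τ) (y τ) ∪ segment ℝ (x τ') (y τ')) with hK
  have hKc : IsClosed K :=
    ((isCompact_uIcc.image_of_continuousOn h.hx).isClosed.union
      (isCompact_uIcc.image_of_continuousOn h.hy).isClosed).union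
      ((isClosed_segment_complex _ _).union (isClosed_segment_complex _ _))
  have hsides : JoinedArcs.sides x y τ α α' ⊆ K := by
    rintro z ((⟨t, ht, rfl⟩ | e) | ⟨t, ht, rfl⟩)
    · exact Or.inl (Or.inl ⟨t, h.subα ht, rfl⟩)
    · exact Or.inr (Or.inl e)
    · exact Or.inl (Or.inr ⟨t, h.subα' ht, rfl⟩)
  have hsides' : JoinedArcs.sides x y τ' α α' ⊆ K := by
    rintro z ((⟨t, ht, rfl⟩ | e) | ⟨t, ht, rfl⟩)
    · exact Or.inl (Or.inl ⟨t, uIcc_comm τ τ' ▸ h.symm.subα ht, rfl⟩)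
    · exact Or.inr (Or.inr e)
    · exact Or.inl (Or.inr ⟨t, uIcc_comm τ τ' ▸ h.symm.subα' ht, rfl⟩)
  have key : ∀ {t t' : ℝ}, JoinedArcs x y t t' α α' ρ → m ∉ segment ℝ (x t) (y t) := by
    intro t t' ht hmt
    have e1 := norm_sub_lt_of_mem_segment (h.closeα α' right_mem_uIcc) hmσ
    have e2 := norm_sub_lt_of_mem_segment (ht.close t left_mem_uIcc) hmt
    have e3 := ht.far' α left_mem_uIcc
    have := norm_sub_le_norm_sub_add_norm_sub (x α) m (x t)
    rw [norm_sub_rev (x α) m] at this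
    linarith
  have hmK : m ∉ K := by
    rintro ((⟨t, ht, e⟩ | ⟨t, ht, e⟩) | (e | e))
    · obtain rfl := h.segx t ht (e ▸ hmσ)
      exact hab ((left_eq_midpoint_iff ℝ).1 (e.trans hm))
    · obtain rfl := h.segy t ht (e ▸ hmσ)
      exact hab ((midpoint_eq_right_iff ℝ).1 (e.trans hm).symm)
    · exact key h e
    · exact key h.symm e
  obtain ⟨r, hr, hsub⟩ := Metric.isOpen_iff.1 hKc.isOpen_compl m hmK
  set D : ℂ → ℂ := fun z => logVar (fun r => x r - z) τ τ' +
    Complex.log ((y τ' - z) / (x τ' - z)) - Complex.log ((y τ - z) / (x τ - z)) -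
    logVar (fun r => y r - z) τ τ' with hD
  have hxne : ∀ z ∈ Kᶜ, ∀ t ∈ uIcc τ τ', x t - z ≠ 0 := fun z hz t ht e =>
    hz (Or.inl (Or.inl ⟨t, ht, sub_eq_zero.1 e⟩))
  have hyne : ∀ z ∈ Kᶜ, ∀ t ∈ uIcc τ τ', y t - z ≠ 0 := fun z hz t ht e =>
    hz (Or.inl (Or.inr ⟨t, ht, sub_eq_zero.1 e⟩))
  have hx := h.hx
  have hy := h.hy
  have hDeq : ∀ z ∈ Kᶜ, D z = loopDefect x y α α' τ' z - loopDefect x y α α' τ z := by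
    intro z hz
    have e1 := logVar_add (g := fun r => x r - z) (by fun_prop) (hxne z hz) left_mem_uIcc h.hα
      right_mem_uIcc
    have e2 := logVar_add (g := fun r => y r - z) (by fun_prop) (hyne z hz) left_mem_uIcc h.hα'
      right_mem_uIcc
    rw [logVar_swap (g := fun r => x r - z) (s := α) (hx.mono h.subα |>.sub continuousOn_const)
      fun r hr => hxne z hz r (h.subα hr)] at e1
    rw [logVar_swap (g := fun r => y r - z) (s := α') (hy.mono h.subα' |>.sub continuousOn_const)
      fun r hr => hyne z hz r (h.subα' hr)] at e2
    simp only [hD, loopDefect]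
    linear_combination e2 - e1
  have hDc : ContinuousOn D (ball m r) := by
    intro z hz
    have hzK := hsub hz
    refine ContinuousAt.continuousWithinAt ((((continuousAt_logVar_sub hx
      fun t ht e => hzK (Or.inl (Or.inl ⟨t, ht, e⟩))).add (continuousAt_log_div
      fun e => hzK (Or.inr (Or.inr e)))).sub (continuousAt_log_div
      fun e => hzK (Or.inr (Or.inl e)))).sub (continuousAt_logVar_sub hy
      fun t ht e => hzK (Or.inl (Or.inr ⟨t, ht, e⟩))))
  have hDconst : ∀ z ∈ ball m r, D z = D m := fun z hz =>
    eq_of_exp_eq_one_of_preconnected isPreconnected_ball hDc (fun w hw => by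
      rw [hDeq w (hsub hw), Complex.exp_sub, h.exp_eq_one fun e => hsub hw (hsides e),
        h.symm.exp_eq_one fun e => hsub hw (hsides' e), div_one]) hz (mem_ball_self hr)
  filter_upwards [ball_mem_nhds m hr] with z hz htriv
  have hDm : D m = 0 := by
    rw [← hDconst z hz]
    have hzK := hsub hz
    rw [LogTrivial, logVar_div (by fun_prop) (hyne z hzK) (by fun_prop) (hxne z hzK)] at htriv
    simp only [hD]
    linear_combination -htriv
  have hmx : ∀ t ∈ uIcc τ τ', x t ≠ m := fun t ht e => hmK (Or.inl (Or.inl ⟨t, ht, e⟩))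
  have hmy : ∀ t ∈ uIcc τ τ', y t ≠ m := fun t ht e => hmK (Or.inl (Or.inr ⟨t, ht, e⟩))
  refine not_continuousAt_log_div_midpoint hab
    (F := fun z => logVar (fun r => x r - z) α τ + Complex.log ((y τ - z) / (x τ - z)) -
      logVar (fun r => y r - z) α' τ)
    (((continuousAt_logVar_sub (hx.mono h.subα) fun t ht => hmx t (h.subα ht)).add
      (continuousAt_log_div fun e => hmK (Or.inr (Or.inl e)))).sub
      (continuousAt_logVar_sub (hy.mono h.subα') fun t ht => hmy t (h.subα' ht))) ?_
  filter_upwards [ball_mem_nhds m hr] with w hw hwσ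
  have hwK := hsub hw
  have e1 : loopDefect x y α α' τ' w = loopDefect x y α α' τ w := by
    have := hDeq w hwK
    rw [hDconst w hw, hDm] at this
    exact (sub_eq_zero.1 this.symm)
  have e2 : loopDefect x y α α' τ w = 0 := by
    by_contra e3
    exact h.eq_zero_or hwσ (fun e => hwK (hsides e)) (fun e => hwK (hsides' e)) e3 (e1 ▸ e3)
  rw [loopDefect] at e2
  linear_combination e2

namespace IsFlow

variable {X : Type*} [MetricSpace X] {φ : ℝ → X → X}

theorem zero (hφ : IsFlow φ) (x : X) : φ 0 x = x := hφ.2.1 x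

theorem add (hφ : IsFlow φ) (s t : ℝ) (x : X) : φ s (φ t x) = φ (s + t) x := hφ.2.2 s t x

theorem continuous_time (hφ : IsFlow φ) (x : X) : Continuous (fun t => φ t x) :=
  hφ.1.comp (by fun_prop : Continuous fun t : ℝ => (t, x))

theorem tendsto (hφ : IsFlow φ) {ι : Type*} {l : Filter ι} {T : ι → ℝ} {p : ι → X} {t : ℝ} {q : X}
    (hT : Tendsto T l (𝓝 t)) (hp : Tendsto p l (𝓝 q)) :
    Tendsto (fun i => φ (T i) (p i)) l (𝓝 (φ t q)) :=
  (hφ.1.tendsto (t, q)).comp (hT.prodMk_nhds hp)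

theorem neg_cancel (hφ : IsFlow φ) (t : ℝ) (x : X) : φ (-t) (φ t x) = x := by
  rw [hφ.add, neg_add_cancel, hφ.zero]

theorem injective (hφ : IsFlow φ) (t : ℝ) : Function.Injective (φ t) := fun x y h => by
  rw [← hφ.neg_cancel t x, h, hφ.neg_cancel]

end IsFlow

/-- A radius below which no nontrivial orbit and no two fixed points can stay. -/
structure IsolatingRadius {X : Type*} [MetricSpace X] (φ : ℝ → X → X) (R : ℝ) : Prop where
  pos : 0 < R
  fixed : ∀ v c : X, (∀ t, dist c (φ t v) ≤ R) → ∀ t, φ t v = v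
  eq : ∀ p q : X, (∀ t, φ t p = p) → (∀ t, φ t q = q) → dist p q ≤ R → p = q

/-- The condition defining geometric separation, for a given constant. -/
def SeparatingAt {X : Type*} [MetricSpace X] (φ : ℝ → X → X) (δ : ℝ) : Prop :=
  ∀ x y : X, ∀ h : ℝ → ℝ, StrictMono h → Function.Surjective h → h 0 = 0 →
    (∀ t : ℝ, dist (φ (h t) x) (φ t y) < δ) → ∃ s : ℝ, y = φ s x

theorem SeparatingAt.eq_of_fixed {X : Type*} [MetricSpace X] {φ : ℝ → X → X} {δ : ℝ} (hδ : SeparatingAt φ δ) {p q : X} (hp : ∀ t, φ t p = p)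
    (h : ∀ t, dist p (φ t q) < δ) : q = p := by
  obtain ⟨s, hs⟩ := hδ p q id strictMono_id Function.surjective_id rfl (fun t => by
    rw [id, hp]; exact h t)
  rw [hs, hp]

namespace IsolatingRadius

variable {X : Type*} [MetricSpace X] {φ : ℝ → X → X} {R : ℝ}

/-- A periodic orbit that stays within an isolating radius is a fixed point. -/
theorem fixed_of_periodic (hR : IsolatingRadius φ R) (hφ : IsFlow φ) {v c : X} {T : ℝ} (hT : 0 < T)
    (hv : φ T v = v) (h : ∀ u ∈ Icc 0 T, dist c (φ u v) ≤ R) : ∀ t, φ t v = v := by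
  refine hR.fixed v c fun t => ?_
  have hp : Function.Periodic (fun t => φ t v) T := fun t => by
    simp only [← hφ.add, hv]
  obtain ⟨u, hu, he⟩ := hp.exists_mem_Ico₀ hT t
  have he : φ t v = φ u v := he
  rw [he]
  exact h u (Ico_subset_Icc_self hu)

theorem orbit_limit {ι : Type*} {l : Ultrafilter ι} (hφ : IsFlow φ) {c p : ι → X} {T : ι → ℝ}
    {c' p' q' : X} (hc : Tendsto c l (𝓝 c')) (hp : Tendsto p l (𝓝 p'))
    (hq : Tendsto (fun i => φ (T i) (p i)) l (𝓝 q')) (hT : ∀ i, 0 ≤ T i)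
    (h : ∀ i, ∀ u ∈ Icc 0 (T i), dist (c i) (φ u (p i)) ≤ R) :
    (∃ t, 0 ≤ t ∧ φ t p' = q' ∧ ∀ u ∈ Icc 0 t, dist c' (φ u p') ≤ R) ∨
      ((∀ u, 0 ≤ u → dist c' (φ u p') ≤ R) ∧ ∀ u, u ≤ 0 → dist c' (φ u q') ≤ R) := by
  by_cases hb : ∃ M, ∀ᶠ i in (l : Filter ι), T i ≤ M
  · left
    obtain ⟨M, hM⟩ := hb
    obtain ⟨t, ht, hlim⟩ := (isCompact_Icc (a := (0 : ℝ)) (b := M)).ultrafilter_le_nhds (l.map T)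
      (by
        rw [le_principal_iff, Ultrafilter.mem_coe, Ultrafilter.mem_map]
        filter_upwards [hM] with i hi using ⟨hT i, hi⟩)
    have hlim : Tendsto T l (𝓝 t) := hlim
    refine ⟨t, ht.1, tendsto_nhds_unique (hφ.tendsto hlim hp) hq, fun u hu => ?_⟩
    have h1 : Tendsto (fun i => min u (T i)) l (𝓝 u) := by
      have := (tendsto_const_nhds (x := u)).min hlim
      rwa [min_eq_left hu.2] at this
    exact le_of_tendsto' (hc.dist (hφ.tendsto h1 hp)) fun i =>
      h i _ ⟨le_min hu.1 (hT i), min_le_right _ _⟩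
  · right
    push Not at hb
    have hb' : ∀ M, ∀ᶠ i in (l : Filter ι), M < T i := hb
    refine ⟨fun u hu => le_of_tendsto (hc.dist (hφ.tendsto (tendsto_const_nhds (x := u)) hp)) ?_,
      fun u hu => le_of_tendsto (hc.dist (hφ.tendsto (tendsto_const_nhds (x := u)) hq)) ?_⟩
    · filter_upwards [hb' u] with i hi using h i u ⟨hu, hi.le⟩
    · filter_upwards [hb' (-u)] with i hi
      rw [hφ.add]
      exact h i _ ⟨by linarith, by linarith⟩

end IsolatingRadius

section

variable {X : Type*} [MetricSpace X] [CompactSpace X] {φ : ℝ → X → X}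

theorem exists_isolatingRadius (hφ : IsFlow φ) {δ : ℝ} (hδ0 : 0 < δ) (hδ : SeparatingAt φ δ) :
    ∃ R, IsolatingRadius φ R := by
  suffices ∃ R > 0, ∀ v c : X, (∀ t, dist c (φ t v) ≤ R) → ∀ t, φ t v = v by
    obtain ⟨R, hR, h⟩ := this
    refine ⟨min R (δ / 2), by positivity, fun v c hv => h v c fun t =>
      (hv t).trans (min_le_left _ _), fun p q hp hq hpq => (hδ.eq_of_fixed hp fun t => ?_).symm⟩
    rw [hq]
    linarith [min_le_right R (δ / 2)]
  by_contra! hcon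
  have hcon' : ∀ n : ℕ, ∃ v c : X, (∀ t, dist c (φ t v) ≤ 1 / ((n : ℝ) + 1)) ∧ ∃ t, φ t v ≠ v :=
    fun n => hcon _ (by positivity)
  choose v c hc τ hτ using hcon'
  obtain ⟨a, σ, hσ, ha⟩ := CompactSpace.tendsto_subseq v
  have hdist : ∀ n t, dist (v n) (φ t (v n)) ≤ 2 * (1 / ((n : ℝ) + 1)) := by
    intro n t
    have h1 := hc n t
    have h2 := hc n 0
    rw [hφ.zero] at h2
    linarith [dist_triangle_left (v n) (φ t (v n)) (c n)]
  have hlim : Tendsto (fun n => 2 * (1 / (((σ n : ℕ) : ℝ) + 1))) atTop (𝓝 0) := by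
    have := (tendsto_one_div_add_atTop_nhds_zero_nat (𝕜 := ℝ)).comp hσ.tendsto_atTop
    simpa using this.const_mul 2
  have hfix : ∀ t, φ t a = a := by
    intro t
    have h1 : Tendsto (fun n => dist (v (σ n)) (φ t (v (σ n)))) atTop (𝓝 (dist a (φ t a))) :=
      ha.dist (hφ.tendsto tendsto_const_nhds ha)
    have h2 := le_of_tendsto_of_tendsto' h1 hlim fun n => hdist (σ n) t
    exact (dist_le_zero.1 h2).symm
  have h3 : Tendsto (fun n => dist a (v (σ n)) + 2 * (1 / (((σ n : ℕ) : ℝ) + 1))) atTop (𝓝 0) := by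
    have : Tendsto (fun n => dist a (v (σ n))) atTop (𝓝 (dist a a)) := tendsto_const_nhds.dist ha
    rw [dist_self] at this
    simpa using this.add hlim
  obtain ⟨n, hn⟩ := (h3.eventually (gt_mem_nhds hδ0)).exists
  have := hδ.eq_of_fixed hfix (q := v (σ n)) fun t =>
    ((dist_triangle _ _ _).trans (add_le_add_right (hdist (σ n) t) _)).trans_lt hn
  exact hτ (σ n) (by rw [this, hfix])

namespace IsolatingRadius

variable {R : ℝ}

/-- Two orbit pieces inside a ball of isolating radius that almost close up have almost
coinciding ends. -/
theorem loop_small (hR : IsolatingRadius φ R) (hφ : IsFlow φ) {η : ℝ} (hη : 0 < η) :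
    ∃ ε > 0, ∀ x z : X, ∀ T T' : ℝ, 0 ≤ T → 0 ≤ T' → (∀ u ∈ Icc 0 T, dist x (φ u x) ≤ R) →
      (∀ u ∈ Icc 0 T', dist x (φ u z) ≤ R) → dist x (φ T' z) < ε → dist (φ T x) z < ε →
      dist x (φ T x) < η := by
  by_contra! hcon
  have hcon' := fun n : ℕ => hcon (1 / ((n : ℝ) + 1)) (by positivity)
  choose x z T T' hT hT' h1 h2 h3 h4 h5 using hcon'
  let l : Ultrafilter ℕ := hyperfilter ℕ
  have hl : (l : Filter ℕ) ≤ atTop := Nat.hyperfilter_le_atTop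
  have lim : ∀ p : ℕ → X, ∃ a, Tendsto p l (𝓝 a) := by
    intro p
    obtain ⟨a, -, ha⟩ := isCompact_univ.ultrafilter_le_nhds (l.map p) (by simp)
    exact ⟨a, ha⟩
  obtain ⟨a, ha⟩ := lim x
  obtain ⟨b, hb⟩ := lim z
  have h0 : Tendsto (fun n : ℕ => 1 / ((n : ℝ) + 1)) l (𝓝 0) :=
    tendsto_one_div_add_atTop_nhds_zero_nat.mono_left hl
  have hb' : Tendsto (fun n => φ (T n) (x n)) l (𝓝 b) := by
    refine hb.congr_dist (squeeze_zero (fun _ => dist_nonneg) (fun n => ?_) h0)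
    rw [dist_comm]; exact (h4 n).le
  have ha' : Tendsto (fun n => φ (T' n) (z n)) l (𝓝 a) :=
    ha.congr_dist (squeeze_zero (fun _ => dist_nonneg) (fun n => (h3 n).le) h0)
  have hab : η ≤ dist a b := ge_of_tendsto' (ha.dist hb') h5
  suffices a = b by rw [this, dist_self] at hab; linarith
  have hfix : ∀ t, (∀ t, φ t a = a) → φ t a = b → a = b := fun t h1 h2 => (h1 t).symm.trans h2
  rcases orbit_limit hφ ha ha hb' hT h1 with ⟨t, ht, htb, htd⟩ | ⟨hf, hbk⟩ <;>
    rcases orbit_limit hφ ha hb ha' hT' h2 with ⟨t', ht', htb', htd'⟩ | ⟨hf', hbk'⟩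
  · rcases (add_nonneg ht' ht).eq_or_lt with h0 | h0
    · have : t = 0 := by linarith
      rw [this, hφ.zero] at htb; exact htb
    · refine hfix t (hR.fixed_of_periodic hφ (c := a) h0 (by rw [← hφ.add, htb, htb'])
        fun u hu => ?_) htb
      rcases le_total u t with h | h
      · exact htd u ⟨hu.1, h⟩
      · have := htd' (u - t) ⟨by linarith, by linarith [hu.2]⟩
        rwa [← htb, hφ.add, sub_add_cancel] at this
  · refine hfix t (hR.fixed a a fun u => ?_) htb
    rcases le_total u 0 with h | h
    · exact hbk' u h
    rcases le_total u t with h' | h'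
    · exact htd u ⟨h, h'⟩
    · have := hf' (u - t) (by linarith)
      rwa [← htb, hφ.add, sub_add_cancel] at this
  · have hfa := hR.fixed a a fun u => by
      rcases le_total 0 u with h | h
      · exact hf u h
      have e : φ u a = φ (u + t') b := by rw [← htb', hφ.add]
      rw [e]
      rcases le_total 0 (u + t') with h' | h'
      · exact htd' _ ⟨h', by linarith⟩
      · exact hbk _ h'
    refine hfix (-t') hfa ?_
    rw [← htb', hφ.neg_cancel]
  · refine hR.eq a b (hR.fixed a a fun u => ?_) (hR.fixed b a fun u => ?_) ?_
    · rcases le_total 0 u with h | h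
      exacts [hf u h, hbk' u h]
    · rcases le_total 0 u with h | h
      exacts [hf' u h, hbk u h]
    · simpa [hφ.zero] using hf' 0 le_rfl

/-- An orbit arc of isolating size with close ends is small. -/
theorem arc_small (hR : IsolatingRadius φ R) (hφ : IsFlow φ) {η : ℝ} (hη : 0 < η) :
    ∃ ε > 0, ∀ x : X, ∀ s t : ℝ, dist (φ s x) (φ t x) < ε →
      (∀ u ∈ uIcc s t, dist (φ s x) (φ u x) ≤ R / 2) → ∀ u ∈ uIcc s t, dist (φ s x) (φ u x) < η := by
  obtain ⟨ε, hε, H⟩ := hR.loop_small hφ (half_pos hη)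
  have hRpos := hR.pos
  have key : ∀ x : X, ∀ s t : ℝ, s ≤ t → dist (φ s x) (φ t x) < ε →
      (∀ u ∈ Icc s t, dist (φ s x) (φ u x) ≤ R) → ∀ u ∈ Icc s t,
      dist (φ s x) (φ u x) < η / 2 := by
    intro x s t hst hd hu u hut
    have hflow : ∀ r w, φ r (φ w x) = φ (r + w) x := fun r w => hφ.add r w x
    have := H (φ s x) (φ u x) (u - s) (t - u) (by linarith [hut.1]) (by linarith [hut.2])
      (fun r hr => by rw [hflow]; exact hu _ ⟨by linarith [hr.1], by linarith [hr.2, hut.2]⟩)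
      (fun r hr => by rw [hflow]; exact hu _ ⟨by linarith [hr.1, hut.1], by linarith [hr.2]⟩)
      (by rwa [hflow, sub_add_cancel]) (by rw [hflow, sub_add_cancel, dist_self]; exact hε)
    rwa [hflow, sub_add_cancel] at this
  refine ⟨min ε (η / 2), by positivity, fun x s t hd hu u hut => ?_⟩
  rcases le_total s t with hst | hst
  · rw [uIcc_of_le hst] at hu hut
    have := key x s t hst (hd.trans_le (min_le_left _ _)) (fun r hr => by linarith [hu r hr]) u hut
    linarith
  · rw [uIcc_of_ge hst] at hu hut
    have hd' := dist_comm (φ s x) (φ t x)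
    have := key x t s hst (hd' ▸ hd.trans_le (min_le_left _ _)) (fun r hr => by
      have := dist_triangle_left (φ t x) (φ r x) (φ s x)
      linarith [hu r hr, hu t (left_mem_Icc.2 hst)]) u hut
    have h2 := dist_triangle (φ s x) (φ t x) (φ u x)
    linarith [min_le_right ε (η / 2)]

end IsolatingRadius

end

/-- Two parametrised curves `X`, `Y`, the first one an orbit, which stay close to each other without
being close along the flow, up to scale `r`. -/
structure ShadowPair {S : Type*} [MetricSpace S] (φ : ℝ → S → S) (r ε : ℝ) (X Y : ℝ → S) :
    Prop where
  orbit : ∀ s t, φ s (X t) = X (s + t)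
  contX : Continuous X
  contY : Continuous Y
  close : ∀ t, dist (X t) (Y t) < ε
  mem_orbit : ∀ t, ∃ s, Y t = X s
  exit_right : ∀ t, ∃ t', t < t' ∧ r < dist (X t) (X t')
  exit_left : ∀ t, ∃ t', t' < t ∧ r < dist (X t) (X t')
  injX : ∀ c a b, (∀ t ∈ Icc a b, dist c (X t) ≤ r) → InjOn X (Icc a b)
  injY : ∀ c a b, (∀ t ∈ Icc a b, dist c (X t) ≤ r) → InjOn Y (Icc a b)
  disj : ∀ c a b, (∀ t ∈ Icc a b, dist c (X t) ≤ r) → ∀ s ∈ Icc a b, ∀ t ∈ Icc a b, X s ≠ Y t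

/-- If the orbit segments between corresponding points are large at one time, so are they at every
time. -/
theorem segment_large {S : Type*} [MetricSpace S] {φ : ℝ → S → S} {R η ε : ℝ} (hε : ∀ x : S, ∀ s t : ℝ, dist (φ s x) (φ t x) < ε →
      (∀ u ∈ uIcc s t, dist (φ s x) (φ u x) ≤ R / 2) → ∀ u ∈ uIcc s t, dist (φ s x) (φ u x) < η)
    (hηR : η ≤ R / 2) {p : S} (hX : Continuous fun t => φ t p) {G : ℝ → ℝ} (hG : Continuous G)
    (hclose : ∀ t, dist (φ t p) (φ (G t) p) < ε)
    {t₀ : ℝ} (h0 : ∃ u ∈ uIcc t₀ (G t₀), η ≤ dist (φ t₀ p) (φ u p)) (t : ℝ) :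
    ∃ u ∈ uIcc t (G t), R / 2 < dist (φ t p) (φ u p) := by
  let f : unitInterval → ℝ → ℝ := fun u t => dist (φ t p) (φ (t + u * (G t - t)) p)
  have hf : Continuous (fun q : unitInterval × ℝ => f q.1 q.2) := by
    refine Continuous.dist (hX.comp continuous_snd) (hX.comp ?_)
    fun_prop
  have hmem : ∀ (u : unitInterval) t, t + u * (G t - t) ∈ uIcc t (G t) := fun u t => by
    rw [← segment_eq_uIcc]
    refine ⟨1 - u, u, by linarith [u.2.2], u.2.1, by ring, ?_⟩
    simp only [smul_eq_mul]; ring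
  have hmem' : ∀ t, ∀ v ∈ uIcc t (G t), ∃ u : unitInterval, v = t + u * (G t - t) := fun t v hv => by
    rw [← segment_eq_uIcc] at hv
    obtain ⟨a, b, ha, hb, hab, rfl⟩ := hv
    refine ⟨⟨b, hb, by linarith⟩, ?_⟩
    simp only [smul_eq_mul]
    rw [show a = 1 - b by linarith]; ring
  let A : Set ℝ := {t | ∃ u : unitInterval, R / 2 < f u t}
  have hA : A = {t | ∃ u : unitInterval, η ≤ f u t} := by
    ext t
    refine ⟨fun ⟨u, hu⟩ => ⟨u, hηR.trans hu.le⟩, fun ⟨u, hu⟩ => ?_⟩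
    by_contra hcon
    simp only [A, mem_ofPred_eq, not_exists, not_lt] at hcon
    refine absurd (hε p t (G t) (hclose t) (fun v hv => ?_) _ (hmem u t)) (not_lt.2 hu)
    obtain ⟨w, rfl⟩ := hmem' t v hv
    exact hcon w
  have hopen : IsOpen A := by
    have : A = ⋃ u : unitInterval, {t | R / 2 < f u t} := by ext t; simp [A]
    rw [this]
    exact isOpen_iUnion fun u => isOpen_lt continuous_const
      (hf.comp (by fun_prop : Continuous fun t : ℝ => (u, t)))
  have hclosed : IsClosed A := by
    have : A = Prod.snd '' {q : unitInterval × ℝ | η ≤ f q.1 q.2} := by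
      rw [hA]; ext t; simp
    rw [this]
    exact isClosedMap_snd_of_compactSpace _ (isClosed_le continuous_const hf)
  have huniv : A = univ := IsClopen.eq_univ ⟨hclosed, hopen⟩ (by
    obtain ⟨v, hv, hd⟩ := h0
    obtain ⟨u, rfl⟩ := hmem' _ v hv
    rw [hA]
    exact ⟨t₀, u, hd⟩)
  obtain ⟨u, hu⟩ : t ∈ A := huniv ▸ mem_univ t
  exact ⟨_, hmem u t, hu⟩

/-- A separating flow which is not expansive has shadow pairs of any precision at a fixed scale. -/
theorem exists_shadowPair {S : Type*} [MetricSpace S] [CompactSpace S] {φ : ℝ → S → S}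
    (hφ : IsFlow φ) {δ R : ℝ} (hδ0 : 0 < δ) (hδ : SeparatingAt φ δ)
    (hR : IsolatingRadius φ R) (hne : ¬ GeomExpansive φ) {ε : ℝ} (hε0 : 0 < ε) :
    ∃ X Y, ShadowPair φ (R / 4) ε X Y := by
  simp only [GeomExpansive, not_forall, gt_iff_lt, not_exists] at hne
  obtain ⟨β, hβ, hne⟩ := hne
  have hRp := hR.pos
  obtain ⟨ε₁, hε₁, H₁⟩ := hR.arc_small hφ (η := min (β / 3) (R / 2)) (by positivity)
  let ε' := min (min ε δ) (min ε₁ (R / 4))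
  have hε' : 0 < ε' := by positivity
  have he1 : ε' ≤ ε := (min_le_left _ _).trans (min_le_left _ _)
  have he2 : ε' ≤ δ := (min_le_left _ _).trans (min_le_right _ _)
  have he3 : ε' ≤ ε₁ := (min_le_right _ _).trans (min_le_left _ _)
  have he4 : ε' ≤ R / 4 := (min_le_right _ _).trans (min_le_right _ _)
  have := hne ε'
  push Not at this
  obtain ⟨x, y, h, hmono, hsurj, h0, hd, hcon⟩ := this hε'
  obtain ⟨s, rfl⟩ := hδ x y h hmono hsurj h0 fun t => (hd t).trans_le he2
  have hG : ∀ t, φ (h t) x = φ (h t - s) (φ s x) := fun t => by rw [hφ.add, sub_add_cancel]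
  set p := φ s x with hp
  set H : ℝ → ℝ := fun t => h t - s with hH
  have hd' : ∀ t, dist (φ t p) (φ (H t) p) < ε' := fun t => by
    rw [dist_comm, ← hG]; exact hd t
  have hHc : Continuous H := (hmono.monotone.continuous_of_surjective hsurj).sub continuous_const
  have hHm : StrictMono H := fun a b hab => sub_lt_sub_right (hmono hab) s
  have hHs : Function.Surjective H := fun t => by
    obtain ⟨u, hu⟩ := hsurj (t + s)
    exact ⟨u, by simp [H, hu]⟩
  have hX : Continuous fun t => φ t p := hφ.continuous_time p
  have big : ∀ c, (∀ t, φ (t + c) p = φ t p) → ∀ t, ∃ u ∈ uIcc t (H t + c),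
      R / 2 < dist (φ t p) (φ u p) := by
    intro c hc t
    refine segment_large (η := min (β / 3) (R / 2)) (ε := ε₁) H₁ (min_le_right _ _) hX (G := fun t => H t + c)
      (hHc.add continuous_const) (fun t => ?_) (t₀ := 0) ?_ t
    · rw [hc]; exact (hd' t).trans_le he3
    by_contra! hsm
    have hx : φ (H 0 + c) p = x := by
      rw [hc]; simp [H, h0, hp, hφ.add, hφ.zero]
    have hcon' := hcon p (min 0 (H 0 + c)) (max 0 (H 0 + c)) min_le_max
      ⟨H 0 + c, ⟨min_le_right _ _, le_max_right _ _⟩, hx⟩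
      ⟨0, ⟨min_le_left _ _, le_max_left _ _⟩, hφ.zero p⟩
    have hb : Metric.diam ((fun t => φ t p) '' Icc (min 0 (H 0 + c)) (max 0 (H 0 + c))) ≤
        2 * (β / 3) := by
      refine diam_le_of_forall_dist_le (by positivity) ?_
      rintro _ ⟨u, hu, rfl⟩ _ ⟨v, hv, rfl⟩
      have h1 := hsm u hu
      have h2 := hsm v hv
      have := dist_triangle_left (φ u p) (φ v p) (φ 0 p)
      simp only
      linarith [min_le_left (β / 3) (R / 2)]
    linarith
  have big0 : ∀ t, ∃ u ∈ uIcc t (H t), R / 2 < dist (φ t p) (φ u p) := by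
    simpa using big 0 (by simp)
  have exits : (∀ t, ∃ t', t < t' ∧ R / 4 < dist (φ t p) (φ t' p)) ∧
      ∀ t, ∃ t', t' < t ∧ R / 4 < dist (φ t p) (φ t' p) := by
    have hne : ∀ t, H t ≠ t := fun t ht => by
      obtain ⟨u, hu, hlt⟩ := big0 t
      rw [ht, uIcc_self, mem_singleton_iff] at hu
      rw [hu, dist_self] at hlt
      linarith
    have ne_of : ∀ u t, R / 4 < dist (φ t p) (φ u p) → u ≠ t := fun u t hlt he => by
      rw [he, dist_self] at hlt; linarith
    have back : ∀ t w, (∃ u ∈ uIcc w (H w), R / 2 < dist (φ w p) (φ u p)) → H w = t →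
        ∃ t' ∈ uIcc w t, R / 4 < dist (φ t p) (φ t' p) := by
      rintro t w ⟨u, hu, hlt⟩ rfl
      by_contra! hc
      have h1 := hc w left_mem_uIcc
      have h2 := hc u hu
      linarith [dist_triangle_left (φ w p) (φ u p) (φ (H w) p)]
    have sign : (∀ t, t < H t) ∨ ∀ t, H t < t := by
      by_contra! hc
      obtain ⟨⟨a, ha⟩, b, hb⟩ := hc
      obtain ⟨c, hc⟩ := mem_range_of_exists_le_of_exists_ge (hHc.sub continuous_id)
        (c := (0 : ℝ)) ⟨a, by simpa using ha⟩ ⟨b, by simpa using hb⟩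
      exact hne c (by simpa [sub_eq_zero] using hc)
    rcases sign with hs | hs
    · refine ⟨fun t => ?_, fun t => ?_⟩
      · obtain ⟨u, hu, hlt⟩ := big0 t
        rw [uIcc_of_le (hs t).le] at hu
        exact ⟨u, hu.1.lt_of_ne' (ne_of _ _ (by linarith)), by linarith⟩
      · obtain ⟨w, hw⟩ := hHs t
        obtain ⟨u, hu, hlt⟩ := back t w (big0 w) hw
        rw [uIcc_of_le (hw ▸ (hs w).le)] at hu
        exact ⟨u, hu.2.lt_of_ne (ne_of _ _ hlt), hlt⟩
    · refine ⟨fun t => ?_, fun t => ?_⟩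
      · obtain ⟨w, hw⟩ := hHs t
        obtain ⟨u, hu, hlt⟩ := back t w (big0 w) hw
        rw [uIcc_of_ge (hw ▸ (hs w).le)] at hu
        exact ⟨u, hu.1.lt_of_ne' (ne_of _ _ hlt), hlt⟩
      · obtain ⟨u, hu, hlt⟩ := big0 t
        rw [uIcc_of_ge (hs t).le] at hu
        exact ⟨u, hu.2.lt_of_ne (ne_of _ _ (by linarith)), by linarith⟩
  have noper : ∀ c a b, a < b → φ a p = φ b p → (∀ t ∈ Icc a b, dist c (φ t p) ≤ R) → False := by
    intro c a b hab he hc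
    have hfl : ∀ u v, φ u (φ v p) = φ (u + v) p := fun u v => hφ.add u v p
    have := hR.fixed_of_periodic hφ (v := φ a p) (c := c) (T := b - a) (by linarith)
      (by rw [hfl, sub_add_cancel, he]) fun u hu => by
        rw [hfl]; exact hc _ ⟨by linarith [hu.1], by linarith [hu.2]⟩
    obtain ⟨t, -, ht⟩ := exits.1 a
    have h2 := this (t - a)
    rw [hfl, sub_add_cancel] at h2
    rw [h2, dist_self] at ht
    linarith
  refine ⟨fun t => φ t p, fun t => φ (H t) p, ⟨fun s t => hφ.add s t p, hX, hX.comp hHc,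
    fun t => (hd' t).trans_le he1, fun t => ⟨H t, rfl⟩, exits.1, exits.2, ?_, ?_, ?_⟩⟩
  · intro c a b hc u hu v hv he
    by_contra hne
    wlog hlt : u < v generalizing u v
    · exact this hv hu he.symm (Ne.symm hne) (lt_of_le_of_ne (not_lt.1 hlt) (Ne.symm hne))
    exact noper c u v hlt he fun t ht =>
      (hc t ⟨hu.1.trans ht.1, ht.2.trans hv.2⟩).trans (by linarith)
  · intro c a b hc u hu v hv he
    by_contra hne
    wlog hlt : u < v generalizing u v
    · exact this hv hu he.symm (Ne.symm hne) (lt_of_le_of_ne (not_lt.1 hlt) (Ne.symm hne))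
    refine noper c (H u) (H v) (hHm hlt) he fun t ht => ?_
    obtain ⟨w, rfl⟩ := hHs t
    have h1 := hc w ⟨hu.1.trans (hHm.le_iff_le.1 ht.1), (hHm.le_iff_le.1 ht.2).trans hv.2⟩
    linarith [dist_triangle c (φ w p) (φ (H w) p), hd' w]
  · intro c a b hc u hu v hv he
    have he : φ u p = φ (H v) p := he
    obtain ⟨w, hw, hlt⟩ := big (u - H v) (fun t => by
      have h1 : ∀ a b, φ a (φ b p) = φ (a + b) p := fun a b => hφ.add a b p
      rw [show t + (u - H v) = (t - H v) + u by ring, ← h1, he, h1, sub_add_cancel]) v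
    rw [add_sub_cancel] at hw
    have h1 := hc w (by
      have := uIcc_subset_Icc hv hu
      exact this hw)
    linarith [dist_triangle_left (φ v p) (φ w p) c, hc v hv]

namespace ShadowPair

variable {S : Type*} [MetricSpace S] {φ : ℝ → S → S} {r ε : ℝ} {X Y : ℝ → S}

theorem mono (h : ShadowPair φ r ε X Y) {r' : ℝ} (hr : r' ≤ r) : ShadowPair φ r' ε X Y where
  orbit := h.orbit
  contX := h.contX
  contY := h.contY
  close := h.close
  mem_orbit := h.mem_orbit
  exit_right t := let ⟨u, hu, hd⟩ := h.exit_right t; ⟨u, hu, hr.trans_lt hd⟩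
  exit_left t := let ⟨u, hu, hd⟩ := h.exit_left t; ⟨u, hu, hr.trans_lt hd⟩
  injX c a b hc := h.injX c a b fun t ht => (hc t ht).trans hr
  injY c a b hc := h.injY c a b fun t ht => (hc t ht).trans hr
  disj c a b hc := h.disj c a b fun t ht => (hc t ht).trans hr

/-- Time reversal of a shadow pair. -/
theorem reverse (h : ShadowPair φ r ε X Y) :
    ShadowPair (fun t => φ (-t)) r ε (fun t => X (-t)) (fun t => Y (-t)) where
  orbit s t := by rw [h.orbit, neg_add]
  contX := h.contX.comp continuous_neg
  contY := h.contY.comp continuous_neg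
  close t := h.close _
  mem_orbit t := let ⟨s, hs⟩ := h.mem_orbit (-t); ⟨-s, by rw [hs, neg_neg]⟩
  exit_right t := let ⟨u, hu, hd⟩ := h.exit_left (-t); ⟨-u, by linarith, by rwa [neg_neg]⟩
  exit_left t := let ⟨u, hu, hd⟩ := h.exit_right (-t); ⟨-u, by linarith, by rwa [neg_neg]⟩
  injX c a b hc := fun s hs t ht he => neg_injective <| h.injX c (-b) (-a)
    (fun u hu => by simpa using hc (-u) ⟨by linarith [hu.2], by linarith [hu.1]⟩)
    ⟨by linarith [hs.2], by linarith [hs.1]⟩ ⟨by linarith [ht.2], by linarith [ht.1]⟩ he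
  injY c a b hc := fun s hs t ht he => neg_injective <| h.injY c (-b) (-a)
    (fun u hu => by simpa using hc (-u) ⟨by linarith [hu.2], by linarith [hu.1]⟩)
    ⟨by linarith [hs.2], by linarith [hs.1]⟩ ⟨by linarith [ht.2], by linarith [ht.1]⟩ he
  disj c a b hc := fun s hs t ht => h.disj c (-b) (-a)
    (fun u hu => by simpa using hc (-u) ⟨by linarith [hu.2], by linarith [hu.1]⟩)
    (-s) ⟨by linarith [hs.2], by linarith [hs.1]⟩ (-t) ⟨by linarith [ht.2], by linarith [ht.1]⟩

end ShadowPair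

/-- Finitely many charts into the closed right half plane, with uniform domains and images. -/
structure ChartCover {S : Type*} [MetricSpace S] {ι : Type*} (ψ : ι → S → ℂ) (K : ι → Set S)
    (c : S → ι) (lam r₀ : ℝ) : Prop where
  lam_pos : 0 < lam
  r₀_pos : 0 < r₀
  compact : ∀ i, IsCompact (K i)
  cont : ∀ i, ContinuousOn (ψ i) (K i)
  inj : ∀ i, InjOn (ψ i) (K i)
  re_nonneg : ∀ i, ∀ p ∈ K i, 0 ≤ (ψ i p).re
  subset : ∀ z, closedBall z lam ⊆ K (c z)
  surj : ∀ z, ∀ w ∈ ball z r₀, ∀ ζ : ℂ, 0 ≤ ζ.re →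
    ‖ζ - ψ (c z) z‖ ≤ ‖ψ (c z) w - ψ (c z) z‖ → ∃ p ∈ ball z (lam / 2), ψ (c z) p = ζ

/-- The standard embedding of the half plane in `ℂ`. -/
def halfPlaneToComplex (x : EuclideanHalfSpace 2) : ℂ := ⟨x.1 0, x.1 1⟩

theorem continuous_halfPlaneToComplex : Continuous halfPlaneToComplex := by
  unfold halfPlaneToComplex
  simp only [Complex.mk_eq_add_mul_I]
  fun_prop

theorem halfPlaneToComplex_injective : Function.Injective halfPlaneToComplex := by
  intro x y h
  have h := Complex.ext_iff.1 h
  apply Subtype.ext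
  ext k
  fin_cases k
  · exact h.1
  · exact h.2

/-- A continuous right inverse of `halfPlaneToComplex` on the half plane. -/
noncomputable def complexToHalfPlane (ζ : ℂ) : EuclideanHalfSpace 2 :=
  ⟨!₂[max ζ.re 0, ζ.im], by simp⟩

theorem continuous_complexToHalfPlane : Continuous complexToHalfPlane := by
  refine Continuous.subtype_mk ?_ _
  refine (PiLp.continuous_toLp 2 _).comp ?_
  refine continuous_pi fun k => ?_
  fin_cases k <;> simp <;> fun_prop

theorem halfPlaneToComplex_complexToHalfPlane {ζ : ℂ} (h : 0 ≤ ζ.re) :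
    halfPlaneToComplex (complexToHalfPlane ζ) = ζ := by
  apply Complex.ext <;> simp [halfPlaneToComplex, complexToHalfPlane, h]

theorem complexToHalfPlane_halfPlaneToComplex (x : EuclideanHalfSpace 2) :
    complexToHalfPlane (halfPlaneToComplex x) = x :=
  halfPlaneToComplex_injective (halfPlaneToComplex_complexToHalfPlane x.2)

section

variable {S : Type*} [MetricSpace S]

theorem exists_local_chart_radius
    (e : OpenPartialHomeomorph S (EuclideanHalfSpace 2)) {z₀ : S} (hz : z₀ ∈ e.source) {l : ℝ}
    (hl : 0 < l) : ∃ ρ > 0, ρ ≤ l ∧ ∀ z ∈ ball z₀ ρ, ∀ w ∈ ball z ρ, ∀ ζ : ℂ, 0 ≤ ζ.re →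
      ‖ζ - halfPlaneToComplex (e z)‖ ≤ ‖halfPlaneToComplex (e w) - halfPlaneToComplex (e z)‖ →
      ∃ p ∈ ball z (l / 2), halfPlaneToComplex (e p) = ζ := by
  set ψ := fun p => halfPlaneToComplex (e p) with hψ
  have hc : ContinuousAt ψ z₀ :=
    continuous_halfPlaneToComplex.continuousAt.comp (e.continuousAt hz)
  have h1 : ∀ᶠ ζ in 𝓝 (ψ z₀), complexToHalfPlane ζ ∈ e.target ∧
      e.symm (complexToHalfPlane ζ) ∈ ball z₀ (l / 4) := by
    have ht : Tendsto complexToHalfPlane (𝓝 (ψ z₀)) (𝓝 (e z₀)) := by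
      have := continuous_complexToHalfPlane.tendsto (ψ z₀)
      rwa [hψ, complexToHalfPlane_halfPlaneToComplex] at this
    have h2 := ht.eventually (e.open_target.mem_nhds (e.map_source hz))
    have h3 : Tendsto e.symm (𝓝 (e z₀)) (𝓝 z₀) := e.tendsto_symm hz
    exact h2.and ((h3.comp ht).eventually (ball_mem_nhds z₀ (by positivity)))
  obtain ⟨θ, hθ, h1⟩ := Metric.eventually_nhds_iff.1 h1
  obtain ⟨ρ, hρ, h2⟩ := Metric.continuousAt_iff.1 hc (θ / 4) (by positivity)
  refine ⟨min (ρ / 2) (l / 4), by positivity, (min_le_right _ _).trans (by linarith), ?_⟩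
  intro z hz w hw ζ hζ hle
  rw [mem_ball] at hz hw
  have e1 := min_le_left (ρ / 2) (l / 4)
  have e2 := min_le_right (ρ / 2) (l / 4)
  have d1 : dist (ψ z) (ψ z₀) < θ / 4 := h2 (by linarith)
  have d2 : dist (ψ w) (ψ z₀) < θ / 4 := h2 (by linarith [dist_triangle w z z₀])
  have d3 : dist ζ (ψ z₀) < θ := by
    have a1 := dist_triangle ζ (ψ z) (ψ z₀)
    have a2 := dist_triangle_right (ψ w) (ψ z) (ψ z₀)
    rw [← dist_eq_norm, ← dist_eq_norm] at hle
    have hle : dist ζ (ψ z) ≤ dist (ψ w) (ψ z) := hle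
    linarith
  obtain ⟨m1, m2⟩ := h1 d3
  refine ⟨e.symm (complexToHalfPlane ζ), ?_, ?_⟩
  · rw [mem_ball] at m2 ⊢
    linarith [dist_triangle_right (e.symm (complexToHalfPlane ζ)) z z₀]
  · rw [e.right_inv m1, halfPlaneToComplex_complexToHalfPlane hζ]

theorem exists_chartCover [CompactSpace S] [Nonempty S] [ChartedSpace (EuclideanHalfSpace 2) S] :
    ∃ (t : Finset S) (ψ : t → S → ℂ) (K : t → Set S) (c : S → t) (lam r₀ : ℝ),
      ChartCover ψ K c lam r₀ := by
  obtain ⟨L, hL, hcov⟩ := lebesgue_number_lemma_of_metric (isCompact_univ (X := S))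
    (c := fun z : S => (chartAt (EuclideanHalfSpace 2) z).source)
    (fun z => (chartAt (EuclideanHalfSpace 2) z).open_source)
    (fun z _ => mem_iUnion.2 ⟨z, mem_chart_source _ z⟩)
  choose! b hb using hcov
  let e : S → OpenPartialHomeomorph S (EuclideanHalfSpace 2) := fun z => chartAt _ (b z)
  have hb' : ∀ z, ball z L ⊆ (e z).source := fun z => hb z (mem_univ z)
  set l := L / 4 with hl
  have hlp : 0 < l := by positivity
  have hloc := fun z => exists_local_chart_radius (e z) (hb' z (mem_ball_self hL)) hlp
  choose ρ hρ hρl hρs using hloc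
  obtain ⟨t, -, ht⟩ := isCompact_univ.elim_nhds_subcover (fun z : S => ball z (ρ z))
    (fun z _ => ball_mem_nhds z (hρ z))
  have hc : ∀ z, ∃ i : t, z ∈ ball (i : S) (ρ i) := fun z => by
    obtain ⟨i, hi, hz⟩ := mem_iUnion₂.1 (ht (mem_univ z))
    exact ⟨⟨i, hi⟩, hz⟩
  choose c hc using hc
  have hne : t.Nonempty := ⟨_, (c (Classical.arbitrary S)).2⟩
  have hsub : ∀ i : t, closedBall (i : S) (2 * l) ⊆ (e i).source := fun i =>
    (closedBall_subset_ball (by linarith)).trans (hb' i)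
  have r₀le : ∀ i : t, t.inf' hne ρ ≤ ρ i := fun i => Finset.inf'_le _ i.2
  refine ⟨t, fun i p => halfPlaneToComplex (e i p), fun i => closedBall (i : S) (2 * l), c, l,
    t.inf' hne ρ, hlp, (Finset.lt_inf'_iff hne).2 fun i _ => hρ i,
    fun i => isClosed_closedBall.isCompact, fun i => ?_, fun i => ?_, fun i p _ => (e i p).2,
    fun z => ?_, fun z w hw => hρs (c z) z (hc z) w (ball_subset_ball (r₀le _) hw)⟩
  · exact continuous_halfPlaneToComplex.comp_continuousOn ((e i).continuousOn.mono (hsub i))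
  · exact halfPlaneToComplex_injective.comp_injOn ((e i).injOn.mono (hsub i))
  · refine closedBall_subset_closedBall' ?_
    have := hc z
    rw [mem_ball] at this
    linarith [hρl (c z)]

namespace ChartCover

variable {ι : Type*} [Finite ι] {ψ : ι → S → ℂ} {K : ι → Set S} {c : S → ι} {lam r₀ : ℝ}

/-- Uniform continuity of the charts. -/
theorem exists_norm_lt (h : ChartCover ψ K c lam r₀) {ν : ℝ} (hν : 0 < ν) :
    ∃ κ > 0, ∀ i, ∀ p ∈ K i, ∀ w ∈ K i, dist p w < κ → ‖ψ i p - ψ i w‖ < ν := by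
  have h1 : ∀ i, ∃ κ > 0, ∀ p ∈ K i, ∀ w ∈ K i, dist p w < κ → ‖ψ i p - ψ i w‖ < ν := fun i => by
    have := Metric.uniformContinuousOn_iff.1
      ((h.compact i).uniformContinuousOn_of_continuous (h.cont i)) ν hν
    simpa only [dist_eq_norm] using this
  choose κ hκ H using h1
  cases nonempty_fintype ι
  cases isEmpty_or_nonempty ι
  · exact ⟨1, one_pos, fun i => isEmptyElim i⟩
  refine ⟨Finset.univ.inf' Finset.univ_nonempty κ, (Finset.lt_inf'_iff _).2 fun i _ => hκ i,
    fun i p hp w hw hd => H i p hp w hw (hd.trans_le (Finset.inf'_le _ (Finset.mem_univ i)))⟩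

/-- Uniform injectivity of the charts. -/
theorem exists_le_norm (h : ChartCover ψ K c lam r₀) {r : ℝ} (hr : 0 < r) :
    ∃ μ > 0, ∀ i, ∀ p ∈ K i, ∀ w ∈ K i, r ≤ dist p w → μ ≤ ‖ψ i p - ψ i w‖ := by
  have h1 : ∀ i, ∃ μ > 0, ∀ p ∈ K i, ∀ w ∈ K i, r ≤ dist p w → μ ≤ ‖ψ i p - ψ i w‖ := fun i => by
    have hA : IsCompact ((K i ×ˢ K i) ∩ {q : S × S | r ≤ dist q.1 q.2}) :=
      ((h.compact i).prod (h.compact i)).inter_right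
        (isClosed_le continuous_const (continuous_fst.dist continuous_snd))
    have hf : ContinuousOn (fun q : S × S => ‖ψ i q.1 - ψ i q.2‖)
        ((K i ×ˢ K i) ∩ {q : S × S | r ≤ dist q.1 q.2}) := by
      refine (ContinuousOn.sub ?_ ?_).norm
      · exact (h.cont i).comp continuousOn_fst fun q hq => hq.1.1
      · exact (h.cont i).comp continuousOn_snd fun q hq => hq.1.2
    obtain ⟨μ, hμ, H⟩ := hA.exists_forall_le' hf (a := 0) (fun q hq => by
      rw [norm_pos_iff, sub_ne_zero]
      intro he
      have := h.inj i hq.1.1 hq.1.2 he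
      have h2 := hq.2
      rw [mem_ofPred_eq, this, dist_self] at h2
      linarith)
    exact ⟨μ, hμ, fun p hp w hw hd => H (p, w) ⟨⟨hp, hw⟩, hd⟩⟩
  choose μ hμ H using h1
  cases nonempty_fintype ι
  cases isEmpty_or_nonempty ι
  · exact ⟨1, one_pos, fun i => isEmptyElim i⟩
  refine ⟨Finset.univ.inf' Finset.univ_nonempty μ, (Finset.lt_inf'_iff _).2 fun i _ => hμ i,
    fun i p hp w hw hd => (Finset.inf'_le _ (Finset.mem_univ i)).trans (H i p hp w hw hd)⟩

/-- Relative closeness in charts. -/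
theorem exists_norm_lt_mul (h : ChartCover ψ K c lam r₀) {r ν : ℝ} (hr : 0 < r) (hν : 0 < ν) :
    ∃ κ > 0, ∀ i, ∀ w ∈ K i, ∀ p ∈ K i, ∀ z ∈ K i, dist w p < κ → r ≤ dist p z →
      ‖ψ i w - ψ i p‖ < ν * ‖ψ i p - ψ i z‖ := by
  obtain ⟨μ, hμ, H⟩ := h.exists_le_norm hr
  obtain ⟨κ, hκ, H'⟩ := h.exists_norm_lt (mul_pos hν hμ)
  exact ⟨κ, hκ, fun i w hw p hp z hz h1 h2 => (H' i w hw p hp h1).trans_le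
    (mul_le_mul_of_nonneg_left (H i p hp z hz h2) hν.le)⟩

end ChartCover

end

/-- The position of `Y t` relative to `X t`, as seen from `z` in the chart `ψ`. -/
noncomputable def relQuot {S : Type*} (ψ : S → ℂ) (X Y : ℝ → S) (z : S) (t : ℝ) : ℂ :=
  (ψ (Y t) - ψ z) / (ψ (X t) - ψ z)

/-- A retraction-like map of the plane to the right half plane under which only `b` goes to `b`. -/
noncomputable def foldAt (b ζ : ℂ) : ℂ :=
  if 0 < b.re then ⟨max ζ.re 0, ζ.im⟩ else ⟨|ζ.re|, ζ.im⟩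

theorem continuous_foldAt (b : ℂ) : Continuous (foldAt b) := by
  unfold foldAt
  simp only [Complex.mk_eq_add_mul_I]
  split_ifs <;> fun_prop

theorem foldAt_re_nonneg (b ζ : ℂ) : 0 ≤ (foldAt b ζ).re := by
  unfold foldAt
  split_ifs <;> simp

theorem foldAt_of_nonneg {b ζ : ℂ} (h : 0 ≤ ζ.re) : foldAt b ζ = ζ := by
  unfold foldAt
  split_ifs <;> apply Complex.ext <;> simp [h]

theorem eq_of_foldAt_eq {b ζ : ℂ} (hb : 0 ≤ b.re) (h : foldAt b ζ = b) : ζ = b := by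
  unfold foldAt at h
  split_ifs at h with h0
  · have h1 := congrArg Complex.re h
    have h2 := congrArg Complex.im h
    simp only at h1 h2
    refine Complex.ext ?_ h2
    rcases max_choice ζ.re 0 with h3 | h3 <;> rw [h3] at h1
    · exact h1
    · linarith
  · have h1 := congrArg Complex.re h
    have h2 := congrArg Complex.im h
    simp only at h1 h2
    have hb0 : b.re = 0 := by linarith
    refine Complex.ext ?_ h2
    rw [hb0, abs_eq_zero] at h1
    rw [h1, hb0]

theorem norm_foldAt_sub_le (b ζ ω : ℂ) : ‖foldAt b ζ - foldAt b ω‖ ≤ ‖ζ - ω‖ := by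
  have key : ∀ x y : ℝ, |x - y| ≤ |ζ.re - ω.re| →
      ‖(⟨x, ζ.im⟩ : ℂ) - ⟨y, ω.im⟩‖ ≤ ‖ζ - ω‖ := fun x y hxy => by
    rw [Complex.norm_def, Complex.norm_def]
    apply Real.sqrt_le_sqrt
    simp only [Complex.normSq_apply, Complex.sub_re, Complex.sub_im]
    nlinarith [sq_le_sq.2 hxy]
  unfold foldAt
  split_ifs
  · refine key _ _ ?_
    simpa using abs_max_sub_max_le_abs ζ.re ω.re 0
  · exact key _ _ (abs_abs_sub_abs_le_abs_sub _ _)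

theorem norm_exp_mul_log_sub_one_le {q : ℂ} (hq : ‖q - 1‖ ≤ 1 / 2) {u : ℝ} (hu : u ∈ Icc (0 : ℝ) 1) :
    ‖Complex.exp (u * Complex.log q) - 1‖ ≤ 3 * ‖q - 1‖ := by
  have h1 : ‖Complex.log q‖ ≤ 3 / 2 * ‖q - 1‖ := by
    simpa using Complex.norm_log_one_add_half_le_self hq
  have h2 : ‖(u : ℂ) * Complex.log q‖ ≤ 3 / 2 * ‖q - 1‖ := by
    rw [norm_mul, Complex.norm_real, Real.norm_of_nonneg hu.1]
    nlinarith [hu.2, norm_nonneg (Complex.log q)]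
  have h3 := Complex.norm_exp_sub_one_le (x := (u : ℂ) * Complex.log q) (by linarith)
  linarith

theorem norm_mul_exp_le {v w l : ℂ} (h : v * Complex.exp l = w) {u : ℝ} (hu : u ∈ Icc (0 : ℝ) 1) :
    ‖v * Complex.exp (u * l)‖ ≤ max ‖v‖ ‖w‖ := by
  rw [← h, norm_mul, norm_mul, Complex.norm_exp, Complex.norm_exp, Complex.re_ofReal_mul]
  rcases le_total l.re 0 with h0 | h0
  · refine le_max_of_le_left (mul_le_of_le_one_right (norm_nonneg _) ?_)
    rw [Real.exp_le_one_iff]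
    exact mul_nonpos_of_nonneg_of_nonpos hu.1 h0
  · refine le_max_of_le_right (mul_le_mul_of_nonneg_left ?_ (norm_nonneg _))
    rw [Real.exp_le_exp]
    exact mul_le_of_le_one_left h0 hu.2

namespace ChartCover

variable {S : Type*} [MetricSpace S] {ι : Type*} [Finite ι] {ψ : ι → S → ℂ} {K : ι → Set S}
  {c : S → ι} {lam r₀ : ℝ}

theorem continuousOn_invFunOn [Nonempty S] (h : ChartCover ψ K c lam r₀) (i : ι) :
    ContinuousOn (Function.invFunOn (ψ i) (K i)) (ψ i '' K i) := by
  rw [Metric.continuousOn_iff]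
  rintro _ ⟨p, hp, rfl⟩ κ hκ
  obtain ⟨μ, hμ, H⟩ := h.exists_le_norm hκ
  refine ⟨μ, hμ, ?_⟩
  rintro _ ⟨w, hw, rfl⟩ hd
  rw [(h.inj i).leftInvOn_invFunOn hp, (h.inj i).leftInvOn_invFunOn hw]
  by_contra hcon
  have := H i w hw p hp (not_lt.1 hcon)
  rw [dist_eq_norm] at hd
  linarith

/-- Triviality of the relative position of two curves as seen in the good chart at `z` implies
triviality in any other chart around `z`. -/
theorem logTrivial_transfer (h : ChartCover ψ K c lam r₀) {r : ℝ} (hr : 0 < r) :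
    ∃ ε > 0, ∀ (z : S) (i : ι), closedBall z (lam / 2) ⊆ K i → ∀ X Y : ℝ → S, ∀ s t, s ≤ t →
      ContinuousOn X (Icc s t) → ContinuousOn Y (Icc s t) →
      (∀ u ∈ Icc s t, X u ∈ ball z r₀ ∧ X u ∈ closedBall z (lam / 2) ∧ X u ≠ z) →
      (∀ u ∈ Icc s t, Y u ∈ ball z r₀ ∧ Y u ∈ closedBall z (lam / 2) ∧ Y u ≠ z) →
      dist (X s) (Y s) < ε → dist (X t) (Y t) < ε → r ≤ dist (X s) z → r ≤ dist (X t) z →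
      LogTrivial (relQuot (ψ (c z)) X Y z) s t → LogTrivial (relQuot (ψ i) X Y z) s t := by
  obtain ⟨κ₁, hκ₁, Q1⟩ := h.exists_norm_lt_mul hr one_pos
  obtain ⟨μ, hμ, Q2⟩ := h.exists_le_norm hκ₁
  obtain ⟨κ₂, hκ₂, Q3⟩ := h.exists_norm_lt_mul hr (one_half_pos (α := ℝ))
  obtain ⟨κ₃, hκ₃, Q4⟩ := h.exists_norm_lt (ν := μ / 3) (by positivity)
  refine ⟨min κ₂ κ₃, by positivity, ?_⟩
  intro z i hi X Y s t hst hX hY hXz hYz hds hdt hrs hrt htriv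
  have : Nonempty S := ⟨z⟩
  have hlam := h.lam_pos
  set j := c z with hj
  have hsubj : closedBall z (lam / 2) ⊆ K j :=
    (closedBall_subset_closedBall (by linarith)).trans (h.subset z)
  have hzj : z ∈ K j := hsubj (mem_closedBall_self (by linarith))
  have hzi : z ∈ K i := hi (mem_closedBall_self (by linarith))
  have hXj : ∀ u ∈ Icc s t, X u ∈ K j := fun u hu => hsubj (hXz u hu).2.1
  have hYj : ∀ u ∈ Icc s t, Y u ∈ K j := fun u hu => hsubj (hYz u hu).2.1
  have hXi : ∀ u ∈ Icc s t, X u ∈ K i := fun u hu => hi (hXz u hu).2.1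
  have hYi : ∀ u ∈ Icc s t, Y u ∈ K i := fun u hu => hi (hYz u hu).2.1
  set b := ψ j z with hb
  have ne : ∀ k, z ∈ K k → ∀ p ∈ K k, p ≠ z → ψ k p - ψ k z ≠ 0 := fun k hz p hp hpz =>
    sub_ne_zero.2 fun he => hpz (h.inj k hp hz he)
  have hx0 : ∀ u ∈ Icc s t, ψ j (X u) - b ≠ 0 := fun u hu => ne j hzj _ (hXj u hu) (hXz u hu).2.2
  have hy0 : ∀ u ∈ Icc s t, ψ j (Y u) - b ≠ 0 := fun u hu => ne j hzj _ (hYj u hu) (hYz u hu).2.2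
  have hxc : ContinuousOn (fun u => ψ j (X u)) (Icc s t) := (h.cont j).comp hX hXj
  have hyc : ContinuousOn (fun u => ψ j (Y u)) (Icc s t) := (h.cont j).comp hY hYj
  have hxic : ContinuousOn (fun u => ψ i (X u)) (Icc s t) := (h.cont i).comp hX hXi
  have hyic : ContinuousOn (fun u => ψ i (Y u)) (Icc s t) := (h.cont i).comp hY hYi
  set q := relQuot (ψ j) X Y z with hq
  have hq0 : ∀ u ∈ Icc s t, q u ≠ 0 := fun u hu => div_ne_zero (hy0 u hu) (hx0 u hu)
  have hqc : ContinuousOn q (Icc s t) :=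
    (hyc.sub continuousOn_const).div (hxc.sub continuousOn_const) hx0
  obtain ⟨l₀, hl₀c, hl₀⟩ := exists_log_on_Icc hst hqc hq0
  obtain ⟨l, hlc, hl, hls, hlt⟩ : ∃ l : ℝ → ℂ, ContinuousOn l (Icc s t) ∧
      (∀ u ∈ Icc s t, Complex.exp (l u) = q u) ∧ l s = Complex.log (q s) ∧
      l t = Complex.log (q t) := by
    refine ⟨fun u => l₀ u + (Complex.log (q s) - l₀ s), hl₀c.add continuousOn_const,
      fun u hu => ?_, by ring, ?_⟩
    · rw [Complex.exp_add, Complex.exp_sub, Complex.exp_log (hq0 s (left_mem_Icc.2 hst)),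
        hl₀ s (left_mem_Icc.2 hst), div_self (hq0 s (left_mem_Icc.2 hst)), mul_one, hl₀ u hu]
    · have h1 := logVar_eq (by rwa [uIcc_of_le hst]) (by rwa [uIcc_of_le hst]) (g := q) (l := l₀)
      rw [LogTrivial, h1] at htriv
      linear_combination htriv
  let G : ℝ → ℝ → ℂ := fun v u => foldAt b (b + (ψ j (X u) - b) * Complex.exp (v * l u))
  have hb0 : 0 ≤ b.re := h.re_nonneg j z hzj
  have hfb : foldAt b b = b := foldAt_of_nonneg hb0
  have hGex : ∀ v ∈ Icc (0 : ℝ) 1, ∀ u ∈ Icc s t, ∃ p ∈ ball z (lam / 2), ψ j p = G v u := by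
    intro v hv u hu
    have h1 : ‖G v u - b‖ ≤ max ‖ψ j (X u) - b‖ ‖ψ j (Y u) - b‖ := by
      have h2 := norm_foldAt_sub_le b (b + (ψ j (X u) - b) * Complex.exp (v * l u)) b
      rw [hfb, add_sub_cancel_left] at h2
      refine h2.trans (norm_mul_exp_le ?_ hv)
      rw [hl u hu]
      exact mul_div_cancel₀ _ (hx0 u hu)
    rcases le_max_iff.1 h1 with h2 | h2
    · exact h.surj z (X u) (hXz u hu).1 _ (foldAt_re_nonneg _ _) h2
    · exact h.surj z (Y u) (hYz u hu).1 _ (foldAt_re_nonneg _ _) h2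
  let P : ℝ → ℝ → S := fun v u => Function.invFunOn (ψ j) (K j) (G v u)
  have hP : ∀ p ∈ K j, Function.invFunOn (ψ j) (K j) (ψ j p) = p :=
    fun p hp => (h.inj j).leftInvOn_invFunOn hp
  have hPb : ∀ v ∈ Icc (0 : ℝ) 1, ∀ u ∈ Icc s t, P v u ∈ ball z (lam / 2) ∧ ψ j (P v u) = G v u := by
    intro v hv u hu
    obtain ⟨p, hp, he⟩ := hGex v hv u hu
    have : P v u = p := by
      simp only [P]; rw [← he, hP p (hsubj (ball_subset_closedBall hp))]
    rw [this]
    exact ⟨hp, he⟩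
  have hPz : ∀ v ∈ Icc (0 : ℝ) 1, ∀ u ∈ Icc s t, P v u ≠ z := by
    intro v hv u hu he
    have h1 := (hPb v hv u hu).2
    rw [he] at h1
    have h2 := eq_of_foldAt_eq hb0 h1.symm
    rw [add_eq_left] at h2
    exact mul_ne_zero (hx0 u hu) (Complex.exp_ne_zero _) h2
  have hPi : ∀ v ∈ Icc (0 : ℝ) 1, ∀ u ∈ Icc s t, P v u ∈ K i := fun v hv u hu =>
    hi (ball_subset_closedBall (hPb v hv u hu).1)
  have hPj : ∀ v ∈ Icc (0 : ℝ) 1, ∀ u ∈ Icc s t, P v u ∈ K j := fun v hv u hu =>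
    hsubj (ball_subset_closedBall (hPb v hv u hu).1)
  have hGc : ContinuousOn (fun p : ℝ × ℝ => G p.1 p.2) (Icc 0 1 ×ˢ Icc s t) := by
    have h1 : ContinuousOn (fun p : ℝ × ℝ => ψ j (X p.2)) (Icc (0 : ℝ) 1 ×ˢ Icc s t) :=
      hxc.comp continuousOn_snd fun p hp => hp.2
    have h2 : ContinuousOn (fun p : ℝ × ℝ => l p.2) (Icc (0 : ℝ) 1 ×ˢ Icc s t) :=
      hlc.comp continuousOn_snd fun p hp => hp.2
    have h3 : ContinuousOn (fun p : ℝ × ℝ => (p.1 : ℂ)) (Icc (0 : ℝ) 1 ×ˢ Icc s t) := by fun_prop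
    exact (continuous_foldAt b).comp_continuousOn (continuousOn_const.add
      ((h1.sub continuousOn_const).mul (h3.mul h2).cexp))
  have hPc : ContinuousOn (fun p : ℝ × ℝ => P p.1 p.2) (Icc 0 1 ×ˢ Icc s t) :=
    (h.continuousOn_invFunOn j).comp hGc fun p hp =>
      ⟨P p.1 p.2, hPj _ hp.1 _ hp.2, (hPb _ hp.1 _ hp.2).2⟩
  have hend : ∀ u ∈ Icc s t, dist (X u) (Y u) < min κ₂ κ₃ → r ≤ dist (X u) z →
      l u = Complex.log (q u) → ∀ v ∈ Icc (0 : ℝ) 1,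
      relQuot (ψ i) X (fun u => P v u) z u ∈ Complex.slitPlane := by
    intro u hu hd hru hlu v hv
    rw [dist_comm] at hd
    have e1 := Q3 j (Y u) (hYj u hu) (X u) (hXj u hu) z hzj (hd.trans_le (min_le_left _ _)) hru
    have e2 := Q4 j (Y u) (hYj u hu) (X u) (hXj u hu) (hd.trans_le (min_le_right _ _))
    have hxn : 0 < ‖ψ j (X u) - b‖ := norm_pos_iff.2 (hx0 u hu)
    have hq1 : (ψ j (X u) - b) * (q u - 1) = ψ j (Y u) - ψ j (X u) := by
      have : (ψ j (X u) - b) * q u = ψ j (Y u) - b := mul_div_cancel₀ _ (hx0 u hu)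
      rw [mul_sub, this]; ring
    have hq1n : ‖ψ j (X u) - b‖ * ‖q u - 1‖ = ‖ψ j (Y u) - ψ j (X u)‖ := by rw [← norm_mul, hq1]
    have hq2 : ‖q u - 1‖ ≤ 1 / 2 := by
      rw [← hq1n, mul_comm (1 / 2 : ℝ)] at e1
      exact (lt_of_mul_lt_mul_left e1 hxn.le).le
    have e3 := norm_exp_mul_log_sub_one_le hq2 hv
    have e4 : ‖ψ j (P v u) - ψ j (X u)‖ < μ := by
      rw [(hPb v hv u hu).2]
      have e5 := norm_foldAt_sub_le b (b + (ψ j (X u) - b) * Complex.exp (v * l u)) (ψ j (X u))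
      rw [foldAt_of_nonneg (h.re_nonneg j _ (hXj u hu))] at e5
      refine e5.trans_lt ?_
      have : b + (ψ j (X u) - b) * Complex.exp (v * l u) - ψ j (X u) =
          (ψ j (X u) - b) * (Complex.exp (v * Complex.log (q u)) - 1) := by rw [hlu]; ring
      rw [this, norm_mul]
      calc _ ≤ ‖ψ j (X u) - b‖ * (3 * ‖q u - 1‖) := mul_le_mul_of_nonneg_left e3 hxn.le
        _ = 3 * ‖ψ j (Y u) - ψ j (X u)‖ := by rw [← hq1n]; ring
        _ < μ := by linarith
    have e5 : dist (P v u) (X u) < κ₁ := by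
      by_contra hcon
      linarith [Q2 j _ (hPj v hv u hu) _ (hXj u hu) (not_lt.1 hcon)]
    have e6 := Q1 i _ (hPi v hv u hu) _ (hXi u hu) z hzi e5 hru
    rw [one_mul] at e6
    exact div_mem_slitPlane_of_norm_lt e6
  have hPic : ContinuousOn (fun p : ℝ × ℝ => ψ i (P p.1 p.2)) (Icc 0 1 ×ˢ Icc s t) :=
    (h.cont i).comp hPc fun p hp => hPi _ hp.1 _ hp.2
  have hxi0 : ∀ u ∈ Icc s t, ψ i (X u) - ψ i z ≠ 0 := fun u hu =>
    ne i hzi _ (hXi u hu) (hXz u hu).2.2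
  have hyi0 : ∀ u ∈ Icc s t, ψ i (Y u) - ψ i z ≠ 0 := fun u hu =>
    ne i hzi _ (hYi u hu) (hYz u hu).2.2
  have hom := logTrivial_homotopy (q := fun v => relQuot (ψ i) X (fun u => P v u) z) hst
    ((hPic.sub continuousOn_const).div
      ((hxic.comp continuousOn_snd fun p hp => hp.2).sub continuousOn_const)
      fun p hp => hxi0 _ hp.2)
    (fun v hv u hu => div_ne_zero (ne i hzi _ (hPi v hv u hu) (hPz v hv u hu)) (hxi0 u hu))
    (hend s (left_mem_Icc.2 hst) hds hrs hls) (hend t (right_mem_Icc.2 hst) hdt hrt hlt)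
  have hP0 : ∀ u ∈ Icc s t, P 0 u = X u := by
    intro u hu
    simp only [P, G]
    rw [Complex.ofReal_zero, zero_mul, Complex.exp_zero, mul_one, add_sub_cancel,
      foldAt_of_nonneg (h.re_nonneg j _ (hXj u hu)), hP _ (hXj u hu)]
  have hP1 : ∀ u ∈ Icc s t, P 1 u = Y u := by
    intro u hu
    simp only [P, G]
    rw [Complex.ofReal_one, one_mul, hl u hu, hq, relQuot, mul_div_cancel₀ _ (hx0 u hu),
      add_sub_cancel, foldAt_of_nonneg (h.re_nonneg j _ (hYj u hu)), hP _ (hYj u hu)]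
  have hq0' : LogTrivial (relQuot (ψ i) X (fun u => P 0 u) z) s t := by
    refine (logTrivial_congr (g := fun _ => (1 : ℂ)) continuousOn_const
      (fun _ _ => one_ne_zero) fun u hu => ?_).2
      (logVar_eq_log continuousOn_const fun _ _ => Complex.one_mem_slitPlane)
    rw [uIcc_of_le hst] at hu
    rw [relQuot, hP0 u hu, div_self (hxi0 u hu)]
  refine (logTrivial_congr (g := relQuot (ψ i) X (fun u => P 1 u) z) ?_ ?_ ?_).2 (hom.1 hq0')
  · rw [uIcc_of_le hst]
    refine ContinuousOn.congr (((hyic.sub (continuousOn_const (c := ψ i z))).div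
      (hxic.sub continuousOn_const) hxi0)) fun u hu => ?_
    rw [relQuot, hP1 u hu]
    rfl
  · rw [uIcc_of_le hst]
    intro u hu
    rw [relQuot, hP1 u hu]
    exact div_ne_zero (hyi0 u hu) (hxi0 u hu)
  · rw [uIcc_of_le hst]
    intro u hu
    rw [relQuot, relQuot, hP1 u hu]

end ChartCover

/-- A continuous function has a first time at which it reaches a given value. -/
theorem exists_first_hit {f : ℝ → ℝ} (hf : Continuous f) {a b R : ℝ} (hab : a < b) (ha : f a < R)
    (hb : R ≤ f b) : ∃ d, a < d ∧ d ≤ b ∧ f d = R ∧ ∀ u ∈ Icc a d, f u ≤ R := by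
  have hc : IsCompact (Icc a b ∩ {u | R ≤ f u}) :=
    isCompact_Icc.inter_right (isClosed_le continuous_const hf)
  obtain ⟨d, ⟨hd, hRd⟩, hmin⟩ := hc.exists_isLeast ⟨b, ⟨hab.le, le_rfl⟩, hb⟩
  have hRd : R ≤ f d := hRd
  have had : a < d := hd.1.lt_of_ne (by rintro rfl; exact absurd hRd (not_le.2 ha))
  have hlt : ∀ u ∈ Ico a d, f u < R := fun u hu => by
    by_contra hcon
    exact absurd (hmin ⟨⟨hu.1, hu.2.le.trans hd.2⟩, not_lt.1 hcon⟩) (not_le.2 hu.2)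
  have hle : f d ≤ R := by
    have : d ∈ closure (Ico a d) := by
      rw [closure_Ico had.ne]; exact right_mem_Icc.2 had.le
    exact closure_minimal (fun u hu => (hlt u hu).le) (isClosed_le hf continuous_const) this
  refine ⟨d, had, hd.2, le_antisymm hle hRd, fun u hu => ?_⟩
  rcases hu.2.eq_or_lt with h | h
  · rw [h]; exact hle
  · exact (hlt u ⟨hu.1, h⟩).le

theorem exists_last_hit {f : ℝ → ℝ} (hf : Continuous f) {a b R : ℝ} (hab : b < a) (ha : f a < R)
    (hb : R ≤ f b) : ∃ d, d < a ∧ b ≤ d ∧ f d = R ∧ ∀ u ∈ Icc d a, f u ≤ R := by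
  obtain ⟨d, h1, h2, h3, h4⟩ := exists_first_hit (f := fun u => f (-u)) (by fun_prop)
    (neg_lt_neg hab) (by simpa using ha) (by simpa using hb)
  refine ⟨-d, by linarith, by linarith, h3, fun u hu => ?_⟩
  simpa using h4 (-u) ⟨by linarith [hu.2], by linarith [hu.1]⟩

/-- The smallness conditions on scales used to follow an orbit along a shadow pair. -/
structure Tracking {S : Type*} [MetricSpace S] {ι : Type*} (φ : ℝ → S → S) (ψ : ι → S → ℂ)
    (K : ι → Set S) (c : S → ι) (lam r₀ R ε₁ c₀ ε : ℝ) : Prop where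
  flow : IsFlow φ
  cover : ChartCover ψ K c lam r₀
  R_pos : 0 < R
  R_lam : 8 * R ≤ lam
  R_r₀ : 8 * R ≤ r₀
  ε_pos : 0 < ε
  ε_le : ε ≤ R / 16
  ε₁_pos : 0 < ε₁
  ε₁_le : ε₁ ≤ R / 64
  quot : ∀ i, ∀ w ∈ K i, ∀ p ∈ K i, ∀ z ∈ K i, dist w p < ε → ε₁ ≤ dist p z →
    ‖ψ i w - ψ i p‖ < ‖ψ i p - ψ i z‖
  arc : ∀ x s t, dist (φ s x) (φ t x) ≤ 2 * ε₁ → (∀ u ∈ uIcc s t, dist (φ s x) (φ u x) ≤ 4 * R) →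
    ∀ u ∈ uIcc s t, dist (φ s x) (φ u x) < R / 64
  loop : ∀ x z T T', 0 ≤ T → 0 ≤ T' → (∀ u ∈ Icc 0 T, dist x (φ u x) ≤ 4 * R) →
    (∀ u ∈ Icc 0 T', dist x (φ u z) ≤ 4 * R) → dist x (φ T' z) ≤ ε₁ → dist (φ T x) z ≤ ε₁ →
    dist x (φ T x) < R / 64
  transfer : ∀ (z : S) (i : ι), closedBall z (lam / 2) ⊆ K i → ∀ X Y : ℝ → S, ∀ s t, s ≤ t →
    ContinuousOn X (Icc s t) → ContinuousOn Y (Icc s t) →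
    (∀ u ∈ Icc s t, X u ∈ ball z r₀ ∧ X u ∈ closedBall z (lam / 2) ∧ X u ≠ z) →
    (∀ u ∈ Icc s t, Y u ∈ ball z r₀ ∧ Y u ∈ closedBall z (lam / 2) ∧ Y u ≠ z) →
    dist (X s) (Y s) < ε → dist (X t) (Y t) < ε → R / 2 ≤ dist (X s) z → R / 2 ≤ dist (X t) z →
    LogTrivial (relQuot (ψ (c z)) X Y z) s t → LogTrivial (relQuot (ψ i) X Y z) s t
  c₀_pos : 0 < c₀
  slow : ∀ x u, |u| ≤ c₀ → dist x (φ u x) < R / 16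

/-- The point `z` lies between the curves `X` and `Y` on the window `[a, b]`. -/
structure Captured {S : Type*} [MetricSpace S] {ι : Type*} (ψ : ι → S → ℂ) (c : S → ι) (R : ℝ)
    (X Y : ℝ → S) (z : S) (a b : ℝ) : Prop where
  le : a ≤ b
  near : ∀ u ∈ Icc a b, dist (X u) z ≤ 2 * R
  far_left : R ≤ dist (X a) z
  far_right : R ≤ dist (X b) z
  nontriv : ¬ LogTrivial (relQuot (ψ (c z)) X Y z) a b

/-- The point `z` lies between the curves `X` and `Y` near time `t`. -/
def CapturedAt {S : Type*} [MetricSpace S] {ι : Type*} (ψ : ι → S → ℂ) (c : S → ι) (R ε₁ : ℝ)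
    (X Y : ℝ → S) (z : S) (t : ℝ) : Prop :=
  ∃ a b, t ∈ Icc a b ∧ Captured ψ c R X Y z a b ∧ dist (X t) z ≤ ε₁

namespace Tracking

variable {S : Type*} [MetricSpace S] {ι : Type*} {φ : ℝ → S → S} {ψ : ι → S → ℂ}
  {K : ι → Set S} {c : S → ι} {lam r₀ R ε₁ c₀ ε : ℝ} {X Y : ℝ → S}

/-- A captured point remains captured when it moves a little. -/
theorem transport (H : Tracking φ ψ K c lam r₀ R ε₁ c₀ ε) (hXY : ShadowPair φ (4 * R) ε X Y)
    {γ : ℝ → S} (hγ : ContinuousOn γ (Icc 0 1)) (hoff : ∀ v ∈ Icc (0 : ℝ) 1, ∀ t, X t ≠ γ v)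
    (hball : ∀ v ∈ Icc (0 : ℝ) 1, dist (γ v) (γ 0) ≤ R / 8) {a b : ℝ}
    (hcap : Captured ψ c R X Y (γ 0) a b) :
    ∃ t ∈ Icc a b, CapturedAt ψ c R ε₁ X Y (γ 1) t := by
  have hRp := H.R_pos
  have e1 := H.R_lam
  have e2 := H.R_r₀
  have e3 := H.ε_pos
  have e4 := H.ε_le
  have e5 := H.ε₁_pos
  have e6 := H.ε₁_le
  have m0 : (0 : ℝ) ∈ Icc (0 : ℝ) 1 := left_mem_Icc.2 zero_le_one
  have m1 : (1 : ℝ) ∈ Icc (0 : ℝ) 1 := right_mem_Icc.2 zero_le_one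
  have hoffY : ∀ v ∈ Icc (0 : ℝ) 1, ∀ t, Y t ≠ γ v := fun v hv t => by
    obtain ⟨s, hs⟩ := hXY.mem_orbit t
    rw [hs]; exact hoff v hv s
  set i := c (γ 0) with hi
  have hsub : closedBall (γ 0) lam ⊆ K i := H.cover.subset (γ 0)
  have mem_of : ∀ p, dist p (γ 0) ≤ 3 * R → p ∈ K i := fun p hp => hsub (by
    rw [mem_closedBall]; linarith)
  have memY : ∀ u, dist (X u) (γ 0) ≤ 2 * R → Y u ∈ K i := fun u hu => mem_of _ (by
    linarith [dist_triangle_left (Y u) (γ 0) (X u), hXY.close u])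
  have memX : ∀ u, dist (X u) (γ 0) ≤ 2 * R → X u ∈ K i := fun u hu => mem_of _ (by linarith)
  have memγ : ∀ v ∈ Icc (0 : ℝ) 1, γ v ∈ K i := fun v hv => mem_of _ (by linarith [hball v hv])
  have ne : ∀ v ∈ Icc (0 : ℝ) 1, ∀ p ∈ K i, p ≠ γ v → ψ i p - ψ i (γ v) ≠ 0 :=
    fun v hv p hp hne => sub_ne_zero.2 fun he => hne (H.cover.inj i hp (memγ v hv) he)
  have slit : ∀ v ∈ Icc (0 : ℝ) 1, ∀ u, dist (X u) (γ 0) ≤ 2 * R → ε₁ ≤ dist (X u) (γ v) →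
      relQuot (ψ i) X Y (γ v) u ∈ Complex.slitPlane := fun v hv u hu hd =>
    div_mem_slitPlane_of_norm_lt (H.quot i _ (memY u hu) _ (memX u hu) _ (memγ v hv)
      (by rw [dist_comm]; exact hXY.close u) hd)
  have hcontX : ∀ a b, (∀ u ∈ Icc a b, dist (X u) (γ 0) ≤ 2 * R) →
      ContinuousOn (fun u => ψ i (X u)) (Icc a b) := fun a b hab =>
    (H.cover.cont i).comp hXY.contX.continuousOn fun u hu => memX u (hab u hu)
  have hcontY : ∀ a b, (∀ u ∈ Icc a b, dist (X u) (γ 0) ≤ 2 * R) →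
      ContinuousOn (fun u => ψ i (Y u)) (Icc a b) := fun a b hab =>
    (H.cover.cont i).comp hXY.contY.continuousOn fun u hu => memY u (hab u hu)
  have hγc : ContinuousOn (fun v => ψ i (γ v)) (Icc 0 1) := (H.cover.cont i).comp hγ memγ
  have ham := left_mem_Icc.2 hcap.le
  have hbm := right_mem_Icc.2 hcap.le
  have farv : ∀ v ∈ Icc (0 : ℝ) 1, ∀ u, R ≤ dist (X u) (γ 0) → 7 * R / 8 ≤ dist (X u) (γ v) := by
    intro v hv u hu
    linarith [dist_triangle (X u) (γ v) (γ 0), hball v hv]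
  -- moving the point
  have hom := logTrivial_homotopy (q := fun v => relQuot (ψ i) X Y (γ v)) hcap.le
    ((((hcontY a b hcap.near).comp continuousOn_snd fun p hp => hp.2).sub
      (hγc.comp continuousOn_fst fun p hp => hp.1)).div
      (((hcontX a b hcap.near).comp continuousOn_snd fun p hp => hp.2).sub
      (hγc.comp continuousOn_fst fun p hp => hp.1))
      fun p hp => ne _ hp.1 _ (memX _ (hcap.near _ hp.2)) (hoff _ hp.1 _))
    (fun v hv u hu => div_ne_zero (ne v hv _ (memY u (hcap.near u hu)) (hoffY v hv u))
      (ne v hv _ (memX u (hcap.near u hu)) (hoff v hv u)))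
    (fun v hv => slit v hv a (hcap.near a ham)
      (by linarith [farv v hv a hcap.far_left]))
    (fun v hv => slit v hv b (hcap.near b hbm)
      (by linarith [farv v hv b hcap.far_right]))
  have hnt : ¬ LogTrivial (relQuot (ψ i) X Y (γ 1)) a b := fun h => hcap.nontriv (hom.2 h)
  have hqc : ∀ a b, (∀ u ∈ Icc a b, dist (X u) (γ 0) ≤ 2 * R) →
      ContinuousOn (relQuot (ψ i) X Y (γ 1)) (Icc a b) := fun a b hab =>
    ((hcontY a b hab).sub continuousOn_const).div ((hcontX a b hab).sub continuousOn_const)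
      fun u hu => ne 1 m1 _ (memX u (hab u hu)) (hoff 1 m1 u)
  -- a nearby point
  obtain ⟨t, ht, htd⟩ : ∃ t ∈ Icc a b, dist (X t) (γ 1) ≤ ε₁ := by
    by_contra! hcon
    refine hnt (logVar_eq_log ?_ fun u hu => ?_)
    · rw [uIcc_of_le hcap.le]; exact hqc a b hcap.near
    · rw [uIcc_of_le hcap.le] at hu
      exact slit 1 m1 u (hcap.near u hu) (hcon u hu).le
  have hf : Continuous fun u => dist (X u) (γ 1) := hXY.contX.dist continuous_const
  have hfar : ∀ u, 4 * R < dist (X t) (X u) → R ≤ dist (X u) (γ 1) := fun u hu => by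
    linarith [dist_triangle_right (X t) (X u) (γ 1)]
  obtain ⟨b', htb, hb'⟩ : ∃ b', t < b' ∧ dist (X b') (γ 1) = R ∧
      ∀ u ∈ Icc t b', dist (X u) (γ 1) ≤ R := by
    obtain ⟨u, hu, hd⟩ := hXY.exit_right t
    obtain ⟨d, h1, -, h2⟩ := exists_first_hit hf hu (R := R) (by linarith) (hfar u hd)
    exact ⟨d, h1, h2⟩
  obtain ⟨a', hta, ha'⟩ : ∃ a', a' < t ∧ dist (X a') (γ 1) = R ∧
      ∀ u ∈ Icc a' t, dist (X u) (γ 1) ≤ R := by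
    obtain ⟨u, hu, hd⟩ := hXY.exit_left t
    obtain ⟨d, h1, -, h2⟩ := exists_last_hit hf hu (R := R) (by linarith) (hfar u hd)
    exact ⟨d, h1, h2⟩
  have near' : ∀ u ∈ Icc a' b', dist (X u) (γ 1) ≤ R := fun u hu => by
    rcases le_total u t with h | h
    · exact ha'.2 u ⟨hu.1, h⟩
    · exact hb'.2 u ⟨h, hu.2⟩
  have near0 : ∀ u ∈ Icc a' b', dist (X u) (γ 0) ≤ 2 * R := fun u hu => by
    linarith [dist_triangle (X u) (γ 1) (γ 0), hball 1 m1, near' u hu]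
  have near1 : ∀ u ∈ Icc a b, dist (X u) (γ 1) ≤ 3 * R := fun u hu => by
    linarith [dist_triangle_right (X u) (γ 1) (γ 0), hball 1 m1, hcap.near u hu]
  -- near points are reached only inside both windows
  have harc : ∀ u w, dist (X u) (γ 1) < ε₁ → w ∈ uIcc t u →
      (∀ v ∈ uIcc t u, dist (X v) (γ 1) ≤ 3 * R) → 7 * R / 8 ≤ dist (X w) (γ 1) → False := by
    intro u w hu hw hv hd
    have horb : ∀ v, X v = φ v (X 0) := fun v => by rw [hXY.orbit, add_zero]
    have := H.arc (X 0) t u (by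
      rw [← horb, ← horb]
      linarith [dist_triangle_right (X t) (X u) (γ 1)]) (fun v hv' => by
      rw [← horb, ← horb]
      linarith [dist_triangle_right (X t) (X v) (γ 1), hv v hv']) w hw
    rw [← horb, ← horb] at this
    linarith [dist_triangle_left (X w) (γ 1) (X t)]
  have sideR : ∀ u ∈ uIcc b b', ε₁ ≤ dist (X u) (γ 1) := by
    intro u hu
    by_contra! hcon
    rcases le_total b b' with h | h
    · rw [uIcc_of_le h] at hu
      refine harc u b hcon ?_ (fun v hv => ?_) (farv 1 m1 b hcap.far_right)
      · rw [uIcc_of_le (ht.2.trans hu.1)]; exact ⟨ht.2, hu.1⟩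
      · rw [uIcc_of_le (ht.2.trans hu.1)] at hv
        linarith [hb'.2 v ⟨hv.1, hv.2.trans hu.2⟩]
    · rw [uIcc_of_ge h] at hu
      refine harc u b' hcon ?_ (fun v hv => ?_) (by linarith [hb'.1])
      · rw [uIcc_of_le (htb.le.trans hu.1)]; exact ⟨htb.le, hu.1⟩
      · rw [uIcc_of_le (htb.le.trans hu.1)] at hv
        exact near1 v ⟨ht.1.trans hv.1, hv.2.trans hu.2⟩
  have sideL : ∀ u ∈ uIcc a a', ε₁ ≤ dist (X u) (γ 1) := by
    intro u hu
    by_contra! hcon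
    rcases le_total a' a with h | h
    · rw [uIcc_of_ge h] at hu
      refine harc u a hcon ?_ (fun v hv => ?_) (farv 1 m1 a hcap.far_left)
      · rw [uIcc_of_ge (hu.2.trans ht.1)]; exact ⟨hu.2, ht.1⟩
      · rw [uIcc_of_ge (hu.2.trans ht.1)] at hv
        linarith [ha'.2 v ⟨hu.1.trans hv.1, hv.2⟩]
    · rw [uIcc_of_le h] at hu
      refine harc u a' hcon ?_ (fun v hv => ?_) (by linarith [ha'.1])
      · rw [uIcc_of_ge (hu.2.trans hta.le)]; exact ⟨hu.2, hta.le⟩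
      · rw [uIcc_of_ge (hu.2.trans hta.le)] at hv
        exact near1 v ⟨hu.1.trans hv.1, hv.2.trans ht.2⟩
  have nearAll : ∀ u ∈ Icc (min a a') (max b b'), dist (X u) (γ 0) ≤ 2 * R := by
    intro u hu
    by_cases h : u ∈ Icc a b
    · exact hcap.near u h
    · refine near0 u ?_
      rw [mem_Icc, not_and_or, not_le, not_le] at h
      rcases h with h | h
      · rcases min_le_iff.1 hu.1 with h1 | h1
        · linarith
        · exact ⟨h1, by linarith [ht.1]⟩
      · rcases le_max_iff.1 hu.2 with h1 | h1
        · linarith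
        · exact ⟨by linarith [ht.2], h1⟩
  have ha_mem : a ∈ Icc (min a a') (max b b') :=
    ⟨min_le_left _ _, hcap.le.trans (le_max_left _ _)⟩
  have ha_mem' : a' ∈ Icc (min a a') (max b b') :=
    ⟨min_le_right _ _, (hta.trans htb).le.trans (le_max_right _ _)⟩
  have hb_mem : b ∈ Icc (min a a') (max b b') :=
    ⟨(min_le_left _ _).trans hcap.le, le_max_left _ _⟩
  have hb_mem' : b' ∈ Icc (min a a') (max b b') :=
    ⟨(min_le_right _ _).trans (hta.trans htb).le, le_max_right _ _⟩
  have hnt' : ¬ LogTrivial (relQuot (ψ i) X Y (γ 1)) a' b' := by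
    rwa [← logTrivial_window_iff (hqc _ _ nearAll)
      (fun u hu => div_ne_zero (ne 1 m1 _ (memY u (nearAll u hu)) (hoffY 1 m1 u))
        (ne 1 m1 _ (memX u (nearAll u hu)) (hoff 1 m1 u))) ha_mem hb_mem ha_mem' hb_mem'
      (fun u hu => slit 1 m1 u (nearAll u (uIcc_subset_Icc ha_mem ha_mem' hu)) (sideL u hu))
      (fun u hu => slit 1 m1 u (nearAll u (uIcc_subset_Icc hb_mem hb_mem' hu)) (sideR u hu))]
  refine ⟨t, ht, a', b', ⟨hta.le, htb.le⟩, ⟨(hta.trans htb).le, fun u hu => by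
    linarith [near' u hu], ha'.1.ge, hb'.1.ge, fun h => hnt' ?_⟩, htd⟩
  have nearY' : ∀ u ∈ Icc a' b', dist (Y u) (γ 1) ≤ 2 * R := fun u hu => by
    linarith [dist_triangle_left (Y u) (γ 1) (X u), hXY.close u, near' u hu]
  refine H.transfer (γ 1) i ?_ X Y a' b' (hta.trans htb).le hXY.contX.continuousOn
    hXY.contY.continuousOn (fun u hu => ⟨?_, ?_, hoff 1 m1 u⟩)
    (fun u hu => ⟨?_, ?_, hoffY 1 m1 u⟩) (hXY.close _) (hXY.close _) (by linarith [ha'.1])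
    (by linarith [hb'.1]) h
  · refine (closedBall_subset_closedBall' ?_).trans hsub
    linarith [hball 1 m1]
  · rw [mem_ball]; linarith [near' u hu]
  · rw [mem_closedBall]; linarith [near' u hu]
  · rw [mem_ball]; linarith [nearY' u hu]
  · rw [mem_closedBall]; linarith [nearY' u hu]

/-- Following a captured orbit until it has moved a definite amount. -/
theorem step (H : Tracking φ ψ K c lam r₀ R ε₁ c₀ ε) (hXY : ShadowPair φ (4 * R) ε X Y) {z : S}
    (hoff : ∀ s t, X t ≠ φ s z) {s t : ℝ} (hcap : CapturedAt ψ c R ε₁ X Y (φ s z) t) :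
    (∀ σ, s ≤ σ → dist (φ σ z) (φ s z) ≤ R / 8) ∨
      ∃ s' t', s + c₀ ≤ s' ∧ t + c₀ ≤ t' ∧ CapturedAt ψ c R ε₁ X Y (φ s' z) t' ∧
        ∀ σ ∈ Icc s s', ∀ θ ∈ Icc t t', dist (φ σ z) (X θ) ≤ 3 * R := by
  have hRp := H.R_pos
  have e5 := H.ε₁_pos
  have e6 := H.ε₁_le
  have hfl : ∀ u v, φ u (φ v z) = φ (u + v) z := fun u v => H.flow.add u v z
  rw [or_iff_not_imp_left]
  intro hst
  push Not at hst
  obtain ⟨σ, hsσ, hσ⟩ := hst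
  have hsσ : s < σ := hsσ.lt_of_ne (by rintro rfl; rw [dist_self] at hσ; linarith)
  have hc : Continuous fun u => φ u z := H.flow.continuous_time z
  obtain ⟨s', hss', -, hs', hball⟩ := exists_first_hit (hc.dist continuous_const) hsσ
    (f := fun u => dist (φ u z) (φ s z)) (R := R / 8) (by rw [dist_self]; linarith) hσ.le
  obtain ⟨a, b, htab, hcap, htd⟩ := hcap
  have hp : ∀ v ∈ Icc (0 : ℝ) 1, s + v * (s' - s) ∈ Icc s s' := fun v hv =>
    ⟨by nlinarith [hv.1], by nlinarith [hv.2]⟩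
  obtain ⟨t', ht', hcap'⟩ := H.transport hXY (γ := fun v => φ (s + v * (s' - s)) z)
    (hc.comp (by fun_prop)).continuousOn (fun v _ t => hoff _ t)
    (fun v hv => by simpa using hball _ (hp v hv)) (a := a) (b := b) (by simpa using hcap)
  simp only [one_mul, add_sub_cancel] at hcap'
  obtain ⟨a', b', -, -, htd'⟩ := id hcap'
  have hmove : R / 16 ≤ dist (X t) (X t') := by
    have h1 := dist_triangle4 (φ s' z) (X t') (X t) (φ s z)
    linarith [dist_comm (φ s' z) (X t'), dist_comm (X t') (X t)]
  have hrect : ∀ σ ∈ Icc s s', ∀ θ ∈ Icc a b, dist (φ σ z) (X θ) ≤ 3 * R := fun σ hσ θ hθ => by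
    linarith [dist_triangle_right (φ σ z) (X θ) (φ s z), hball σ hσ, hcap.near θ hθ]
  have hX2 : ∀ u ∈ Icc a b, dist (X t') (X u) ≤ 4 * R := fun u hu => by
    linarith [dist_triangle_right (X t') (X u) (φ s z), hcap.near u hu, hcap.near t' ht']
  have htt' : t < t' := by
    by_contra! hle
    have := H.loop (X t') (φ s z) (t - t') (s' - s) (by linarith) (by linarith)
      (fun u hu => by
        rw [hXY.orbit]
        exact hX2 _ ⟨by linarith [hu.1, ht'.1], by linarith [hu.2, htab.2]⟩)
      (fun u hu => by
        rw [hfl, dist_comm]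
        linarith [hrect (u + s) ⟨by linarith [hu.1], by linarith [hu.2]⟩ t' ht'])
      (by rwa [hfl, sub_add_cancel]) (by rwa [hXY.orbit, sub_add_cancel])
    rw [hXY.orbit, sub_add_cancel, dist_comm] at this
    linarith
  refine ⟨s', t', ?_, ?_, hcap', fun σ hσ θ hθ =>
    hrect σ hσ θ ⟨htab.1.trans hθ.1, hθ.2.trans ht'.2⟩⟩
  · by_contra! hlt
    have := H.slow (φ s z) (s' - s) (by rw [abs_of_pos] <;> linarith)
    rw [hfl, sub_add_cancel, dist_comm] at this
    linarith
  · by_contra! hlt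
    have := H.slow (X t) (t' - t) (by rw [abs_of_pos] <;> linarith)
    rw [hXY.orbit, sub_add_cancel] at this
    linarith

end Tracking

section Reverse

variable {S : Type*} [MetricSpace S] {φ : ℝ → S → S}

theorem IsFlow.reverse (hφ : IsFlow φ) : IsFlow fun t => φ (-t) :=
  ⟨hφ.1.comp (by fun_prop : Continuous fun p : ℝ × S => (-p.1, p.2)), fun x => by
    simpa using hφ.zero x, fun s t x => by
    simp only [hφ.add, neg_add]⟩

theorem IsolatingRadius.reverse {R : ℝ} (hR : IsolatingRadius φ R) :
    IsolatingRadius (fun t => φ (-t)) R where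
  pos := hR.pos
  fixed v c h t := hR.fixed v c (fun t => by simpa using h (-t)) (-t)
  eq p q hp hq := hR.eq p q (fun t => by simpa using hp (-t)) (fun t => by simpa using hq (-t))

theorem IsolatingRadius.mono {R R' : ℝ} (hR : IsolatingRadius φ R) (h0 : 0 < R') (h : R' ≤ R) :
    IsolatingRadius φ R' where
  pos := h0
  fixed v c hv := hR.fixed v c fun t => (hv t).trans h
  eq p q hp hq hpq := hR.eq p q hp hq (hpq.trans h)

theorem IsFlow.exists_slow [CompactSpace S] (hφ : IsFlow φ) {η : ℝ} (hη : 0 < η) :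
    ∃ c₀ > 0, ∀ x u, |u| ≤ c₀ → dist x (φ u x) < η := by
  have hc : CompactSpace (Icc (-1 : ℝ) 1) := isCompact_iff_compactSpace.1 isCompact_Icc
  have hu : UniformContinuousOn (fun p : ℝ × S => φ p.1 p.2) (Icc (-1 : ℝ) 1 ×ˢ univ) :=
    (isCompact_Icc.prod isCompact_univ).uniformContinuousOn_of_continuous hφ.1.continuousOn
  obtain ⟨d, hd, H⟩ := Metric.uniformContinuousOn_iff.1 hu η hη
  refine ⟨min 1 (d / 2), by positivity, fun x u hu => ?_⟩
  have h1 := hu.trans (min_le_left _ _)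
  have h2 := hu.trans (min_le_right _ _)
  have := H (0, x) ⟨by constructor <;> norm_num, trivial⟩ (u, x) ⟨abs_le.1 h1, trivial⟩ (by
    simp only [Prod.dist_eq, dist_self, Real.dist_eq, zero_sub, abs_neg]
    rw [max_eq_left (abs_nonneg u)]
    linarith)
  simpa [hφ.zero] using this

end Reverse

theorem ChartCover.exists_tracking {S : Type*} [MetricSpace S] [CompactSpace S] {φ : ℝ → S → S}
    {ι : Type*} [Finite ι] {ψ : ι → S → ℂ} {K : ι → Set S} {c : S → ι} {lam r₀ R : ℝ}
    (h : ChartCover ψ K c lam r₀) (hφ : IsFlow φ) (hR : IsolatingRadius φ (8 * R)) (hl : 8 * R ≤ lam)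
    (hr : 8 * R ≤ r₀) : ∃ ε₁ > 0, ∃ c₀ > 0, ∃ ε₀ > 0, ∀ ε, 0 < ε → ε ≤ ε₀ →
      Tracking φ ψ K c lam r₀ R ε₁ c₀ ε ∧
      Tracking (fun t => φ (-t)) ψ K c lam r₀ R ε₁ c₀ ε := by
  have hRp : 0 < R := by linarith [hR.pos]
  have hη : 0 < R / 64 := by positivity
  obtain ⟨a₁, ha₁, A₁⟩ := hR.arc_small hφ hη
  obtain ⟨a₂, ha₂, A₂⟩ := hR.reverse.arc_small hφ.reverse hη
  obtain ⟨l₁, hl₁, L₁⟩ := hR.loop_small hφ hη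
  obtain ⟨l₂, hl₂, L₂⟩ := hR.reverse.loop_small hφ.reverse hη
  obtain ⟨c₁, hc₁, C₁⟩ := hφ.exists_slow (η := R / 16) (by positivity)
  obtain ⟨ε₁, hε₁, e1, e2, e3, e4, e5⟩ : ∃ ε₁ > 0, ε₁ ≤ R / 64 ∧ 2 * ε₁ < a₁ ∧ 2 * ε₁ < a₂ ∧
      ε₁ < l₁ ∧ ε₁ < l₂ := by
    refine ⟨min (min (R / 64) (min (a₁ / 3) (a₂ / 3))) (min (l₁ / 2) (l₂ / 2)), by positivity, ?_⟩
    set m := min (min (R / 64) (min (a₁ / 3) (a₂ / 3))) (min (l₁ / 2) (l₂ / 2))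
    have h1 : m ≤ R / 64 := (min_le_left _ _).trans (min_le_left _ _)
    have h2 : m ≤ a₁ / 3 := (min_le_left _ _).trans ((min_le_right _ _).trans (min_le_left _ _))
    have h3 : m ≤ a₂ / 3 := (min_le_left _ _).trans ((min_le_right _ _).trans (min_le_right _ _))
    have h4 : m ≤ l₁ / 2 := (min_le_right _ _).trans (min_le_left _ _)
    have h5 : m ≤ l₂ / 2 := (min_le_right _ _).trans (min_le_right _ _)
    refine ⟨h1, ?_, ?_, ?_, ?_⟩ <;> linarith
  obtain ⟨κ, hκ, Q⟩ := h.exists_norm_lt_mul hε₁ one_pos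
  obtain ⟨τ, hτ, T⟩ := h.logTrivial_transfer (half_pos hRp)
  refine ⟨ε₁, hε₁, c₁, hc₁, min (R / 16) (min κ τ), by positivity, fun ε hε hle => ?_⟩
  have f1 : ε ≤ R / 16 := hle.trans (min_le_left _ _)
  have f2 : ε ≤ κ := hle.trans ((min_le_right _ _).trans (min_le_left _ _))
  have f3 : ε ≤ τ := hle.trans ((min_le_right _ _).trans (min_le_right _ _))
  have main : ∀ φ' : ℝ → S → S, IsFlow φ' →
      (∀ x s t, dist (φ' s x) (φ' t x) ≤ 2 * ε₁ →
        (∀ u ∈ uIcc s t, dist (φ' s x) (φ' u x) ≤ 4 * R) →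
        ∀ u ∈ uIcc s t, dist (φ' s x) (φ' u x) < R / 64) →
      (∀ x z T T', 0 ≤ T → 0 ≤ T' → (∀ u ∈ Icc 0 T, dist x (φ' u x) ≤ 4 * R) →
        (∀ u ∈ Icc 0 T', dist x (φ' u z) ≤ 4 * R) → dist x (φ' T' z) ≤ ε₁ →
        dist (φ' T x) z ≤ ε₁ → dist x (φ' T x) < R / 64) →
      (∀ x u, |u| ≤ c₁ → dist x (φ' u x) < R / 16) →
      Tracking φ' ψ K c lam r₀ R ε₁ c₁ ε := fun φ' hf hA hL hC =>
    { flow := hf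
      cover := h
      R_pos := hRp
      R_lam := hl
      R_r₀ := hr
      ε_pos := hε
      ε_le := f1
      ε₁_pos := hε₁
      ε₁_le := e1
      quot := fun i w hw p hp z hz hwp hpz => by
        simpa using Q i w hw p hp z hz (hwp.trans_le f2) hpz
      arc := hA
      loop := hL
      transfer := fun z i hi X Y s t hst hX hY h1 h2 h3 h4 =>
        T z i hi X Y s t hst hX hY h1 h2 (h3.trans_le f3) (h4.trans_le f3)
      c₀_pos := hc₁
      slow := hC }
  refine ⟨main φ hφ ?_ ?_ C₁, main _ hφ.reverse ?_ ?_ fun x u hu => C₁ x (-u) (by rwa [abs_neg])⟩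
  · intro x s t hd hu
    exact A₁ x s t (hd.trans_lt e2) fun u hu' => (hu u hu').trans (by linarith)
  · intro x z T T' hT hT' h1 h2 h3 h4
    exact L₁ x z T T' hT hT' (fun u hu => (h1 u hu).trans (by linarith))
      (fun u hu => (h2 u hu).trans (by linarith)) (h3.trans_lt e4) (h4.trans_lt e4)
  · intro x s t hd hu
    exact A₂ x s t (hd.trans_lt e3) fun u hu' => (hu u hu').trans (by linarith)
  · intro x z T T' hT hT' h1 h2 h3 h4
    exact L₂ x z T T' hT hT' (fun u hu => (h1 u hu).trans (by linarith))
      (fun u hu => (h2 u hu).trans (by linarith)) (h3.trans_lt e5) (h4.trans_lt e5)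

theorem logVar_comp_neg (q : ℝ → ℂ) (a b : ℝ) :
    logVar (fun t => q (-t)) (-b) (-a) = -logVar q a b := by
  have hm : ∀ u, u ∈ uIcc (-b) (-a) → -u ∈ uIcc a b := fun u hu => by
    rw [mem_uIcc] at hu ⊢
    rcases hu with h | h
    · left; constructor <;> linarith [h.1, h.2]
    · right; constructor <;> linarith [h.1, h.2]
  have hm' : ∀ u, u ∈ uIcc a b → -u ∈ uIcc (-b) (-a) := fun u hu => by
    rw [mem_uIcc] at hu ⊢
    rcases hu with h | h
    · left; constructor <;> linarith [h.1, h.2]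
    · right; constructor <;> linarith [h.1, h.2]
  by_cases h : ∃ l : ℝ → ℂ, ContinuousOn l (uIcc a b) ∧ ∀ r ∈ uIcc a b, Complex.exp (l r) = q r
  · obtain ⟨l, hl, he⟩ := h
    rw [logVar_eq hl he, logVar_eq (l := fun t => l (-t))
      (hl.comp continuous_neg.continuousOn hm) (fun r hr => he _ (hm r hr))]
    simp
  · have h' : ¬ ∃ l : ℝ → ℂ, ContinuousOn l (uIcc (-b) (-a)) ∧
        ∀ r ∈ uIcc (-b) (-a), Complex.exp (l r) = q (-r) := fun ⟨l, hl, he⟩ =>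
      h ⟨fun t => l (-t), hl.comp continuous_neg.continuousOn hm', fun r hr => by
        simpa using he _ (hm' r hr)⟩
    rw [logVar, logVar, dif_neg h, dif_neg h', neg_zero]

theorem logTrivial_comp_neg_iff {q : ℝ → ℂ} {a b : ℝ} :
    LogTrivial (fun t => q (-t)) (-b) (-a) ↔ LogTrivial q a b := by
  unfold LogTrivial
  rw [logVar_comp_neg, neg_eq_iff_eq_neg, neg_sub]
  simp only [neg_neg]

theorem CapturedAt.reverse {S : Type*} [MetricSpace S] {ι : Type*} {ψ : ι → S → ℂ} {c : S → ι}
    {R ε₁ : ℝ} {X Y : ℝ → S} {z : S} {t : ℝ} (h : CapturedAt ψ c R ε₁ X Y z t) :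
    CapturedAt ψ c R ε₁ (fun t => X (-t)) (fun t => Y (-t)) z (-t) := by
  obtain ⟨a, b, ⟨hat, htb⟩, H, hd⟩ := h
  refine ⟨-b, -a, ⟨by linarith, by linarith⟩, ⟨by linarith [H.le], fun u hu => H.near _
    ⟨by linarith [hu.2], by linarith [hu.1]⟩, by simpa using H.far_right, by simpa using H.far_left,
    fun hl => H.nontriv (logTrivial_comp_neg_iff.1 hl)⟩, by simpa using hd⟩

theorem exists_mem_Ico_of_lt {s : ℕ → ℝ} {x : ℝ} (h0 : s 0 ≤ x) (h : ∃ m, x < s m) :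
    ∃ k, x ∈ Ico (s k) (s (k + 1)) := by
  classical
  have h1 : Nat.find h ≠ 0 := fun h2 => by
    have := Nat.find_spec h
    rw [h2] at this
    exact absurd h0 (not_le.2 this)
  obtain ⟨k, hk⟩ := Nat.exists_eq_succ_of_ne_zero h1
  exact ⟨k, not_lt.1 (Nat.find_min h (m := k) (by omega)), by
    have := Nat.find_spec h
    rwa [hk] at this⟩

/-- A piecewise linear map taking one increasing sequence to another. -/
theorem exists_strictMonoOn_of_seq {s t : ℕ → ℝ} (hs : StrictMono s) (ht : StrictMono t)
    (hlim : ∀ x, ∃ m, x < s m) :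
    ∃ g : ℝ → ℝ, StrictMonoOn g (Ici (s 0)) ∧ g (s 0) = t 0 ∧
      (∀ σ, s 0 ≤ σ → ∃ k, σ ∈ Icc (s k) (s (k + 1)) ∧ g σ ∈ Icc (t k) (t (k + 1))) ∧
      g '' Ici (s 0) = {x | t 0 ≤ x ∧ ∃ k, x < t k} := by
  have hds : ∀ k, 0 < s (k + 1) - s k := fun k => sub_pos.2 (hs k.lt_succ_self)
  have hdt : ∀ k, 0 < t (k + 1) - t k := fun k => sub_pos.2 (ht k.lt_succ_self)
  have hidx : ∀ σ, ∃ k, s 0 ≤ σ → σ ∈ Ico (s k) (s (k + 1)) := fun σ => by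
    by_cases h : s 0 ≤ σ
    · obtain ⟨k, hk⟩ := exists_mem_Ico_of_lt h (hlim σ)
      exact ⟨k, fun _ => hk⟩
    · exact ⟨0, fun h' => absurd h' h⟩
  choose κ hκ using hidx
  have huniq : ∀ σ k, σ ∈ Ico (s k) (s (k + 1)) → κ σ = k := fun σ k hk => by
    have h1 := hκ σ ((hs.monotone k.zero_le).trans hk.1)
    have h2 := hs.lt_iff_lt.1 (h1.1.trans_lt hk.2)
    have h3 := hs.lt_iff_lt.1 (hk.1.trans_lt h1.2)
    omega
  let L : ℕ → ℝ → ℝ := fun k σ => t k + (σ - s k) / (s (k + 1) - s k) * (t (k + 1) - t k)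
  have hL : ∀ k σ, σ ∈ Ico (s k) (s (k + 1)) → L k σ ∈ Ico (t k) (t (k + 1)) := fun k σ hσ => by
    have h1 : 0 ≤ (σ - s k) / (s (k + 1) - s k) := div_nonneg (sub_nonneg.2 hσ.1) (hds k).le
    have h2 : (σ - s k) / (s (k + 1) - s k) < 1 := by
      rw [div_lt_one (hds k)]; linarith [hσ.2]
    constructor <;> simp only [L] <;> nlinarith [hdt k]
  have hmono : ∀ k, StrictMono (L k) := fun k a b hab => by
    have : (a - s k) / (s (k + 1) - s k) < (b - s k) / (s (k + 1) - s k) :=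
      div_lt_div_of_pos_right (by linarith) (hds k)
    simp only [L]
    nlinarith [hdt k]
  refine ⟨fun σ => L (κ σ) σ, ?_, ?_, ?_, ?_⟩
  · intro a ha b hb hab
    have h1 := hκ a ha
    have h2 := hκ b hb
    have h3 : κ a ≤ κ b := Nat.lt_succ_iff.1 (hs.lt_iff_lt.1 (h1.1.trans_lt (hab.trans h2.2)))
    rcases h3.eq_or_lt with h | h
    · simp only [h]; exact hmono _ hab
    · exact ((hL _ _ h1).2.trans_le (ht.monotone h)).trans_le (hL _ _ h2).1
  · have := huniq (s 0) 0 ⟨le_rfl, hs Nat.zero_lt_one⟩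
    simp [this, L]
  · intro σ hσ
    exact ⟨κ σ, Ico_subset_Icc_self (hκ σ hσ), Ico_subset_Icc_self (hL _ _ (hκ σ hσ))⟩
  · ext x
    constructor
    · rintro ⟨σ, hσ, rfl⟩
      have := hL _ _ (hκ σ hσ)
      exact ⟨(ht.monotone (Nat.zero_le _)).trans this.1, _, this.2⟩
    · rintro ⟨h0, h⟩
      obtain ⟨k, hk⟩ := exists_mem_Ico_of_lt h0 h
      have h1 : 0 ≤ (x - t k) / (t (k + 1) - t k) := div_nonneg (sub_nonneg.2 hk.1) (hdt k).le
      have h2 : (x - t k) / (t (k + 1) - t k) < 1 := by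
        rw [div_lt_one (hdt k)]; linarith [hk.2]
      have hσ : s k + (x - t k) / (t (k + 1) - t k) * (s (k + 1) - s k) ∈
          Ico (s k) (s (k + 1)) := by constructor <;> nlinarith [hds k]
      refine ⟨_, (hs.monotone k.zero_le).trans hσ.1, ?_⟩
      simp only [huniq _ _ hσ, L]
      have := (hds k).ne'
      have := (hdt k).ne'
      field_simp
      ring

/-- Sequences built by steps of a definite size which may eventually approach a mark. -/
theorem exists_seq_of_steps {c₀ : ℝ} (hc₀ : 0 < c₀) {P : ℝ → ℝ → Prop} {C : ℝ → ℝ → Prop}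
    (hstep : ∀ s t, P s t → (∀ σ, s ≤ σ → ∀ θ ∈ Icc t (t + c₀), C σ θ) ∨
      ∃ s' t', s + c₀ ≤ s' ∧ t + c₀ ≤ t' ∧ P s' t' ∧ ∀ σ ∈ Icc s s', ∀ θ ∈ Icc t t', C σ θ)
    {s₀ t₀ : ℝ} (h0 : P s₀ t₀) :
    ∃ (s t : ℕ → ℝ) (o : Option ℤ), s 0 = s₀ ∧ t 0 = t₀ ∧ (∀ k, s k + c₀ ≤ s (k + 1)) ∧ StrictMono t ∧
      (∀ x, (∃ k, x < t k) ↔ ∀ n ∈ o, x < n * c₀) ∧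
      ∀ k, ∀ σ ∈ Icc (s k) (s (k + 1)), ∀ θ ∈ Icc (t k) (t (k + 1)), C σ θ := by
  let Q : ℝ × ℝ × Option ℤ → Prop := fun p =>
    (p.2.2 = none → P p.1 p.2.1) ∧ ∀ n ∈ p.2.2, p.2.1 < n * c₀ ∧
      ∀ σ, p.1 ≤ σ → ∀ θ, p.2.1 ≤ θ → θ < n * c₀ → C σ θ
  let r : ℝ × ℝ × Option ℤ → ℝ × ℝ × Option ℤ → Prop := fun p q =>
    p.1 + c₀ ≤ q.1 ∧ p.2.1 < q.2.1 ∧ (∀ σ ∈ Icc p.1 q.1, ∀ θ ∈ Icc p.2.1 q.2.1, C σ θ) ∧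
      (q.2.2 = none → p.2.1 + c₀ ≤ q.2.1) ∧
      ∀ n ∈ p.2.2, q.2.2 = some n ∧ q.2.1 = (p.2.1 + n * c₀) / 2
  have hmark : ∀ (s t : ℝ) (n : ℤ), t < n * c₀ → (∀ σ, s ≤ σ → ∀ θ, t ≤ θ → θ < n * c₀ → C σ θ) →
      Q (s + c₀, (t + n * c₀) / 2, some n) ∧ r (s, t, some n) (s + c₀, (t + n * c₀) / 2, some n) := by
    intro s t n htn hC
    refine ⟨⟨by simp, ?_⟩, le_rfl, by simp only; linarith, ?_, by simp, by simp⟩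
    · rintro m ⟨⟩
      exact ⟨by simp only; linarith, fun σ hσ θ hθ hθ' =>
        hC σ (by simp only at hσ; linarith) θ (by simp only at hθ; linarith) hθ'⟩
    · intro σ hσ θ hθ
      exact hC σ hσ.1 θ hθ.1 (hθ.2.trans_lt (by simp only; linarith))
  have hsucc : ∀ p : {p // Q p}, ∃ q : {q // Q q}, r p q := by
    rintro ⟨⟨s, t, o⟩, hP, hC⟩
    rcases o with _ | n
    · rcases hstep s t (hP rfl) with h | ⟨s', t', hs, ht, hP', hC'⟩
      · obtain ⟨n, hn1, hn2⟩ : ∃ n : ℤ, t < n * c₀ ∧ n * c₀ ≤ t + c₀ := by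
          refine ⟨⌊t / c₀⌋ + 1, ?_, ?_⟩ <;> push_cast
          · rw [← div_lt_iff₀ hc₀]; exact Int.lt_floor_add_one _
          · have := Int.floor_le (t / c₀)
            rw [le_div_iff₀ hc₀] at this
            linarith
        obtain ⟨h1, h2, h3, h4, h5⟩ := hmark s t n hn1 fun σ hσ θ h1 h2 => h σ hσ θ ⟨h1, by linarith⟩
        exact ⟨⟨_, h1⟩, h2, h3, h4, by simp, by simp⟩
      · exact ⟨⟨(s', t', none), fun _ => hP', by simp⟩, hs, by simp only; linarith, hC',
          fun _ => ht, by simp⟩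
    · obtain ⟨h1, h2⟩ := hmark s t n (hC n rfl).1 (hC n rfl).2
      exact ⟨⟨_, h1⟩, h2⟩
  choose F hF using hsucc
  let f : ℕ → {p // Q p} := fun k => F^[k] ⟨(s₀, t₀, none), fun _ => h0, by simp⟩
  have hf : ∀ k, r (f k) (f (k + 1)) := fun k => by
    simp only [f, Function.iterate_succ_apply']
    exact hF _
  have hmono : StrictMono fun k => (f k).1.2.1 := strictMono_nat_of_lt_succ fun k => (hf k).2.1
  suffices ∃ o : Option ℤ, ∀ x, (∃ k, x < (f k).1.2.1) ↔ ∀ n ∈ o, x < n * c₀ by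
    obtain ⟨o, ho⟩ := this
    exact ⟨fun k => (f k).1.1, fun k => (f k).1.2.1, o, rfl, rfl, fun k => (hf k).1,
      hmono, ho, fun k => (hf k).2.2.1⟩
  by_cases hall : ∀ k, (f k).1.2.2 = none
  · refine ⟨none, fun x => ⟨by simp, fun _ => ?_⟩⟩
    have hge : ∀ k : ℕ, t₀ + k * c₀ ≤ (f k).1.2.1 := fun k => by
      induction k with
      | zero => simp [f]
      | succ k ih =>
        have := (hf k).2.2.2.1 (hall _)
        push_cast
        linarith
    obtain ⟨k, hk⟩ := exists_nat_gt ((x - t₀) / c₀)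
    rw [div_lt_iff₀ hc₀] at hk
    exact ⟨k, by linarith [hge k]⟩
  · push Not at hall
    obtain ⟨k₀, hk₀⟩ := hall
    obtain ⟨n, hn⟩ := Option.ne_none_iff_exists'.1 hk₀
    have hstay : ∀ j, (f (k₀ + j)).1.2.2 = some n := fun j => by
      induction j with
      | zero => exact hn
      | succ j ih => exact ((hf (k₀ + j)).2.2.2.2 n ih).1
    have hlt : ∀ j, (f (k₀ + j)).1.2.1 < n * c₀ := fun j => ((f (k₀ + j)).2.2 n (hstay j)).1
    have hgap : ∀ j : ℕ, n * c₀ - (f (k₀ + j)).1.2.1 =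
        (n * c₀ - (f k₀).1.2.1) * (1 / 2) ^ j := fun j => by
      induction j with
      | zero => simp
      | succ j ih =>
        have := ((hf (k₀ + j)).2.2.2.2 n (hstay j)).2
        rw [pow_succ, ← mul_assoc, ← ih, ← add_assoc, this]
        ring
    refine ⟨some n, fun x => ⟨?_, fun h => ?_⟩⟩
    · rintro ⟨k, hk⟩ m ⟨⟩
      exact hk.trans ((hmono.monotone (show k ≤ k₀ + k by omega)).trans_lt (hlt k))
    · have hx := h n rfl
      have h0 : 0 < n * c₀ - (f k₀).1.2.1 := sub_pos.2 (hlt 0)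
      obtain ⟨j, hj⟩ := exists_pow_lt_of_lt_one (div_pos (sub_pos.2 hx) h0)
        (by norm_num : (1 / 2 : ℝ) < 1)
      rw [lt_div_iff₀ h0] at hj
      exact ⟨k₀ + j, by linarith [hgap j]⟩

/-- The interval with the given pair of end marks, a missing mark meaning an infinite end. -/
def markInterval (c₀ : ℝ) (o : Option ℤ × Option ℤ) : Set ℝ :=
  {x | (∀ n ∈ o.1, -x < n * c₀) ∧ ∀ n ∈ o.2, x < n * c₀}

/-- The orbit of `z` follows the curve `X` along the interval with end marks `o`, up to
reparametrisation. -/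
def Follows {S : Type*} [MetricSpace S] (φ : ℝ → S → S) (R c₀ : ℝ) (X : ℝ → S) (z : S)
    (o : Option ℤ × Option ℤ) : Prop :=
  ∃ g : ℝ → ℝ, StrictMono g ∧ range g = markInterval c₀ o ∧ ∀ σ, dist (φ σ z) (X (g σ)) ≤ 3 * R

namespace Tracking

variable {S : Type*} [MetricSpace S] {ι : Type*} {φ : ℝ → S → S} {ψ : ι → S → ℂ}
  {K : ι → Set S} {c : S → ι} {lam r₀ R ε₁ c₀ ε : ℝ} {X Y : ℝ → S}

theorem exists_forward (H : Tracking φ ψ K c lam r₀ R ε₁ c₀ ε) (hXY : ShadowPair φ (4 * R) ε X Y)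
    {z : S} (hoff : ∀ s t, X t ≠ φ s z) {t₀ : ℝ} (hcap : CapturedAt ψ c R ε₁ X Y z t₀) :
    ∃ (g : ℝ → ℝ) (o : Option ℤ), StrictMonoOn g (Ici 0) ∧ g 0 = t₀ ∧
      g '' Ici 0 = {x | t₀ ≤ x ∧ ∀ n ∈ o, x < n * c₀} ∧
      ∀ σ, 0 ≤ σ → dist (φ σ z) (X (g σ)) ≤ 3 * R := by
  have hRp := H.R_pos
  obtain ⟨s, t, o, hs0, ht0, hs, ht, ho, hclose⟩ := exists_seq_of_steps H.c₀_pos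
    (P := fun s t => CapturedAt ψ c R ε₁ X Y (φ s z) t)
    (C := fun σ θ => dist (φ σ z) (X θ) ≤ 3 * R) (s₀ := 0) (t₀ := t₀) (fun s t hst => by
      refine (H.step hXY hoff hst).imp_left fun h σ hσ θ hθ => ?_
      obtain ⟨a, b, -, -, hd⟩ := hst
      have h1 := H.slow (X t) (θ - t) (by rw [abs_of_nonneg] <;> linarith [hθ.1, hθ.2])
      rw [hXY.orbit, sub_add_cancel] at h1
      linarith [dist_triangle4_right (φ σ z) (X θ) (φ s z) (X t), h σ hσ, H.ε₁_le,
        dist_comm (X t) (X θ), dist_comm (X t) (φ s z)]) (by rwa [H.flow.zero])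
  have hsm : StrictMono s := strictMono_nat_of_lt_succ fun k => by linarith [hs k, H.c₀_pos]
  have hlim : ∀ x, ∃ m, x < s m := fun x => by
    have hge : ∀ k : ℕ, k * c₀ ≤ s k := fun k => by
      induction k with
      | zero => simp [hs0]
      | succ k ih => push_cast; linarith [hs k]
    obtain ⟨k, hk⟩ := exists_nat_gt (x / c₀)
    rw [div_lt_iff₀ H.c₀_pos] at hk
    exact ⟨k, hk.trans_le (hge k)⟩
  obtain ⟨g, hg, hg0, hgm, hgi⟩ := exists_strictMonoOn_of_seq hsm ht hlim
  rw [hs0] at hg hg0 hgm hgi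
  refine ⟨g, o, hg, hg0.trans ht0, ?_, fun σ hσ => ?_⟩
  · rw [hgi, ht0]
    ext x
    simp only [mem_ofPred_eq, ho]
  · obtain ⟨k, h1, h2⟩ := hgm σ hσ
    exact hclose k σ h1 _ h2

theorem exists_follows (H : Tracking φ ψ K c lam r₀ R ε₁ c₀ ε)
    (H' : Tracking (fun t => φ (-t)) ψ K c lam r₀ R ε₁ c₀ ε) (hXY : ShadowPair φ (4 * R) ε X Y)
    {z : S} (hoff : ∀ s t, X t ≠ φ s z) {t₀ : ℝ} (hcap : CapturedAt ψ c R ε₁ X Y z t₀) :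
    ∃ o, Follows φ R c₀ X z o := by
  obtain ⟨g, o, hg, hg0, hgi, hgd⟩ := H.exists_forward hXY hoff hcap
  obtain ⟨g', o', hg', hg0', hgi', hgd'⟩ := H'.exists_forward hXY.reverse
    (fun s t => hoff _ _) hcap.reverse
  have hpos : ∀ σ, 0 ≤ σ → t₀ ≤ g σ ∧ ∀ n ∈ o, g σ < n * c₀ := fun σ hσ =>
    hgi.subset (mem_image_of_mem g hσ)
  have hpos' : ∀ σ, 0 ≤ σ → -t₀ ≤ g' σ ∧ ∀ n ∈ o', g' σ < n * c₀ := fun σ hσ =>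
    hgi'.subset (mem_image_of_mem g' hσ)
  refine ⟨(o', o), fun σ => if 0 ≤ σ then g σ else -g' (-σ), ?_, ?_, fun σ => ?_⟩
  · intro a b hab
    by_cases ha : 0 ≤ a
    · simp only [if_pos ha, if_pos (ha.trans hab.le)]
      exact hg ha (ha.trans hab.le) hab
    · have ha' : 0 < -a := by linarith [not_le.1 ha]
      by_cases hb : 0 ≤ b
      · simp only [if_neg ha, if_pos hb]
        have := hg' (mem_Ici.2 le_rfl) ha'.le ha'
        linarith [(hpos b hb).1]
      · simp only [if_neg ha, if_neg hb]
        exact neg_lt_neg (hg' (mem_Ici.2 (by linarith)) ha'.le (neg_lt_neg hab))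
  · ext x
    constructor
    · rintro ⟨σ, rfl⟩
      by_cases h : 0 ≤ σ
      · simp only [if_pos h]
        refine ⟨fun n hn => ?_, (hpos σ h).2⟩
        have := (hpos' 0 le_rfl).2 n hn
        linarith [(hpos σ h).1]
      · simp only [if_neg h]
        have h' : 0 ≤ -σ := by linarith [not_le.1 h]
        refine ⟨fun n hn => ?_, fun n hn => ?_⟩
        · simpa using (hpos' _ h').2 n hn
        · have := (hpos 0 le_rfl).2 n hn
          linarith [(hpos' _ h').1]
    · rintro ⟨h1, h2⟩
      rcases le_or_gt t₀ x with hx | hx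
      · obtain ⟨σ, hσ, rfl⟩ := hgi.superset ⟨hx, h2⟩
        exact ⟨σ, if_pos hσ⟩
      · obtain ⟨σ, hσ, he⟩ := hgi'.superset ⟨neg_le_neg hx.le, h1⟩
        have hσ : 0 ≤ σ := hσ
        have hσ0 : σ ≠ 0 := by rintro rfl; linarith
        refine ⟨-σ, ?_⟩
        have : ¬ 0 ≤ -σ := fun h => hσ0 (by linarith)
        simp only [if_neg this, neg_neg, he]
  · by_cases h : 0 ≤ σ
    · simp only [if_pos h]; exact hgd σ h
    · simp only [if_neg h]
      simpa using hgd' (-σ) (by linarith [not_le.1 h])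

end Tracking

theorem Follows.orbit_eq {S : Type*} [MetricSpace S] {φ : ℝ → S → S} {R c₀ δ : ℝ} {X : ℝ → S}
    {z z' : S} {o : Option ℤ × Option ℤ} (hφ : IsFlow φ) (hδ : SeparatingAt φ δ) (hR : 6 * R < δ)
    (h : Follows φ R c₀ X z o) (h' : Follows φ R c₀ X z' o) : ∃ s, z' = φ s z := by
  obtain ⟨g, hg, hr, hd⟩ := h
  obtain ⟨g', hg', hr', hd'⟩ := h'
  have h1 : ∀ t, ∃ u, g u = g' t := fun t => (hr.trans hr'.symm).superset (mem_range_self t)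
  have h2 : ∀ u, ∃ t, g' t = g u := fun t => (hr.trans hr'.symm).subset (mem_range_self t)
  choose f hf using h1
  have hmono : StrictMono f := fun a b hab => by
    rw [← hg.lt_iff_lt, hf, hf]; exact hg' hab
  obtain ⟨s, hs⟩ := hδ (φ (f 0) z) z' (fun t => f t - f 0) (fun a b hab => sub_lt_sub_right (hmono hab) _)
    (fun u => by
      obtain ⟨t, ht⟩ := h2 (u + f 0)
      refine ⟨t, ?_⟩
      have : f t = u + f 0 := hg.injective (by rw [hf, ht])
      simp only [this, add_sub_cancel_right]) (sub_self _) (fun t => by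
      rw [hφ.add, sub_add_cancel]
      have := hd (f t)
      rw [hf] at this
      linarith [dist_triangle_right (φ (f t) z) (φ t z') (X (g' t)), hd' t])
  exact ⟨s + f 0, by rw [hs, hφ.add]⟩

/-- A segment between two disjoint compact sets contains one which meets them only at its ends. -/
theorem exists_segment_inter_eq {A B : Set ℂ} (hA : IsCompact A) (hB : IsCompact B)
    {p q : ℂ} (hp : p ∈ A) (hq : q ∈ B) :
    ∃ a ∈ A, ∃ b ∈ B, a ∈ segment ℝ p q ∧ b ∈ segment ℝ p q ∧
      (∀ w ∈ A, w ∈ segment ℝ a b → w = a) ∧ ∀ w ∈ B, w ∈ segment ℝ a b → w = b := by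
  set f : ℝ →ᵃ[ℝ] ℂ := AffineMap.lineMap p q with hf
  have hc : Continuous f := AffineMap.lineMap_continuous
  have hseg : ∀ u ∈ Icc (0 : ℝ) 1, f u ∈ segment ℝ p q := fun u hu => by
    rw [segment_eq_image_lineMap]; exact mem_image_of_mem _ hu
  obtain ⟨u, ⟨hu, huA⟩, humax⟩ := (isCompact_Icc.inter_right (hA.isClosed.preimage hc)
    : IsCompact (Icc (0 : ℝ) 1 ∩ f ⁻¹' A)).exists_isGreatest ⟨0, by simp, by simpa [hf]⟩
  obtain ⟨v, ⟨hv, hvB⟩, hvmin⟩ := (isCompact_Icc.inter_right (hB.isClosed.preimage hc)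
    : IsCompact (Icc u 1 ∩ f ⁻¹' B)).exists_isLeast ⟨1, ⟨hu.2, le_rfl⟩, by simpa [hf]⟩
  have him : ∀ w ∈ segment ℝ (f u) (f v), ∃ r ∈ Icc u v, f r = w := fun w hw => by
    rw [← image_segment, segment_eq_Icc hv.1] at hw
    exact hw
  refine ⟨f u, huA, f v, hvB, hseg u hu, hseg v ⟨hu.1.trans hv.1, hv.2⟩, fun w hw hws => ?_,
    fun w hw hws => ?_⟩
  · obtain ⟨r, hr, rfl⟩ := him w hws
    rw [le_antisymm (humax ⟨⟨hu.1.trans hr.1, hr.2.trans hv.2⟩, hw⟩) hr.1]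
  · obtain ⟨r, hr, rfl⟩ := him w hws
    rw [le_antisymm hr.2 (hvmin ⟨⟨hr.1, hr.2.trans hv.2⟩, hw⟩)]

theorem norm_sub_left_le_of_mem_segment {a b w : ℂ} (h : w ∈ segment ℝ a b) :
    ‖w - a‖ ≤ ‖b - a‖ := by
  obtain ⟨t, ht, rfl⟩ := (segment_eq_image_lineMap ℝ a b).subset h
  rw [AffineMap.lineMap_apply, vsub_eq_sub, vadd_eq_add, add_sub_cancel_right, norm_smul,
    Real.norm_of_nonneg ht.1]
  exact mul_le_of_le_one_left (norm_nonneg _) ht.2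

section Capture

variable {S : Type*} [MetricSpace S] {ι : Type*} {φ : ℝ → S → S} {ψ : ι → S → ℂ}
  {K : ι → Set S} {c : S → ι} {lam r₀ R ε₁ c₀ ε : ℝ} {X Y : ℝ → S}

/-- A shadow pair captures all the points of an open set, except those on its own orbit. -/
theorem ChartCover.exists_capture [CompactSpace S] [Finite ι] (h : ChartCover ψ K c lam r₀)
    (hφ : IsFlow φ) (hR : IsolatingRadius φ (8 * R)) (hε₁ : 0 < ε₁) (hε₁R : ε₁ ≤ R / 64) :
    ∃ ε₀ > 0, ∀ ε c₀ X Y, ε ≤ ε₀ → Tracking φ ψ K c lam r₀ R ε₁ c₀ ε →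
      ShadowPair φ (4 * R) ε X Y → ∃ (i : ι) (m : ℂ) (ν : ℝ), 0 < ν ∧
        (ball m ν ⊆ ψ i '' K i) ∧ ∀ p ∈ K i, ψ i p ∈ ball m ν →
          (∀ s t, X t ≠ φ s p) → ∃ t, CapturedAt ψ c R ε₁ X Y p t := by
  have hRp : 0 < R := by linarith [hR.pos]
  obtain ⟨μ, hμ, Mμ⟩ := h.exists_le_norm (r := 2 * ε₁) (by positivity)
  have hρ : 0 < μ / 10 := by positivity
  set ρ := μ / 10 with hρdef
  obtain ⟨κ, hκ, Kκ⟩ := h.exists_norm_lt hρ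
  obtain ⟨η, hη, hη1, hη2⟩ : ∃ η > 0, η ≤ κ / 4 ∧ η ≤ R / 64 :=
    ⟨min (κ / 4) (R / 64), by positivity, min_le_left _ _, min_le_right _ _⟩
  obtain ⟨a, ha, A⟩ := hR.arc_small hφ hη
  obtain ⟨μa, hμa, Ma⟩ := h.exists_le_norm (half_pos ha)
  obtain ⟨κa, hκa, Ka⟩ := h.exists_norm_lt (lt_min hμa hρ)
  refine ⟨min (min κa (κ / 4)) (a / 2), by positivity, fun ε c₀ X Y hε H hXY => ?_⟩
  have q1 : ε ≤ κa := hε.trans ((min_le_left _ _).trans (min_le_left _ _))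
  have q2 : ε ≤ κ / 4 := hε.trans ((min_le_left _ _).trans (min_le_right _ _))
  have q3 : ε ≤ a / 2 := hε.trans (min_le_right _ _)
  have q4 := H.ε_le
  have q5 := H.R_lam
  have q6 := H.R_r₀
  have hXc := hXY.contX
  have hYc := hXY.contY
  -- the window
  obtain ⟨t₁, ht₁, hd₁⟩ := hXY.exit_right 0
  obtain ⟨t₂, ht₂, hd₂⟩ := hXY.exit_left 0
  obtain ⟨τ', hτ'0, -, hτ'd, hτ'⟩ := exists_first_hit (f := fun u => dist (X u) (X 0))
    (hXc.dist continuous_const) ht₁ (R := 3 / 2 * R) (by rw [dist_self]; positivity)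
    (by rw [dist_comm]; linarith)
  obtain ⟨τ, hτ0, -, hτd, hτ⟩ := exists_last_hit (f := fun u => dist (X u) (X 0))
    (hXc.dist continuous_const) ht₂ (R := 3 / 2 * R) (by rw [dist_self]; positivity)
    (by rw [dist_comm]; linarith)
  have hw : τ ≤ τ' := by linarith
  have hwin : ∀ u ∈ Icc τ τ', dist (X u) (X 0) ≤ 3 / 2 * R := fun u hu => by
    rcases le_total u 0 with h0 | h0
    · exact hτ u ⟨hu.1, h0⟩
    · exact hτ' u ⟨h0, hu.2⟩
  have hwinY : ∀ u ∈ Icc τ τ', dist (Y u) (X 0) ≤ 3 / 2 * R + R / 16 := fun u hu => by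
    linarith [dist_triangle_left (Y u) (X 0) (X u), hXY.close u, hwin u hu]
  have h0w : (0 : ℝ) ∈ Icc τ τ' := ⟨hτ0.le, hτ'0.le⟩
  have hτw : τ ∈ Icc τ τ' := ⟨le_rfl, hw⟩
  have hτw' : τ' ∈ Icc τ τ' := ⟨hw, le_rfl⟩
  have hwin4 : ∀ u ∈ Icc τ τ', dist (X 0) (X u) ≤ 4 * R := fun u hu => by
    rw [dist_comm]; linarith [hwin u hu]
  set i := c (X 0) with hi
  have hsub : closedBall (X 0) lam ⊆ K i := h.subset (X 0)
  have memK : ∀ p, dist p (X 0) ≤ 2 * R → p ∈ K i := fun p hp => hsub (by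
    rw [mem_closedBall]; linarith)
  have hXK : ∀ u ∈ Icc τ τ', X u ∈ K i := fun u hu => memK _ (by linarith [hwin u hu])
  have hYK : ∀ u ∈ Icc τ τ', Y u ∈ K i := fun u hu => memK _ (by linarith [hwinY u hu])
  have hxc : ContinuousOn (fun u => ψ i (X u)) (Icc τ τ') :=
    (h.cont i).comp hXc.continuousOn hXK
  have hyc : ContinuousOn (fun u => ψ i (Y u)) (Icc τ τ') :=
    (h.cont i).comp hYc.continuousOn hYK
  -- the joining segment
  obtain ⟨_, ⟨α, hα, rfl⟩, _, ⟨α', hα', rfl⟩, sα, sα', segx, segy⟩ := exists_segment_inter_eq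
    (isCompact_Icc.image_of_continuousOn hxc) (isCompact_Icc.image_of_continuousOn hyc)
    (mem_image_of_mem _ h0w) (mem_image_of_mem _ h0w)
  simp only at sα sα' segx segy
  have hclose0 : ‖ψ i (Y 0) - ψ i (X 0)‖ < min μa ρ := Ka i _ (hYK 0 h0w) _ (hXK 0 h0w) (by
    rw [dist_comm]; exact (hXY.close 0).trans_le q1)
  have nα := norm_sub_left_le_of_mem_segment sα
  have nα' := norm_sub_left_le_of_mem_segment sα'
  have near_of : ∀ p ∈ K i, ‖ψ i p - ψ i (X 0)‖ ≤ ‖ψ i (Y 0) - ψ i (X 0)‖ →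
      dist p (X 0) < a / 2 := fun p hp hn => by
    by_contra! hcon
    linarith [Ma i p hp _ (hXK 0 h0w) hcon, min_le_left μa ρ]
  have arc0 : ∀ b ∈ Icc τ τ', dist (X b) (X 0) < a → ∀ u ∈ uIcc 0 b, dist (X 0) (X u) < η := by
    intro b hb hd u hu
    have e : ∀ s, φ s (X 0) = X s := fun s => by rw [hXY.orbit, add_zero]
    have := A (X 0) 0 b (by rw [e, e, dist_comm]; exact hd) (fun v hv => by
      rw [e, e]; linarith [hwin4 v (uIcc_subset_Icc h0w hb hv)]) u hu
    rwa [e, e] at this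
  have arcα := arc0 α hα (by linarith [near_of _ (hXK α hα) nα])
  have arcα' := arc0 α' hα' (by
    linarith [near_of _ (hYK α' hα') nα', dist_triangle (X α') (Y α') (X 0), hXY.close α'])
  have hαη : dist (X 0) (X α) < η := arcα α right_mem_uIcc
  have hfar : ∀ t ∈ Icc τ τ', ∀ b ∈ Icc τ τ', α ∈ uIcc t b → dist (X b) (X 0) = 3 / 2 * R →
      10 * ρ ≤ ‖ψ i (X t) - ψ i (X b)‖ := fun t ht b hb hm hd => by
    have e : ∀ s, φ s (X 0) = X s := fun s => by rw [hXY.orbit, add_zero]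
    rw [show 10 * ρ = μ by rw [hρdef]; ring]
    refine Mμ i _ (hXK t ht) _ (hXK b hb) ?_
    by_contra! hcon
    have := H.arc (X 0) t b (by rw [e, e]; exact hcon.le) (fun v hv => by
      rw [e, e]
      linarith [hwin v (uIcc_subset_Icc ht hb hv), hwin t ht,
        dist_triangle_right (X t) (X v) (X 0)]) α hm
    rw [e, e] at this
    linarith [dist_triangle4 (X b) (X t) (X α) (X 0), dist_comm (X b) (X t),
      dist_comm (X 0) (X α)]
  have hJ : JoinedArcs (fun u => ψ i (X u)) (fun u => ψ i (Y u)) τ τ' α α' ρ := by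
    have hdisj := hXY.disj _ _ _ hwin4
    rw [← uIcc_of_le hw] at hxc hyc hα hα'
    refine ⟨hxc, hyc, hα, hα', ?_, ?_, ?_, ?_, ?_, ?_, ?_, ?_, ?_⟩ <;> rw [uIcc_of_le hw] at * 
    · exact (h.inj i).comp (hXY.injX _ _ _ hwin4) hXK
    · exact (h.inj i).comp (hXY.injY _ _ _ hwin4) hYK
    · exact fun s hs t ht he => hdisj s hs t ht (h.inj i (hXK s hs) (hYK t ht) he)
    · exact fun t ht hs => hXY.injX _ _ _ hwin4 ht hα
        (h.inj i (hXK t ht) (hXK α hα) (segx _ (mem_image_of_mem _ ht) hs))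
    · exact fun t ht hs => hXY.injY _ _ _ hwin4 ht hα'
        (h.inj i (hYK t ht) (hYK α' hα') (segy _ (mem_image_of_mem _ ht) hs))
    · exact fun t ht => Kκ i _ (hYK t ht) _ (hXK t ht) (by
        rw [dist_comm]; linarith [hXY.close t])
    · intro t ht
      have htη : dist (X 0) (X t) < η := by
        rcases uIcc_subset_uIcc_union_uIcc (b := 0) ht with h1 | h1
        · exact arcα t (by rwa [uIcc_comm])
        · exact arcα' t h1
      have htw : t ∈ Icc τ τ' := uIcc_subset_Icc hα hα' ht
      refine Kκ i _ (hYK t htw) _ (hXK α hα) ?_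
      linarith [dist_triangle4_left (Y t) (X α) (X t) (X 0), hXY.close t, dist_comm (X t) (X 0), dist_triangle4 (Y t) (X t) (X 0) (X α), dist_comm (X t) (Y t)]
    · intro t ht
      refine hfar t (uIcc_subset_Icc hα hτw ht) τ' hτw' ?_ hτ'd
      rw [uIcc_of_ge hα.1] at ht
      exact Icc_subset_uIcc ⟨ht.2, hα.2⟩
    · intro t ht
      refine hfar t (uIcc_subset_Icc hα hτw' ht) τ hτw ?_ hτd
      rw [uIcc_of_le hα.2] at ht
      exact Icc_subset_uIcc' ⟨hα.1, ht.1⟩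
  obtain ⟨ν₀, hν₀, hball⟩ := Metric.eventually_nhds_iff_ball.1 hJ.eventually_not_logTrivial
  set m := midpoint ℝ (ψ i (X α)) (ψ i (Y α')) with hm
  have hm0 : ‖m - ψ i (X 0)‖ < ρ := by
    have : m ∈ segment ℝ (ψ i (X 0)) (ψ i (Y 0)) :=
      (convex_segment _ _).segment_subset sα sα' (midpoint_mem_segment _ _)
    exact (norm_sub_left_le_of_mem_segment this).trans_lt (hclose0.trans_le (min_le_right _ _))
  have hmre : 0 ≤ m.re := by
    have hconv : Convex ℝ {w : ℂ | 0 ≤ w.re} := convex_halfSpace_re_ge 0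
    exact hconv.segment_subset (h.re_nonneg i _ (hXK α hα)) (h.re_nonneg i _ (hYK α' hα'))
      (midpoint_mem_segment _ _)
  obtain ⟨ν, hν, hν1, hν2⟩ : ∃ ν > 0, 2 * ν ≤ ν₀ ∧ 2 * ν ≤ ρ :=
    ⟨min (ν₀ / 2) (ρ / 2), by positivity, by linarith [min_le_left (ν₀ / 2) (ρ / 2)],
      by linarith [min_le_right (ν₀ / 2) (ρ / 2)]⟩
  have hdisc : ∀ w ∈ ball (m + ν) ν, ‖w - m‖ < 2 * ν ∧ 0 ≤ w.re := fun w hw => by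
    rw [mem_ball_iff_norm] at hw
    constructor
    · have : w - m = (w - (m + ν)) + ν := by ring
      rw [this]
      refine (norm_add_le _ _).trans_lt ?_
      rw [Complex.norm_real, Real.norm_of_nonneg hν.le]
      linarith
    · have := (Complex.abs_re_le_norm _).trans_lt hw
      simp only [Complex.sub_re, Complex.add_re, Complex.ofReal_re] at this
      linarith [(abs_lt.1 this).1]
  have hdisc0 : ∀ w ∈ ball (m + ν) ν, ‖w - ψ i (X 0)‖ < 2 * ρ := fun w hw => by
    linarith [norm_sub_le_norm_sub_add_norm_sub w m (ψ i (X 0)), (hdisc w hw).1]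
  refine ⟨i, m + ν, ν, hν, fun w hw => ?_, fun p hp hpw hoff => ?_⟩
  · obtain ⟨p, hp, rfl⟩ := h.surj (X 0) (X τ') (by rw [mem_ball, hτ'd]; linarith) w
      (hdisc w hw).2 (by
        have := Mμ i _ (hXK τ' hτw') _ (hXK 0 h0w) (by rw [hτ'd]; linarith)
        linarith [hdisc0 w hw])
    exact ⟨p, hsub (ball_subset_closedBall (ball_subset_ball (by linarith [h.lam_pos]) hp)), rfl⟩
  have hpd : dist p (X 0) < R / 32 := by
    by_contra! hcon
    linarith [Mμ i p hp _ (hXK 0 h0w) (by linarith), hdisc0 _ hpw]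
  have hXp : ∀ u ∈ Icc τ τ', dist (X u) p ≤ 2 * R := fun u hu => by
    linarith [dist_triangle_right (X u) p (X 0), hwin u hu]
  have hYp : ∀ u ∈ Icc τ τ', dist (Y u) p ≤ 2 * R := fun u hu => by
    linarith [dist_triangle_right (Y u) p (X 0), hwinY u hu]
  have hfarp : ∀ u, dist (X u) (X 0) = 3 / 2 * R → R ≤ dist (X u) p := fun u hu => by
    linarith [dist_triangle (X u) p (X 0)]
  have hoff' : ∀ t, X t ≠ p := fun t => by simpa [hφ.zero] using hoff 0 t
  have hoffY : ∀ t, Y t ≠ p := fun t => by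
    obtain ⟨s, hs⟩ := hXY.mem_orbit t
    rw [hs]; exact hoff' s
  have hcap : Captured ψ c R X Y p τ τ' := by
    refine ⟨hw, hXp, hfarp _ hτd, hfarp _ hτ'd, fun hl => ?_⟩
    refine hball (ψ i p) (by rw [mem_ball_iff_norm]; linarith [(hdisc _ hpw).1])
      (H.transfer p i ?_ X Y τ τ' hw hXc.continuousOn hYc.continuousOn
        (fun u hu => ⟨?_, ?_, hoff' u⟩) (fun u hu => ⟨?_, ?_, hoffY u⟩) (hXY.close _)
        (hXY.close _) ?_ ?_ hl)
    · exact (closedBall_subset_closedBall' (by linarith)).trans hsub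
    · rw [mem_ball]; linarith [hXp u hu]
    · rw [mem_closedBall]; linarith [hXp u hu]
    · rw [mem_ball]; linarith [hYp u hu]
    · rw [mem_closedBall]; linarith [hYp u hu]
    · linarith [hfarp τ hτd]
    · linarith [hfarp τ' hτ'd]
  obtain ⟨t, -, ht⟩ := H.transport hXY (γ := fun _ => p) continuousOn_const
    (fun _ _ => hoff') (fun _ _ => by rw [dist_self]; positivity) hcap
  exact ⟨t, ht⟩

end Capture

/-- The plane does not embed in the line. -/
theorem not_injective_of_continuous_complex_real {θ : ℂ → ℝ} (hθ : Continuous θ) :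
    ¬ Function.Injective θ := fun hinj => by
  have main : ∀ x y z : ℂ, θ x < θ y → θ y < θ z → False := fun x y z hxy hyz => by
    have hc := (isConnected_compl_singleton_of_one_lt_rank (E := ℂ) (by simp) y).isPreconnected
    have ho := (hc.image θ hθ.continuousOn).ordConnected
    have hmem : ∀ w, w ≠ y → θ w ∈ θ '' {y}ᶜ := fun w hw => mem_image_of_mem θ hw
    obtain ⟨w, hw, he⟩ := ho.out (hmem x (by rintro rfl; exact hxy.false))
      (hmem z (by rintro rfl; exact hyz.false)) ⟨hxy.le, hyz.le⟩
    exact hw (hinj he)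
  have h01 : θ 0 ≠ θ 1 := hinj.ne zero_ne_one
  have h02 : θ 0 ≠ θ 2 := hinj.ne two_ne_zero.symm
  have h12 : θ 1 ≠ θ 2 := hinj.ne (by norm_num)
  rcases h01.lt_or_gt with a | a <;> rcases h02.lt_or_gt with b | b <;>
    rcases h12.lt_or_gt with d | d
  all_goals first
    | exact main _ _ _ a d
    | exact main _ _ _ b d
    | exact main _ _ _ d a
    | exact main _ _ _ d b
    | exact main _ _ _ a b
    | exact main _ _ _ b a

/-- The plane is not covered by countably many arcs. -/
theorem not_subset_iUnion_arcs {S : Type*} [TopologicalSpace S] [T2Space S] {G : ℂ → S}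
    (hG : Continuous G) (hinj : Function.Injective G) {J : Type*} [Countable J] {e : J → ℝ → S}
    {I : J → Set ℝ} (hI : ∀ j, IsCompact (I j)) (hec : ∀ j, ContinuousOn (e j) (I j))
    (hei : ∀ j, InjOn (e j) (I j)) (hcov : ∀ w, ∃ j, G w ∈ e j '' I j) : False := by
  obtain ⟨j, w, hw⟩ := nonempty_interior_of_iUnion_of_closed
    (f := fun j => G ⁻¹' (e j '' I j))
    (fun j => ((hI j).image_of_continuousOn (hec j)).isClosed.preimage hG)
    (eq_univ_of_forall fun w => by simpa only [mem_iUnion, mem_preimage] using hcov w)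
  obtain ⟨r, hr, hball⟩ := Metric.mem_nhds_iff.1 (mem_interior_iff_mem_nhds.1 hw)
  let b := OpenPartialHomeomorph.univBall w r
  have hbs : b.source = univ := OpenPartialHomeomorph.univBall_source w r
  have hbc : Continuous b := OpenPartialHomeomorph.continuous_univBall w r
  have hbi : Function.Injective b := fun x y h =>
    b.injOn (hbs ▸ mem_univ x) (hbs ▸ mem_univ y) h
  have hbm : ∀ x, b x ∈ ball w r := fun x => by
    rw [← OpenPartialHomeomorph.univBall_target w hr]
    exact b.map_source (hbs ▸ mem_univ x)
  have : CompactSpace (I j) := isCompact_iff_compactSpace.1 (hI j)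
  have hE : IsClosedEmbedding ((I j).domRestrict (e j)) :=
    (continuousOn_iff_continuous_domRestrict.1 (hec j)).isClosedEmbedding
      (injOn_iff_injective.1 (hei j))
  have hmem : ∀ x, G (b x) ∈ range ((I j).domRestrict (e j)) := fun x => by
    obtain ⟨t, ht, he⟩ := hball (hbm x)
    exact ⟨⟨t, ht⟩, he⟩
  let θ : ℂ → ℝ := fun x => (hE.isEmbedding.toHomeomorph.symm ⟨G (b x), hmem x⟩ : I j)
  refine not_injective_of_continuous_complex_real (θ := θ) ?_ fun x y h => ?_
  · exact continuous_subtype_val.comp (hE.isEmbedding.toHomeomorph.symm.continuous.comp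
      ((hG.comp hbc).subtype_mk _))
  · have h1 := hE.isEmbedding.toHomeomorph.symm.injective (Subtype.ext h)
    exact hbi (hinj (Subtype.ext_iff.1 h1))

/-- A flow on a compact surface which is geometric separating is geometric expansive. -/
theorem SeparatingAt.geomExpansive {S : Type*} [MetricSpace S] [CompactSpace S] [Nonempty S]
    [ChartedSpace (EuclideanHalfSpace 2) S] {φ : ℝ → S → S} (hφ : IsFlow φ) {δ : ℝ} (hδ0 : 0 < δ)
    (hδ : SeparatingAt φ δ) : GeomExpansive φ := by
  by_contra hne
  obtain ⟨T, ψ, K, c, lam, r₀, h⟩ := exists_chartCover (S := S)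
  obtain ⟨R₀, hR₀⟩ := exists_isolatingRadius hφ hδ0 hδ
  have p1 := hR₀.pos
  have p2 := h.lam_pos
  have p3 := h.r₀_pos
  obtain ⟨R, hRp, r1, r2, r3, r4⟩ : ∃ R > 0, 16 * R ≤ R₀ ∧ 8 * R ≤ lam ∧ 8 * R ≤ r₀ ∧ 6 * R < δ := by
    refine ⟨min (min (R₀ / 16) (lam / 8)) (min (r₀ / 8) (δ / 7)), by positivity, ?_⟩
    set m := min (min (R₀ / 16) (lam / 8)) (min (r₀ / 8) (δ / 7))
    have h1 : m ≤ R₀ / 16 := (min_le_left _ _).trans (min_le_left _ _)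
    have h2 : m ≤ lam / 8 := (min_le_left _ _).trans (min_le_right _ _)
    have h3 : m ≤ r₀ / 8 := (min_le_right _ _).trans (min_le_left _ _)
    have h4 : m ≤ δ / 7 := (min_le_right _ _).trans (min_le_right _ _)
    refine ⟨?_, ?_, ?_, ?_⟩ <;> linarith
  have hR : IsolatingRadius φ (8 * R) := hR₀.mono (by positivity) (by linarith)
  obtain ⟨ε₁, hε₁, c₀, hc₀, e₁, he₁, H⟩ := h.exists_tracking hφ hR r2 r3
  obtain ⟨e₂, he₂, Hcap⟩ := h.exists_capture hφ hR hε₁ (H e₁ he₁ le_rfl).1.ε₁_le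
  set ε := min e₁ e₂ with hεdef
  have hε : 0 < ε := lt_min he₁ he₂
  obtain ⟨X, Y, hXY⟩ := exists_shadowPair hφ hδ0 hδ hR₀ hne hε
  have hXY : ShadowPair φ (4 * R) ε X Y := hXY.mono (by linarith)
  obtain ⟨H₁, H₂⟩ := H ε hε (min_le_left _ _)
  obtain ⟨i, m, ν, hν, hball, hcap⟩ := Hcap ε c₀ X Y (min_le_right _ _) H₁ hXY
  let b := OpenPartialHomeomorph.univBall m ν
  have hbs : b.source = univ := OpenPartialHomeomorph.univBall_source m ν
  have hbm : ∀ x, b x ∈ ball m ν := fun x => by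
    rw [← OpenPartialHomeomorph.univBall_target m hν]
    exact b.map_source (hbs ▸ mem_univ x)
  let G : ℂ → S := fun x => Function.invFunOn (ψ i) (K i) (b x)
  have hGK : ∀ x, G x ∈ K i := fun x => Function.invFunOn_mem (hball (hbm x))
  have hGψ : ∀ x, ψ i (G x) = b x := fun x => Function.invFunOn_eq (hball (hbm x))
  have hGc : Continuous G := (h.continuousOn_invFunOn i).comp_continuous
    (OpenPartialHomeomorph.continuous_univBall m ν) fun x => hball (hbm x)
  have hGi : Function.Injective G := fun x y hxy => by
    refine b.injOn (hbs ▸ mem_univ x) (hbs ▸ mem_univ y) ?_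
    rw [← hGψ, ← hGψ, hxy]
  -- countably many orbits
  have hv : ∀ o : Option ℤ × Option ℤ, ∃ v, ∀ p, Follows φ R c₀ X p o → ∃ t, p = φ t v := fun o => by
    by_cases ho : ∃ v, Follows φ R c₀ X v o
    · obtain ⟨v, hv⟩ := ho
      exact ⟨v, fun p hp => hv.orbit_eq hφ hδ r4 hp⟩
    · exact ⟨X 0, fun p hp => absurd ⟨p, hp⟩ ho⟩
  choose v hv using hv
  let V : Option (Option ℤ × Option ℤ) → S := fun j => j.elim (X 0) v
  have hcov : ∀ x, ∃ j t, G x = φ t (V j) := fun x => by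
    by_cases hoff : ∀ s t, X t ≠ φ s (G x)
    · obtain ⟨t, ht⟩ := hcap _ (hGK x) (by rw [hGψ]; exact hbm x) hoff
      obtain ⟨o, ho⟩ := H₁.exists_follows H₂ hXY hoff ht
      obtain ⟨s, hs⟩ := hv o _ ho
      exact ⟨some o, s, hs⟩
    · push Not at hoff
      obtain ⟨s, t, hst⟩ := hoff
      refine ⟨none, -s + t, ?_⟩
      change _ = φ _ (X 0)
      rw [hXY.orbit, add_zero, ← hXY.orbit, hst, hφ.neg_cancel]
  let e : Option (Option ℤ × Option ℤ) × ℤ → ℝ → S := fun j t => φ t (V j.1)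
  classical
  let I : Option (Option ℤ × Option ℤ) × ℤ → Set ℝ := fun j =>
    if ∀ t, φ t (V j.1) = V j.1 then {0} else Icc (j.2 * c₀) (j.2 * c₀ + c₀)
  refine not_subset_iUnion_arcs hGc hGi (e := e) (I := I) (fun j => ?_)
    (fun j => (hφ.continuous_time _).continuousOn) (fun j => ?_) fun x => ?_
  · simp only [I]
    split_ifs
    · exact isCompact_singleton
    · exact isCompact_Icc
  · simp only [I]
    split_ifs with hf
    · exact injOn_singleton _ _
    · have key : ∀ s ∈ Icc (j.2 * c₀) (j.2 * c₀ + c₀), ∀ t ∈ Icc (j.2 * c₀) (j.2 * c₀ + c₀),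
          φ s (V j.1) = φ t (V j.1) → ¬ s < t := fun s hs t ht he hst => by
        refine hf (hR.fixed_of_periodic hφ (c := V j.1) (sub_pos.2 hst) ?_ fun u hu => ?_)
        · rw [sub_eq_neg_add, ← hφ.add, ← he, hφ.neg_cancel]
        · have := H₁.slow (V j.1) u (by
            rw [abs_of_nonneg hu.1]; linarith [hu.2, hs.1, ht.2])
          linarith
      intro s hs t ht he
      exact le_antisymm (not_lt.1 (key t ht s hs he.symm)) (not_lt.1 (key s hs t ht he))
  · obtain ⟨j, t, hjt⟩ := hcov x
    by_cases hf : ∀ t, φ t (V j) = V j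
    · refine ⟨(j, 0), 0, ?_, ?_⟩
      · simp only [I, if_pos hf]; rfl
      · simp only [e]; rw [hjt, hf, hf]
    · refine ⟨(j, ⌊t / c₀⌋), t, ?_, hjt.symm⟩
      simp only [I, if_neg hf]
      have h1 := Int.floor_le (t / c₀)
      have h2 := Int.lt_floor_add_one (t / c₀)
      rw [le_div_iff₀ hc₀] at h1
      rw [div_lt_iff₀ hc₀] at h2
      exact ⟨h1, by linarith⟩

/-- A continuous flow on a compact surface is geometric separating iff it is
geometric expansive. -/
theorem stmt4 {S : Type*} [MetricSpace S] [CompactSpace S] [ConnectedSpace S]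
    [ChartedSpace (EuclideanHalfSpace 2) S]
    (φ : ℝ → S → S) (hφ : IsFlow φ) :
    GeomSeparating φ ↔ GeomExpansive φ := by
  constructor
  · rintro ⟨δ, hδ0, hδ⟩
    exact SeparatingAt.geomExpansive hφ hδ0 hδ
  · intro h
    obtain ⟨δ, hδ0, hδ⟩ := h 1 one_pos
    refine ⟨δ, hδ0, fun x y g h1 h2 h3 h4 => ?_⟩
    obtain ⟨z, a, b, -, ⟨s, -, rfl⟩, ⟨t, -, rfl⟩, -⟩ := hδ x y g h1 h2 h3 h4
    exact ⟨t - s, by simp only [hφ.add, sub_add_cancel]⟩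
end
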